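/- arXiv:2008.00014 — 3 statements merged into one kernel-verified Lean document; each statement's English description precedes it below -/
import Mathlib

section
/- A matroid M is representable over both 𝔽₃ and the field ℚ of rational numbers if and only if M is representable over every field of characteristic different from 2. -/
universe u v w

open Matroid Set

namespace Paper

/-- The deletion of the set `D` from the matroid `M`. -/
def delete {α : Type u} (M : Matroid α) (D : Set α) : Matroid α := M ↾ (M.E \ D)

/-- The contraction of the set `C` in the matroid `M`. -/
def contract {α : Type u} (M : Matroid α) (C : Set α) : Matroid α := (delete M✶ C)✶

/-- `N` is a minor of `M`: it is obtained from `M` by a sequence of deletions and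
contractions, equivalently by a single contraction followed by a single deletion. -/
def IsMinor {α : Type u} (N M : Matroid α) : Prop :=
  ∃ C D : Set α, N = delete (contract M C) D

/-- `M` is a copy of the uniform matroid `U(r,n)`: its ground set has `n` elements and its
independent sets are exactly the subsets of the ground set with at most `r` elements. -/
def IsUniform {α : Type u} (M : Matroid α) (r n : ℕ) : Prop :=
  M.E.Finite ∧ M.E.ncard = n ∧ ∀ I ⊆ M.E, (M.Indep I ↔ I.ncard ≤ r)

/-- `M` has a minor isomorphic to the uniform matroid `U(r,n)`. -/
def HasUniformMinor {α : Type u} (M : Matroid α) (r n : ℕ) : Prop :=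
  ∃ N : Matroid α, IsMinor N M ∧ IsUniform N r n

/-- `M` is without large uniform minors: no minor of `M` is isomorphic to `U(2,5)` or
`U(3,5)`. -/
def NoLargeUniformMinors {α : Type u} (M : Matroid α) : Prop :=
  ¬ HasUniformMinor M 2 5 ∧ ¬ HasUniformMinor M 3 5

/-- `M` is isomorphic to the Fano matroid `F₇`, the matroid on the seven nonzero vectors of
`(𝔽₂)³` whose independent sets are the `𝔽₂`-linearly independent subsets. -/
def IsFano {α : Type u} (M : Matroid α) : Prop :=
  ∃ f : α → (Fin 3 → ZMod 2),
    Set.BijOn f M.E {x | x ≠ 0} ∧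
    ∀ I ⊆ M.E, (M.Indep I ↔ Set.InjOn f I ∧
      LinearIndependent (ZMod 2) (fun x : (f '' I) => (x : Fin 3 → ZMod 2)))

/-- `M` has a minor isomorphic to the Fano matroid `F₇`. -/
def HasFanoMinor {α : Type u} (M : Matroid α) : Prop :=
  ∃ N : Matroid α, IsMinor N M ∧ IsFano N

/-- `M` has a minor isomorphic to the dual Fano matroid `F₇*`. -/
def HasFanoDualMinor {α : Type u} (M : Matroid α) : Prop :=
  ∃ N : Matroid α, IsMinor N M ∧ IsFano N✶

/-- `M` is representable over the field `K`: there are a `K`-vector space `V` and a map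
`φ` from the ground type to `V` such that a set `I ⊆ M.E` is independent in `M` if and only
if the family `φ` restricted to `I` is linearly independent over `K` (equivalently, `φ` is
injective on `I` and the image `φ '' I` is linearly independent). -/
def Representable {α : Type u} (M : Matroid α) (K : Type v) [Field K] : Prop :=
  ∃ (V : Type (max u v)) (_ : AddCommGroup V) (_ : Module K V) (φ : α → V),
    ∀ I ⊆ M.E, (M.Indep I ↔ LinearIndependent K (fun x : I => φ x))

end Paper

namespace DyadicLift

/-- Pivoting the matrix `A` at the entry `(x, y)`: the row label `x` and the column label `y`
change places. -/
def pivot {X : Type*} {Y : Type*} {K : Type*} [DecidableEq X] [DecidableEq Y] [Field K]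
    (A : X → Y → K) (x : X) (y : Y) : X → Y → K := fun i j =>
  if i = x then (if j = y then (A x y)⁻¹ else A x j / A x y)
  else if j = y then -(A i y / A x y) else A i j - A i y * A x j / A x y

/-- The cross ratio of the `2 × 2` submatrix of `A` with rows `i, j` and columns `c, d`. -/
def cr {X : Type*} {Y : Type*} {K : Type*} [Field K] (A : X → Y → K) (i j : X) (c d : Y) : K :=
  A i c * A j d / (A i d * A j c)

/-- A map between fields that respects `q ↦ 1 - q` and `q ↦ q⁻¹`. -/
structure LiftFun {L : Type*} {K : Type*} [Field L] [Field K] (f : L → K) : Prop where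
  eq_zero_iff : ∀ q, f q = 0 ↔ q = 0
  one_sub : ∀ q, f (1 - q) = 1 - f q
  inv : ∀ q, f q⁻¹ = (f q)⁻¹

/-- `g` is multiplicative only at trivial products. -/
def TrivialProducts {L : Type*} {F : Type*} [Field L] [Field F] (g : L → F) : Prop :=
  ∀ p q, p ≠ 0 → q ≠ 0 → g (p * q) = g p * g q → p = 1 ∨ q = 1 ∨ p * q = 1

section LiftFun

variable {L F K : Type*} [Field L] [Field F] [Field K] {f : L → K} {g : L → F}

lemma LiftFun.zero (hf : LiftFun f) : f 0 = 0 := (hf.eq_zero_iff 0).2 rfl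

lemma LiftFun.one (hf : LiftFun f) : f 1 = 1 := by
  have := hf.one_sub 0
  rwa [hf.zero, sub_zero, sub_zero] at this

lemma LiftFun.eq_one_iff (hf : LiftFun f) (q : L) : f q = 1 ↔ q = 1 := by
  have := hf.eq_zero_iff (1 - q)
  rw [hf.one_sub, sub_eq_zero, sub_eq_zero] at this
  exact ⟨fun h => (this.1 h.symm).symm, fun h => (this.2 h.symm).symm⟩

lemma LiftFun.neg_one (hf : LiftFun f) (h2 : (-1 : L) ≠ 1) : f (-1) = -1 := by
  have h := hf.inv (-1)
  have h0 : f (-1) ≠ 0 := fun h => by simpa using (hf.eq_zero_iff _).1 h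
  have h1 : f (-1) ≠ 1 := fun h => h2 ((hf.eq_one_iff _).1 h)
  rw [inv_neg, inv_one] at h
  have h3 : f (-1) * f (-1) = 1 := by nth_rewrite 2 [h]; exact mul_inv_cancel₀ h0
  exact (mul_self_eq_one_iff.1 h3).resolve_left h1

lemma LiftFun.mul (hf : LiftFun f) (hg : TrivialProducts g) {p q : L} (hp : p ≠ 0) (hq : q ≠ 0)
    (h : g (p * q) = g p * g q) : f (p * q) = f p * f q := by
  rcases hg p q hp hq h with rfl | rfl | h
  · rw [hf.one, one_mul, one_mul]
  · rw [hf.one, mul_one, mul_one]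
  · rw [h, hf.one, eq_inv_of_mul_eq_one_right h, hf.inv, mul_inv_cancel₀]
    exact fun h => hp ((hf.eq_zero_iff _).1 h)

end LiftFun

section Pivot

variable {X Y K : Type*} [DecidableEq X] [DecidableEq Y] [Field K]

lemma pivot_self (A : X → Y → K) (x : X) (y : Y) : pivot A x y x y = (A x y)⁻¹ := by
  simp [pivot]

lemma pivot_row (A : X → Y → K) {x : X} {y j : Y} (hj : j ≠ y) :
    pivot A x y x j = A x j / A x y := by
  simp [pivot, hj]

lemma pivot_col (A : X → Y → K) {x i : X} {y : Y} (hi : i ≠ x) :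
    pivot A x y i y = -(A i y / A x y) := by
  simp [pivot, hi]

lemma pivot_ne (A : X → Y → K) {x i : X} {y j : Y} (hi : i ≠ x) (hj : j ≠ y) :
    pivot A x y i j = A i j - A i y * A x j / A x y := by
  simp [pivot, hi, hj]

lemma pivot_of_col_eq_zero (A : X → Y → K) {x i : X} {y : Y} (hi : i ≠ x) (h : A i y = 0)
    (j : Y) : pivot A x y i j = A i j := by
  by_cases hj : j = y
  · subst hj; simp [pivot_col A hi, h]
  · simp [pivot_ne A hi hj, h]

lemma pivot_of_row_eq_zero (A : X → Y → K) {x : X} {y j : Y} (hj : j ≠ y) (h : A x j = 0)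
    (i : X) : pivot A x y i j = A i j := by
  by_cases hi : i = x
  · subst hi; simp [pivot_row A hj, h]
  · simp [pivot_ne A hi hj, h]

lemma pivot_pivot (A : X → Y → K) {x : X} {y : Y} (h : A x y ≠ 0) :
    pivot (pivot A x y) x y = A := by
  funext i j
  by_cases hi : i = x <;> by_cases hj : j = y
  · subst hi hj; simp [pivot]
  · subst hi; simp [pivot, hj]; field_simp
  · subst hj; simp [pivot, hi]; field_simp
  · simp [pivot, hi, hj]; field_simp; ring

lemma pivot_pivot_same_row (A : X → Y → K) {x : X} {u c : Y} (hc : c ≠ u)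
    (hu : A x u ≠ 0) (hxc : A x c ≠ 0) :
    pivot (pivot A x u) x c = fun i j => pivot A x c i (Equiv.swap u c j) := by
  funext i j
  by_cases hj : j = c
  · subst hj
    by_cases hi : i = x
    · subst hi; simp [pivot, hc, hc.symm]
    · simp [pivot, hc, hc.symm, hi]; field_simp; ring
  by_cases hj' : j = u
  · subst hj'
    by_cases hi : i = x
    · subst hi; simp [pivot, hc, hc.symm]; field_simp
    · simp [pivot, hc, hc.symm, hi]; field_simp; ring
  rw [Equiv.swap_apply_of_ne_of_ne hj' hj]
  by_cases hi : i = x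
  · subst hi; simp [pivot, hc, hj, hj']; field_simp
  · simp [pivot, hc, hi, hj, hj']; field_simp; ring

lemma pivot_pivot_same_col (A : X → Y → K) {x z : X} {u : Y} (hz : z ≠ x)
    (hu : A x u ≠ 0) (hzu : A z u ≠ 0) :
    pivot (pivot A x u) z u = pivot (fun i j => A (Equiv.swap x z i) j) x u := by
  funext i j
  by_cases hi : i = x
  · subst hi
    by_cases hj : j = u
    · subst hj; simp [pivot, hz, hz.symm]; field_simp
    · simp [pivot, hz, hz.symm, hj]; field_simp; ring
  by_cases hi' : i = z
  · subst hi'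
    by_cases hj : j = u
    · subst hj; simp [pivot, hz]
    · simp [pivot, hz, hj]; field_simp; ring
  by_cases hj : j = u
  · subst hj; simp [pivot, hz, hi, hi', Equiv.swap_apply_of_ne_of_ne]; field_simp
  · simp [pivot, hz, hi, hi', hj, Equiv.swap_apply_of_ne_of_ne]; field_simp; ring

lemma pivot_comm (A : X → Y → K) {x z : X} {u c : Y} (hz : z ≠ x) (hc : c ≠ u)
    (hu : A x u ≠ 0) (hzc : A z c ≠ 0) (hp : pivot A x u z c ≠ 0) :
    pivot (pivot A x u) z c = pivot (pivot A z c) x u := by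
  rw [pivot_ne A hz hc] at hp
  have hp1 : A z c * A x u - A z u * A x c ≠ 0 := by
    intro h; apply hp; field_simp; linear_combination h
  have hp2 : A x u * A z c - A x c * A z u ≠ 0 := by
    intro h; apply hp1; linear_combination h
  have hp4 : A x u * A z c - A z u * A x c ≠ 0 := by
    intro h; apply hp1; linear_combination h
  have hp3 : A x u - A x c * A z u / A z c ≠ 0 := by
    intro h; apply hp2; field_simp at h; linear_combination h
  funext i j
  by_cases hi : i = x
  · subst hi
    by_cases hj : j = u
    · subst hj; simp [pivot, hz, hz.symm, hc, hc.symm]; field_simp; ring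
    by_cases hj' : j = c
    · subst hj'; simp [pivot, hz, hz.symm, hc, hc.symm]; field_simp
    · simp [pivot, hz, hz.symm, hc, hc.symm, hj, hj']; field_simp; ring
  by_cases hi' : i = z
  · subst hi'
    by_cases hj : j = u
    · subst hj; simp [pivot, hz, hz.symm, hc, hc.symm]; field_simp
    by_cases hj' : j = c
    · subst hj'; simp [pivot, hz, hz.symm, hc, hc.symm]; field_simp; ring
    · simp [pivot, hz, hz.symm, hc, hc.symm, hj, hj']; field_simp; ring
  by_cases hj : j = u
  · subst hj; simp [pivot, hz, hz.symm, hc, hc.symm, hi, hi']; field_simp; ring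
  by_cases hj' : j = c
  · subst hj'; simp [pivot, hz, hz.symm, hc, hc.symm, hi, hi']; field_simp; ring
  · simp [pivot, hz, hz.symm, hc, hc.symm, hi, hi', hj, hj']; field_simp; ring

lemma pivot_pivot_of_eq_zero (A : X → Y → K) {x z : X} {u c : Y} (hz : z ≠ x) (hc : c ≠ u)
    (hu : A x u ≠ 0) (hzc : A z c = 0) (hp : pivot A x u z c ≠ 0) :
    pivot (pivot A x u) z c =
      pivot (fun i j => pivot A x c (Equiv.swap x z i) (Equiv.swap u c j)) x c := by
  rw [pivot_ne A hz hc, hzc, zero_sub, neg_ne_zero] at hp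
  have h1 : A z u ≠ 0 := fun h => hp (by simp [h])
  have h2 : A x c ≠ 0 := fun h => hp (by simp [h])
  funext i j
  by_cases hi : i = x
  · subst hi
    by_cases hj : j = u
    · subst hj; simp [pivot, hz, hz.symm, hc, hc.symm, hzc]; field_simp; ring
    by_cases hj' : j = c
    · subst hj'; simp [pivot, hz, hz.symm, hc, hc.symm, hzc]; field_simp
    · simp [pivot, hz, hz.symm, hc, hc.symm, hj, hj', hzc, Equiv.swap_apply_of_ne_of_ne]; field_simp; ring
  by_cases hi' : i = z
  · subst hi'
    by_cases hj : j = u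
    · subst hj; simp [pivot, hz, hc, hc.symm, hzc]; field_simp
    by_cases hj' : j = c
    · subst hj'; simp [pivot, hz, hc, hc.symm, hzc]; field_simp
    · simp [pivot, hz, hc, hc.symm, hj, hj', hzc, Equiv.swap_apply_of_ne_of_ne]; field_simp; ring
  by_cases hj : j = u
  · subst hj; simp [pivot, hz, hc, hc.symm, hi, hi', hzc, Equiv.swap_apply_of_ne_of_ne]; field_simp; ring
  by_cases hj' : j = c
  · subst hj'; simp [pivot, hz, hc, hc.symm, hi, hi', hzc, Equiv.swap_apply_of_ne_of_ne]; field_simp; ring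
  · simp [pivot, hz, hc, hc.symm, hi, hi', hj, hj', hzc, Equiv.swap_apply_of_ne_of_ne]; field_simp; ring

end Pivot

section Good

variable {X Y L K : Type*} [Field L] [Field K] {f : L → K}

/-- On the rows `P` and the columns `Q` the matrix `A'` has the same support as `A`, and its
cross ratios are the images under `f` of those of `A`. -/
structure Good (f : L → K) (P : Set X) (Q : Set Y) (A : X → Y → L) (A' : X → Y → K) : Prop where
  supp : ∀ i ∈ P, ∀ c ∈ Q, A' i c = 0 ↔ A i c = 0
  cross : ∀ i ∈ P, ∀ j ∈ P, ∀ c ∈ Q, ∀ d ∈ Q, A i d ≠ 0 → A j c ≠ 0 →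
    cr A' i j c d = f (cr A i j c d)

variable {P P' : Set X} {Q Q' : Set Y} {A C : X → Y → L} {A' C' : X → Y → K}

lemma Good.ne (h : Good f P Q A A') {i : X} (hi : i ∈ P) {c : Y} (hc : c ∈ Q) (ha : A i c ≠ 0) :
    A' i c ≠ 0 := fun h0 => ha ((h.supp i hi c hc).1 h0)

lemma cr_self_row (A : X → Y → L) {i : X} {c d : Y} (h : A i c ≠ 0) (h' : A i d ≠ 0) :
    cr A i i c d = 1 := by
  unfold cr; field_simp

lemma cr_self_col (A : X → Y → L) {i j : X} {c : Y} (h : A i c ≠ 0) (h' : A j c ≠ 0) :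
    cr A i j c c = 1 := by
  unfold cr; field_simp

lemma cr_swap_row (A : X → Y → L) (i j : X) (c d : Y) : cr A j i c d = (cr A i j c d)⁻¹ := by
  unfold cr; rw [inv_div]; ring_nf

lemma cr_swap_col (A : X → Y → L) (i j : X) (c d : Y) : cr A i j d c = (cr A i j c d)⁻¹ := by
  unfold cr; rw [inv_div]; 

lemma cr_flip (A : X → Y → L) (i j : X) (c d : Y) : cr (flip A) c d i j = cr A i j c d := by
  unfold cr flip; ring_nf

lemma cr_mul_col (A : X → Y → L) {i j : X} {c e d : Y} (hi : A i e ≠ 0) (hj : A j e ≠ 0) :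
    cr A i j c e * cr A i j e d = cr A i j c d := by
  unfold cr; field_simp

lemma cr_mul_row (A : X → Y → L) {i k j : X} {c d : Y} (hi : A k c ≠ 0) (hj : A k d ≠ 0) :
    cr A i k c d * cr A k j c d = cr A i j c d := by
  unfold cr; field_simp

lemma cr_ne_zero {A : X → Y → L} {i j : X} {c d : Y} (h1 : A i c ≠ 0) (h2 : A j d ≠ 0)
    (h3 : A i d ≠ 0) (h4 : A j c ≠ 0) : cr A i j c d ≠ 0 :=
  div_ne_zero (mul_ne_zero h1 h2) (mul_ne_zero h3 h4)

lemma Good.of_ne (hf : LiftFun f) (hs : ∀ i ∈ P, ∀ c ∈ Q, A' i c = 0 ↔ A i c = 0)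
    (hc : ∀ i ∈ P, ∀ j ∈ P, ∀ c ∈ Q, ∀ d ∈ Q, i ≠ j → c ≠ d → A i c ≠ 0 → A j d ≠ 0 →
      A i d ≠ 0 → A j c ≠ 0 → cr A' i j c d = f (cr A i j c d)) : Good f P Q A A' := by
  refine ⟨hs, fun i hi j hj c hc' d hd h1 h2 => ?_⟩
  by_cases h3 : A i c = 0
  · simp [cr, h3, (hs i hi c hc').2 h3, hf.zero]
  by_cases h4 : A j d = 0
  · simp [cr, h4, (hs j hj d hd).2 h4, hf.zero]
  have h1' := mt (hs i hi d hd).1 h1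
  have h2' := mt (hs j hj c hc').1 h2
  have h3' := mt (hs i hi c hc').1 h3
  have h4' := mt (hs j hj d hd).1 h4
  by_cases hij : i = j
  · subst hij
    rw [cr_self_row _ h3 h1, cr_self_row _ h3' h1', hf.one]
  by_cases hcd : c = d
  · subst hcd
    rw [cr_self_col _ h3 h4, cr_self_col _ h3' h4', hf.one]
  exact hc i hi j hj c hc' d hd hij hcd h3 h4 h1 h2

lemma Good.mono (h : Good f P Q A A') (hP : P' ⊆ P) (hQ : Q' ⊆ Q) : Good f P' Q' A A' :=
  ⟨fun i hi c hc => h.supp i (hP hi) c (hQ hc),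
    fun i hi j hj c hc d hd => h.cross i (hP hi) j (hP hj) c (hQ hc) d (hQ hd)⟩

lemma Good.congr (h : Good f P Q A A') (hA : ∀ i ∈ P, ∀ c ∈ Q, A i c = C i c)
    (hA' : ∀ i ∈ P, ∀ c ∈ Q, A' i c = C' i c) : Good f P Q C C' := by
  refine ⟨fun i hi c hc => ?_, fun i hi j hj c hc d hd => ?_⟩
  · rw [← hA i hi c hc, ← hA' i hi c hc, h.supp i hi c hc]
  · have := h.cross i hi j hj c hc d hd
    unfold cr at *
    rwa [hA i hi c hc, hA i hi d hd, hA j hj c hc, hA j hj d hd, hA' i hi c hc, hA' i hi d hd,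
      hA' j hj c hc, hA' j hj d hd] at this

lemma Good.flip (h : Good f P Q A A') : Good f Q P (flip A) (flip A') := by
  refine ⟨fun i hi c hc => h.supp c hc i hi, fun i hi j hj c hc d hd h1 h2 => ?_⟩
  rw [cr_flip, cr_flip]
  exact h.cross c hc d hd i hi j hj h2 h1

/-- The matrix `A` with rows scaled by `r` and columns scaled by `c`. -/
def scale (r : X → L) (c : Y → L) (A : X → Y → L) : X → Y → L := fun i j => r i * A i j * c j

lemma scale_one (A : X → Y → L) : scale (fun _ => 1) (fun _ => 1) A = A := by
  funext i j; simp [scale]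

lemma scale_scale (r r₁ : X → L) (c c₁ : Y → L) (A : X → Y → L) :
    scale r c (scale r₁ c₁ A) = scale (fun i => r i * r₁ i) (fun j => c j * c₁ j) A := by
  funext i j; simp only [scale]; ring

lemma cr_scale {r : X → L} {c : Y → L} (hr : ∀ i, r i ≠ 0) (hc : ∀ j, c j ≠ 0) (A : X → Y → L)
    (i j : X) (d e : Y) : cr (scale r c A) i j d e = cr A i j d e := by
  unfold cr scale
  have := hr i; have := hr j; have := hc d; have := hc e
  rw [show r i * A i d * c d * (r j * A j e * c e) = (r i * r j * c d * c e) * (A i d * A j e) by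
    ring, show r i * A i e * c e * (r j * A j d * c d) =
      (r i * r j * c d * c e) * (A i e * A j d) by ring]
  exact mul_div_mul_left _ _ (by positivity)

lemma scale_eq_zero {r : X → L} {c : Y → L} (hr : ∀ i, r i ≠ 0) (hc : ∀ j, c j ≠ 0)
    {A : X → Y → L} {i : X} {j : Y} : scale r c A i j = 0 ↔ A i j = 0 := by
  simp [scale, hr i, hc j]

lemma Good.scale (h : Good f P Q A A') {r : X → L} {c : Y → L} (hr : ∀ i, r i ≠ 0)
    (hc : ∀ j, c j ≠ 0) {r' : X → K} {c' : Y → K} (hr' : ∀ i, r' i ≠ 0) (hc' : ∀ j, c' j ≠ 0) :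
    Good f P Q (scale r c A) (DyadicLift.scale r' c' A') := by
  refine ⟨fun i hi j hj => ?_, fun i hi j hj d hd e he h1 h2 => ?_⟩
  · rw [scale_eq_zero hr hc, scale_eq_zero hr' hc', h.supp i hi j hj]
  · rw [cr_scale hr hc, cr_scale hr' hc']
    exact h.cross i hi j hj d hd e he (mt (scale_eq_zero hr hc).2 h1)
      (mt (scale_eq_zero hr hc).2 h2)

variable [DecidableEq X] [DecidableEq Y]

lemma update_ne_zero {r : X → L} (hr : ∀ i, r i ≠ 0) (x : X) {a : L} (ha : a ≠ 0) (i : X) :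
    Function.update r x a i ≠ 0 := by
  by_cases h : i = x
  · subst h; simpa
  · simpa [h] using hr i

lemma pivot_scale {r : X → L} {c : Y → L} (hr : ∀ i, r i ≠ 0) (hc : ∀ j, c j ≠ 0) (A : X → Y → L)
    (x : X) (y : Y) : pivot (scale r c A) x y =
      scale (Function.update r x (c y)⁻¹) (Function.update c y (r x)⁻¹) (pivot A x y) := by
  funext i j
  have := hr x; have := hc y
  by_cases hi : i = x <;> by_cases hj : j = y
  · subst hi hj; simp [pivot, scale]; ring
  · subst hi; simp [pivot, scale, hj]; field_simp
  · subst hj; simp [pivot, scale, hi]; field_simp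
  · simp only [pivot, scale, hi, hj, if_false, ne_eq, not_false_eq_true, Function.update_of_ne]
    rw [show r i * A i y * c y * (r x * A x j * c j) = (r x * c y) * (r i * (A i y * A x j) * c j)
      by ring, show r x * A x y * c y = (r x * c y) * A x y by ring,
      mul_div_mul_left _ _ (by positivity)]
    ring

lemma pivot_flip (A : X → Y → L) (x : X) (y : Y) : pivot (flip A) y x =
    scale (Function.update (fun _ => 1) y (-1)) (Function.update (fun _ => 1) x (-1))
      (flip (pivot A x y)) := by
  funext j i
  by_cases hi : i = x <;> by_cases hj : j = y
  · subst hi hj; simp [pivot, scale, flip]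
  · subst hi; simp [pivot, scale, flip, hj]
  · subst hj; simp [pivot, scale, flip, hi]
  · simp [pivot, scale, flip, hi, hj, mul_comm]

lemma pivot_congr (hA : ∀ i ∈ P, ∀ c ∈ Q, A i c = C i c) {x : X} (hx : x ∈ P) {y : Y}
    (hy : y ∈ Q) : ∀ i ∈ P, ∀ c ∈ Q, pivot A x y i c = pivot C x y i c := by
  intro i hi c hc
  unfold pivot
  rw [hA i hi c hc, hA x hx c hc, hA i hi y hy, hA x hx y hy]

/-- `A'` is a lift of `A` along `f` on the rows `P` and the columns `Q`, robustly under pivots in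
the columns `S`. -/
def Lift (f : L → K) (P : Set X) (Q S : Set Y) (A : X → Y → L) (A' : X → Y → K) : Prop :=
  ∃ R : (X → Y → L) → (X → Y → K) → Prop, R A A' ∧ ∀ C C', R C C' → Good f P Q C C' ∧
    ∀ x ∈ P, ∀ y ∈ S, C x y ≠ 0 → R (pivot C x y) (pivot C' x y)

variable {S S' : Set Y}

lemma Lift.good (h : Lift f P Q S A A') : Good f P Q A A' := by
  obtain ⟨R, h1, h2⟩ := h
  exact (h2 _ _ h1).1

lemma Lift.pivot (h : Lift f P Q S A A') {x : X} (hx : x ∈ P) {y : Y} (hy : y ∈ S)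
    (ha : A x y ≠ 0) : Lift f P Q S (pivot A x y) (pivot A' x y) := by
  obtain ⟨R, h1, h2⟩ := h
  exact ⟨R, (h2 _ _ h1).2 x hx y hy ha, h2⟩

lemma pivot_apply_ne_zero {x : X} {y : Y} (ha : A x y ≠ 0) : DyadicLift.pivot A x y x y ≠ 0 := by
  rw [pivot_self]; exact inv_ne_zero ha

lemma Lift.of_pivot {x : X} {y : Y} (h : Lift f P Q S (DyadicLift.pivot A x y) A') (hx : x ∈ P)
    (hy : y ∈ S) (ha : A x y ≠ 0) : Lift f P Q S A (DyadicLift.pivot A' x y) := by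
  have := h.pivot hx hy (pivot_apply_ne_zero ha)
  rwa [pivot_pivot _ ha] at this

lemma Lift.mono (h : Lift f P Q S A A') (hP : P' ⊆ P) (hQ : Q' ⊆ Q) (hS : S' ⊆ S) :
    Lift f P' Q' S' A A' := by
  obtain ⟨R, h1, h2⟩ := h
  exact ⟨R, h1, fun C C' hR => ⟨(h2 C C' hR).1.mono hP hQ,
    fun x hx y hy => (h2 C C' hR).2 x (hP hx) y (hS hy)⟩⟩

lemma Lift.congr (h : Lift f P Q S A A') (hS : S ⊆ Q) (hA : ∀ i ∈ P, ∀ c ∈ Q, A i c = C i c)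
    (hA' : ∀ i ∈ P, ∀ c ∈ Q, A' i c = C' i c) : Lift f P Q S C C' := by
  refine ⟨fun C C' => ∃ D D', Lift f P Q S D D' ∧ (∀ i ∈ P, ∀ c ∈ Q, D i c = C i c) ∧
    ∀ i ∈ P, ∀ c ∈ Q, D' i c = C' i c, ⟨A, A', h, hA, hA'⟩, ?_⟩
  rintro C C' ⟨D, D', hD, h1, h2⟩
  refine ⟨hD.good.congr h1 h2, fun x hx y hy hxy => ⟨_, _, hD.pivot hx hy ?_,
    pivot_congr h1 hx (hS hy), pivot_congr h2 hx (hS hy)⟩⟩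
  rwa [h1 x hx y (hS hy)]

lemma Lift.scale (h : Lift f P Q S A A') {r : X → L} {c : Y → L} (hr : ∀ i, r i ≠ 0)
    (hc : ∀ j, c j ≠ 0) {r' : X → K} {c' : Y → K} (hr' : ∀ i, r' i ≠ 0) (hc' : ∀ j, c' j ≠ 0) :
    Lift f P Q S (scale r c A) (DyadicLift.scale r' c' A') := by
  refine ⟨fun C C' => ∃ D D', ∃ r : X → L, ∃ c : Y → L, ∃ r' : X → K, ∃ c' : Y → K,
    Lift f P Q S D D' ∧ (∀ i, r i ≠ 0) ∧ (∀ j, c j ≠ 0) ∧ (∀ i, r' i ≠ 0) ∧ (∀ j, c' j ≠ 0) ∧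
    C = DyadicLift.scale r c D ∧ C' = DyadicLift.scale r' c' D',
    ⟨A, A', r, c, r', c', h, hr, hc, hr', hc', rfl, rfl⟩, ?_⟩
  rintro _ _ ⟨D, D', r, c, r', c', hD, hr, hc, hr', hc', rfl, rfl⟩
  refine ⟨hD.good.scale hr hc hr' hc', fun x hx y hy hxy => ⟨_, _, _, _, _, _,
    hD.pivot hx hy (mt (scale_eq_zero hr hc).2 hxy), ?_, ?_, ?_, ?_, pivot_scale hr hc _ _ _,
    pivot_scale hr' hc' _ _ _⟩⟩
  all_goals refine update_ne_zero (by assumption) _ (inv_ne_zero ?_)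
  exacts [hc y, hr x, hc' y, hr' x]

lemma Lift.scale_right (h : Lift f P Q S A A') {r' : X → K} {c' : Y → K} (hr' : ∀ i, r' i ≠ 0)
    (hc' : ∀ j, c' j ≠ 0) : Lift f P Q S A (DyadicLift.scale r' c' A') := by
  have := h.scale (r := fun _ => 1) (c := fun _ => 1) (by simp) (by simp) hr' hc'
  rwa [scale_one] at this

lemma pivot_relabel {σ : X → X} (hσ : σ.Injective) {τ : Y → Y} (hτ : τ.Injective)
    (A : X → Y → L) (x : X) (y : Y) : DyadicLift.pivot (fun i j => A (σ i) (τ j)) x y =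
      fun i j => DyadicLift.pivot A (σ x) (τ y) (σ i) (τ j) := by
  funext i j
  simp [DyadicLift.pivot, hσ.eq_iff, hτ.eq_iff]

lemma Lift.relabel (h : Lift f P Q S A A') {σ : X → X} (hσ : σ.Injective) {τ : Y → Y}
    (hτ : τ.Injective) (hP : ∀ i ∈ P', σ i ∈ P) (hQ : ∀ j ∈ Q', τ j ∈ Q)
    (hS : ∀ j ∈ S', τ j ∈ S) :
    Lift f P' Q' S' (fun i j => A (σ i) (τ j)) (fun i j => A' (σ i) (τ j)) := by
  refine ⟨fun C C' => ∃ D D', Lift f P Q S D D' ∧ C = (fun i j => D (σ i) (τ j)) ∧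
    C' = (fun i j => D' (σ i) (τ j)), ⟨A, A', h, rfl, rfl⟩, ?_⟩
  rintro _ _ ⟨D, D', hD, rfl, rfl⟩
  refine ⟨⟨fun i hi j hj => hD.good.supp _ (hP i hi) _ (hQ j hj), fun i hi j hj c hc d hd =>
    hD.good.cross _ (hP i hi) _ (hP j hj) _ (hQ c hc) _ (hQ d hd)⟩, fun x hx y hy hxy =>
    ⟨_, _, hD.pivot (hP x hx) (hS y hy) hxy, pivot_relabel hσ hτ _ _ _, pivot_relabel hσ hτ _ _ _⟩⟩

lemma pivot_scale_flip {r : Y → L} {c : X → L} (hr : ∀ i, r i ≠ 0) (hc : ∀ i, c i ≠ 0)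
    (A : X → Y → L) (x : X) (y : Y) : ∃ r₁ : Y → L, ∃ c₁ : X → L, (∀ i, r₁ i ≠ 0) ∧
      (∀ i, c₁ i ≠ 0) ∧ DyadicLift.pivot (scale r c (flip A)) y x =
        scale r₁ c₁ (flip (DyadicLift.pivot A x y)) := by
  rw [pivot_scale hr hc, pivot_flip, scale_scale]
  refine ⟨_, _, fun i => mul_ne_zero ?_ ?_, fun i => mul_ne_zero ?_ ?_, rfl⟩
  · exact update_ne_zero hr _ (inv_ne_zero (hc x)) _
  · exact update_ne_zero (by simp) _ (by simp) _
  · exact update_ne_zero hc _ (inv_ne_zero (hr y)) _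
  · exact update_ne_zero (by simp) _ (by simp) _

lemma Lift.flip (h : Lift f P Q Q A A') : Lift f Q P P (flip A) (flip A') := by
  refine ⟨fun C C' => ∃ D D', ∃ r : Y → L, ∃ c : X → L, ∃ r' : Y → K, ∃ c' : X → K,
    Lift f P Q Q D D' ∧ (∀ i, r i ≠ 0) ∧ (∀ j, c j ≠ 0) ∧ (∀ i, r' i ≠ 0) ∧ (∀ j, c' j ≠ 0) ∧
    C = DyadicLift.scale r c (_root_.flip D) ∧ C' = DyadicLift.scale r' c' (_root_.flip D'),
    ⟨A, A', fun _ => 1, fun _ => 1, fun _ => 1, fun _ => 1, h, by simp, by simp, by simp, by simp,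
      (scale_one _).symm, (scale_one _).symm⟩, ?_⟩
  rintro _ _ ⟨D, D', r, c, r', c', hD, hr, hc, hr', hc', rfl, rfl⟩
  refine ⟨hD.good.flip.scale hr hc hr' hc', fun y hy x hx hxy => ?_⟩
  obtain ⟨r₁, c₁, h1, h2, h3⟩ := pivot_scale_flip hr hc D x y
  obtain ⟨r₁', c₁', h1', h2', h3'⟩ := pivot_scale_flip hr' hc' D' x y
  exact ⟨_, _, _, _, _, _, hD.pivot hx hy (fun h0 => hxy ((scale_eq_zero hr hc).2 h0)), h1, h2, h1', h2',
    h3, h3'⟩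

end Good

section PivotCrossRatio

variable {X Y K : Type*} [DecidableEq X] [DecidableEq Y] [Field K] (A : X → Y → K)

lemma cr_pivot_self {x i : X} {y d : Y} (hi : i ≠ x) (hd : d ≠ y) (h : A x y ≠ 0)
    (h1 : A x d ≠ 0) (h2 : A i y ≠ 0) :
    cr (pivot A x y) x i y d = 1 - cr A x i y d := by
  rw [cr, pivot_self, pivot_row A hd, pivot_col A hi, pivot_ne A hi hd, cr]
  field_simp
  ring

lemma pivot_ne_eq_mul {x i : X} {y d : Y} (hi : i ≠ x) (hd : d ≠ y) (h : A x y ≠ 0)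
    (h1 : A i d ≠ 0) : pivot A x y i d = A i d * (1 - cr A x i d y) := by
  rw [pivot_ne A hi hd, cr]
  field_simp

lemma cr_pivot_row_of_eq_zero {x j : X} {y c d : Y} (hj : j ≠ x) (hc : c ≠ y) (hd : d ≠ y)
    (h : A x y ≠ 0) (h1 : A x c ≠ 0) (h2 : A x d ≠ 0) (h3 : A j y ≠ 0) (h4 : A j c = 0) :
    cr (pivot A x y) x j c d = 1 - cr A x j y d := by
  rw [cr, pivot_row A hc, pivot_row A hd, pivot_ne A hj hc, pivot_ne A hj hd, cr, h4]
  field_simp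
  ring

lemma cr_pivot_row_of_cr_eq_one {x j : X} {y c d : Y} (hj : j ≠ x) (hc : c ≠ y) (hd : d ≠ y)
    (h : A x y ≠ 0) (h2 : A x d ≠ 0) (h3 : A j c ≠ 0)
    (h5 : cr A x j c d = 1) (h6 : pivot A x y j c ≠ 0) : cr (pivot A x y) x j c d = 1 := by
  have h7 : A x c * A j d = A x d * A j c := by
    rw [cr, div_eq_one_iff_eq (mul_ne_zero h2 h3)] at h5; exact h5
  rw [cr, pivot_row A hc, pivot_row A hd, pivot_ne A hj hd]
  rw [pivot_ne A hj hc] at h6 ⊢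
  rw [div_eq_one_iff_eq (mul_ne_zero (div_ne_zero h2 h) h6)]
  field_simp
  linear_combination A x y * h7

lemma pivot_ne_eq_zero_iff {x i : X} {u c : Y} (hi : i ≠ x) (hc : c ≠ u) (hu : A x u ≠ 0)
    (h1 : A i u ≠ 0) (h2 : A x c ≠ 0) : pivot A x u i c = 0 ↔ 1 - cr A i x c u = 0 := by
  rw [pivot_ne _ hi hc, sub_eq_zero, sub_eq_zero, cr, eq_div_iff hu, eq_comm (a := (1 : K)),
    div_eq_one_iff_eq (mul_ne_zero h1 h2)]

lemma cr_pivot_row_of_col_eq_zero {x j : X} {u c d : Y} (hj : j ≠ x) (hc : c ≠ u) (hd : d ≠ u)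
    (hu : A x u ≠ 0) (h1 : A j u = 0) : cr (pivot A x u) x j c d = cr A x j c d := by
  rw [cr, pivot_of_col_eq_zero _ hj h1, pivot_of_col_eq_zero _ hj h1, pivot_row _ hc,
    pivot_row _ hd, cr, div_mul_eq_mul_div, div_mul_eq_mul_div, div_div_div_cancel_right₀ hu]

lemma pivot_flip_eq_zero_iff (x : X) (u : Y) (i : X) (c : Y) :
    pivot (flip A) u x c i = 0 ↔ pivot A x u i c = 0 := by
  rw [pivot_flip, scale_eq_zero (update_ne_zero (by simp) _ (by simp))
    (update_ne_zero (by simp) _ (by simp))]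
  rfl

lemma cr_pivot_flip (x : X) (u : Y) (i j : X) (c d : Y) :
    cr (pivot (flip A) u x) c d i j = cr (pivot A x u) i j c d := by
  rw [pivot_flip, cr_scale (update_ne_zero (by simp) _ (by simp))
    (update_ne_zero (by simp) _ (by simp)), cr_flip]

variable {A} {x i j : X} {u c d : Y} (hi : i ≠ x) (hj : j ≠ x) (hij : i ≠ j) (hc : c ≠ u)
  (hd : d ≠ u) (hcd : c ≠ d) (hu : A x u ≠ 0)

include hi hj hc hd hu

include hij hcd in
lemma cr_pivot_ne₁ (h1 : A x d = 0) (h2 : A i u = 0) (h3 : A j c = 0) (h4 : A i d ≠ 0)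
    (h6 : A x c ≠ 0) (h7 : A j u ≠ 0) :
    cr (pivot A x u) i j c d = cr (pivot A i d) x j u c := by
  rw [cr, cr, pivot_ne A hi hc, pivot_ne A hj hd, pivot_ne A hi hd, pivot_ne A hj hc,
    pivot_ne A hi.symm hd.symm, pivot_ne A hij.symm hcd, pivot_ne A hi.symm hcd,
    pivot_ne A hij.symm hd.symm, h1, h2, h3]
  simp only [zero_mul, zero_div, mul_zero, sub_zero, zero_sub]
  field_simp

lemma cr_pivot_ne₂ (h1 : A x d = 0) (h2 : A i u = 0) (h3 : A j c ≠ 0) (h4 : A i d ≠ 0)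
    (h5 : pivot A x u j c ≠ 0) :
    cr (pivot A x u) i j c d * (1 - cr A x j c u) = cr A i j c d := by
  rw [pivot_ne_eq_mul A hj hc hu h3] at h5
  have h6 := right_ne_zero_of_mul h5
  rw [cr, pivot_ne_eq_mul A hj hc hu h3, pivot_ne A hi hc, pivot_ne A hj hd, pivot_ne A hi hd,
    h1, h2]
  unfold cr at h6 ⊢
  simp only [zero_mul, zero_div, mul_zero, sub_zero] 
  rw [div_mul_eq_mul_div, div_eq_div_iff (by positivity) (by positivity)]
  ring

lemma cr_pivot_ne₃ (h1 : A x d = 0) (h2 : A i c = 0) (h3 : A j c = 0) (h6 : A x c ≠ 0) :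
    cr (pivot A x u) i j c d = cr A i j u d := by
  rw [cr, cr, pivot_ne A hi hc, pivot_ne A hj hd, pivot_ne A hi hd, pivot_ne A hj hc, h1, h2, h3]
  simp only [zero_div, mul_zero, sub_zero, zero_sub]
  rw [show A i u * A x c / A x u = A i u * (A x c / A x u) by ring,
    show A j u * A x c / A x u = A j u * (A x c / A x u) by ring,
    show -(A i u * (A x c / A x u)) * A j d = -(A x c / A x u) * (A i u * A j d) by ring,
    show A i d * -(A j u * (A x c / A x u)) = -(A x c / A x u) * (A i d * A j u) by ring]
  exact mul_div_mul_left _ _ (neg_ne_zero.2 (div_ne_zero h6 hu))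

lemma cr_pivot_ne₄ (h1 : A x d = 0) (h2 : A i c = 0) (h4 : A i u ≠ 0) (h5 : A j u ≠ 0)
    (h6 : A x c ≠ 0) (h7 : A j d ≠ 0) :
    cr A j i u d * (1 - cr A x j u c) = cr (pivot A x u) j i c d := by
  rw [cr, cr, cr, pivot_ne A hi hc, pivot_ne A hj hd, pivot_ne A hi hd, pivot_ne A hj hc, h1, h2]
  simp only [zero_div, mul_zero, sub_zero, zero_sub]
  field_simp
  ring

lemma cr_pivot_ne₅ (h1 : A x d = 0) (h2 : A i c ≠ 0) (h3 : A j c ≠ 0) (h4 : A i d ≠ 0) 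
    (h6 : cr A x j c u = cr A x i c u) (h8 : pivot A x u j c ≠ 0) :
    cr (pivot A x u) i j c d = cr A i j c d := by
  rw [cr, pivot_ne_eq_mul A hi hc hu h2, pivot_ne_eq_mul A hj hc hu h3, pivot_ne A hj hd,
    pivot_ne A hi hd, h1, ← h6]
  rw [pivot_ne_eq_mul A hj hc hu h3] at h8
  have h9 := right_ne_zero_of_mul h8
  simp only [mul_zero, zero_div, sub_zero]
  generalize cr A x j c u = q at h9 ⊢
  rw [cr, div_eq_div_iff (by positivity) (by positivity)]
  ring

omit [DecidableEq X] [DecidableEq Y] hi hj hc hd hu in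
lemma cr_eq_of_cr_eq_one (h1 : A i c ≠ 0) (h2 : A j u ≠ 0) (h3 : A x u ≠ 0) (h4 : A j c ≠ 0)
    (h : cr A i j u c = 1) : cr A x j c u = cr A x i c u := by
  rw [← mul_one (cr A x j c u), ← h]
  unfold cr
  field_simp

end PivotCrossRatio

section GoodPivot

variable {X Y L F K : Type*} [DecidableEq X] [DecidableEq Y] [Field L] [Field F] [Field K]
  {f : L → K} {g : L → F} {P : Set X} {Q S : Set Y} {A : X → Y → L} {A' : X → Y → K}
  {B : X → Y → F}

omit [DecidableEq X] [DecidableEq Y] in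
lemma Good.zero (h : Good f P Q A A') {i : X} (hi : i ∈ P) {c : Y} (hc : c ∈ Q) (ha : A i c = 0) :
    A' i c = 0 := (h.supp i hi c hc).2 ha

lemma Good.pivot_supp (hf : LiftFun f) (h : Good f P Q A A') {x : X} {u : Y} (hx : x ∈ P)
    (hu : u ∈ Q) (hxu : A x u ≠ 0) :
    ∀ i ∈ P, ∀ c ∈ Q, pivot A' x u i c = 0 ↔ pivot A x u i c = 0 := by
  intro i hi c hc
  have hxu' := h.ne hx hu hxu
  by_cases hix : i = x
  · subst hix
    by_cases hcu : c = u
    · subst hcu; simp [pivot_self, hxu, hxu']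
    · simp [pivot_row _ hcu, hxu, hxu', h.supp i hi c hc]
  by_cases hcu : c = u
  · subst hcu; simp [pivot_col _ hix, hxu, hxu', h.supp i hi c hc]
  by_cases h1 : A i u = 0
  · rw [pivot_of_col_eq_zero _ hix h1, pivot_of_col_eq_zero _ hix (h.zero hi hu h1),
      h.supp i hi c hc]
  by_cases h2 : A x c = 0
  · rw [pivot_of_row_eq_zero _ hcu h2, pivot_of_row_eq_zero _ hcu (h.zero hx hc h2),
      h.supp i hi c hc]
  have h1' := h.ne hi hu h1
  have h2' := h.ne hx hc h2
  rw [pivot_ne_eq_zero_iff _ hix hcu hxu h1 h2, pivot_ne_eq_zero_iff _ hix hcu hxu' h1' h2',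
    h.cross i hi x hx c hc u hu h1 h2, ← hf.one_sub,
    hf.eq_zero_iff]

variable (hf : LiftFun f) (hg : LiftFun g) (ht : TrivialProducts g)
include hf hg ht

omit hg in
lemma Good.pivot_cross_row_aux (h : Good f P Q A A') (hB : Good g P Q A B) {x j : X} {u c d : Y}
    (hx : x ∈ P) (hj : j ∈ P) (hu : u ∈ Q) (hc : c ∈ Q) (hd : d ∈ Q) (hxu : A x u ≠ 0)
    (hjx : j ≠ x) (hcu : c ≠ u) (hdu : d ≠ u) (h1 : A x c ≠ 0) (h2 : A x d ≠ 0)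
    (h3 : pivot A x u j c ≠ 0) (h4 : pivot A x u j d ≠ 0) (h5 : A j d = 0 → A j c = 0) :
    cr (pivot A' x u) x j c d = f (cr (pivot A x u) x j c d) := by
  have hxu' := h.ne hx hu hxu
  have h1' := h.ne hx hc h1
  have h2' := h.ne hx hd h2
  by_cases h6 : A j u = 0
  · have h6' := h.zero hj hu h6
    rw [pivot_of_col_eq_zero _ hjx h6] at h3 h4
    have := h.cross x hx j hj c hc d hd h2 h3
    rw [cr_pivot_row_of_col_eq_zero _ hjx hcu hdu hxu h6,
      cr_pivot_row_of_col_eq_zero _ hjx hcu hdu hxu' h6', this]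
  have h6' := h.ne hj hu h6
  by_cases h7 : A j c = 0
  · rw [cr_pivot_row_of_eq_zero _ hjx hcu hdu hxu h1 h2 h6 h7,
      cr_pivot_row_of_eq_zero _ hjx hcu hdu hxu' h1' h2' h6' (h.zero hj hc h7), hf.one_sub,
      h.cross x hx j hj u hu d hd h2 h6]
  have h8 : A j d ≠ 0 := fun h => h7 (h5 h)
  have key : cr A x j c d = 1 := by
    have e := cr_mul_col A (i := x) (j := j) (c := c) (e := d) (d := u) h2 h8
    have e' := cr_mul_col B (i := x) (j := j) (c := c) (e := d) (d := u) (hB.ne hx hd h2)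
      (hB.ne hj hd h8)
    rw [hB.cross x hx j hj c hc d hd h2 h7, hB.cross x hx j hj d hd u hu hxu h8,
      hB.cross x hx j hj c hc u hu hxu h7, ← e] at e'
    rcases ht _ _ (cr_ne_zero h1 h8 h2 h7) (cr_ne_zero h2 h6 hxu h8) e'.symm with h | h | h
    · exact h
    · rw [pivot_ne_eq_mul A hjx hdu hxu h8, h] at h4; simp at h4
    · rw [pivot_ne_eq_mul A hjx hcu hxu h7, ← e, h] at h3; simp at h3
  have key' : cr A' x j c d = 1 := by rw [h.cross x hx j hj c hc d hd h2 h7, key, hf.one]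
  rw [cr_pivot_row_of_cr_eq_one A hjx hcu hdu hxu h2 h7 key h3,
    cr_pivot_row_of_cr_eq_one A' hjx hcu hdu hxu' h2' (h.ne hj hc h7) key', hf.one]
  exact mt (h.pivot_supp hf hx hu hxu j hj c hc).1 h3

omit hg in
lemma Good.pivot_cross_row (h : Good f P Q A A') (hB : Good g P Q A B) {x j : X} {u c d : Y}
    (hx : x ∈ P) (hj : j ∈ P) (hu : u ∈ Q) (hc : c ∈ Q) (hd : d ∈ Q) (hxu : A x u ≠ 0)
    (hjx : j ≠ x) (hcd : c ≠ d) (h1 : pivot A x u x c ≠ 0) (h2 : pivot A x u x d ≠ 0)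
    (h3 : pivot A x u j c ≠ 0) (h4 : pivot A x u j d ≠ 0) :
    cr (pivot A' x u) x j c d = f (cr (pivot A x u) x j c d) := by
  have hxu' := h.ne hx hu hxu
  have key : ∀ d ∈ Q, d ≠ u → pivot A x u x d ≠ 0 → pivot A x u j u ≠ 0 →
      cr (pivot A' x u) x j u d = f (cr (pivot A x u) x j u d) := by
    intro d hd hdu h1 h2
    rw [pivot_row _ hdu] at h1
    have h1 := (div_ne_zero_iff.1 h1).1
    rw [pivot_col _ hjx] at h2
    have h2 := (div_ne_zero_iff.1 (neg_ne_zero.1 h2)).1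
    rw [cr_pivot_self _ hjx hdu hxu h1 h2, cr_pivot_self _ hjx hdu hxu' (h.ne hx hd h1)
      (h.ne hj hu h2), hf.one_sub, h.cross x hx j hj u hu d hd h1 h2]
  by_cases hcu : c = u
  · subst hcu
    exact key d hd hcd.symm h2 h3
  by_cases hdu : d = u
  · subst hdu
    rw [cr_swap_col _ x j d c, cr_swap_col _ x j d c, hf.inv, key c hc hcd h1 h4]
  rw [pivot_row _ hcu] at h1
  have h1 := (div_ne_zero_iff.1 h1).1
  rw [pivot_row _ hdu] at h2
  have h2 := (div_ne_zero_iff.1 h2).1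
  by_cases h5 : A j d = 0
  · rw [cr_swap_col _ x j d c, cr_swap_col _ x j d c, hf.inv,
      h.pivot_cross_row_aux hf ht hB hx hj hu hd hc hxu hjx hdu hcu h2 h1 h4 h3 (fun _ => h5)]
  · exact h.pivot_cross_row_aux hf ht hB hx hj hu hc hd hxu hjx hcu hdu h1 h2 h3 h4
      (fun h0 => absurd h0 h5)

omit hg in
lemma Good.pivot_cross_col (h : Good f P Q A A') (hB : Good g P Q A B) {x i j : X} {u d : Y}
    (hx : x ∈ P) (hi : i ∈ P) (hj : j ∈ P) (hu : u ∈ Q) (hd : d ∈ Q) (hxu : A x u ≠ 0)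
    (hij : i ≠ j) (hdu : d ≠ u) (h1 : pivot A x u i u ≠ 0) (h2 : pivot A x u i d ≠ 0)
    (h3 : pivot A x u j u ≠ 0) (h4 : pivot A x u j d ≠ 0) :
    cr (pivot A' x u) i j u d = f (cr (pivot A x u) i j u d) := by
  rw [← cr_pivot_flip A', ← cr_pivot_flip A]
  exact h.flip.pivot_cross_row hf ht hB.flip hu hd hx hi hj hxu hdu hij
    (mt (pivot_flip_eq_zero_iff _ _ _ _ _).1 h1) (mt (pivot_flip_eq_zero_iff _ _ _ _ _).1 h3)
    (mt (pivot_flip_eq_zero_iff _ _ _ _ _).1 h2) (mt (pivot_flip_eq_zero_iff _ _ _ _ _).1 h4)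


lemma Good.pivot_cross_ne_aux {S : Set Y} (h : Lift f P Q S A A') (hB : Lift g P Q Q A B)
    (hS : S ⊆ Q)
    {x i j : X} {u c d : Y} (hx : x ∈ P) (hi : i ∈ P) (hj : j ∈ P) (hu : u ∈ Q) (hc : c ∈ Q)
    (hd : d ∈ S) (hxu : A x u ≠ 0) (hix : i ≠ x) (hjx : j ≠ x) (hij : i ≠ j) (hcu : c ≠ u)
    (hdu : d ≠ u) (hcd : c ≠ d) (h1 : pivot A x u i c ≠ 0) (h2 : pivot A x u i d ≠ 0)
    (h3 : pivot A x u j c ≠ 0) (h4 : pivot A x u j d ≠ 0) (hxd : A x d = 0) (hxc : A x c ≠ 0)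
    (h6 : A j u = 0 → A i u = 0) (h7 : A i u ≠ 0 → A j c = 0 → A i c = 0) :
    cr (pivot A' x u) i j c d = f (cr (pivot A x u) i j c d) := by
  have hA := h.good
  have hdQ := hS hd
  have hgB := hB.good
  have hxu' := hA.ne hx hu hxu
  have hxd' := hA.zero hx hdQ hxd
  have hxc' := hA.ne hx hc hxc
  have hxuB := hgB.ne hx hu hxu
  have hxdB := hgB.zero hx hdQ hxd
  have hxcB := hgB.ne hx hc hxc
  have hs := hA.pivot_supp hf hx hu hxu
  have hsB := hgB.pivot_supp hg hx hu hxu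
  have hBp := (hB.pivot hx hu hxu).good
  have hid : A i d ≠ 0 := by rwa [pivot_of_row_eq_zero _ hdu hxd] at h2
  have hjd : A j d ≠ 0 := by rwa [pivot_of_row_eq_zero _ hdu hxd] at h4
  have hid' := hA.ne hi hdQ hid
  have hjd' := hA.ne hj hdQ hjd
  have hjdB := hgB.ne hj hdQ hjd
  have hidB := hgB.ne hi hdQ hid
  have h3' := mt (hs j hj c hc).1 h3
  have h3B := mt (hsB j hj c hc).1 h3
  by_cases hiu : A i u = 0
  · have hiu' := hA.zero hi hu hiu
    have hiuB := hgB.zero hi hu hiu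
    by_cases hju : A j u = 0
    · have hju' := hA.zero hj hu hju
      simp only [cr, pivot_of_col_eq_zero _ hix hiu, pivot_of_col_eq_zero _ hjx hju,
        pivot_of_col_eq_zero _ hix hiu', pivot_of_col_eq_zero _ hjx hju']
      rw [pivot_of_col_eq_zero _ hjx hju] at h3
      exact hA.cross i hi j hj c hc d hdQ hid h3
    have hju' := hA.ne hj hu hju
    by_cases hjc : A j c = 0
    · rw [cr_pivot_ne₁ hix hjx hij hcu hdu hcd hxu hxd hiu hjc hid hxc hju,
        cr_pivot_ne₁ hix hjx hij hcu hdu hcd hxu' hxd' hiu' (hA.zero hj hc hjc) hid' hxc' hju']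
      refine (h.pivot hi hd hid).good.cross x hx j hj u hu c hc ?_ ?_
      · rwa [pivot_of_col_eq_zero _ hix.symm hxd]
      · rwa [pivot_of_row_eq_zero _ hdu.symm hiu]
    · have e := cr_pivot_ne₂ hix hjx hcu hdu hxu hxd hiu hjc hid h3
      have e' := cr_pivot_ne₂ hix hjx hcu hdu hxu' hxd' hiu' (hA.ne hj hc hjc) hid' h3'
      have eB := cr_pivot_ne₂ hix hjx hcu hdu hxuB hxdB hiuB (hgB.ne hj hc hjc) hidB h3B
      rw [hBp.cross i hi j hj c hc d hdQ h2 h3, hgB.cross i hi j hj c hc d hdQ hid hjc,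
        hgB.cross x hx j hj c hc u hu hxu hjc, ← hg.one_sub, ← e] at eB
      have h8 : 1 - cr A x j c u ≠ 0 := by
        intro h0; rw [pivot_ne_eq_mul A hjx hcu hxu hjc, h0] at h3; simp at h3
      have h9 := hf.mul ht (cr_ne_zero h1 h4 h2 h3) h8 eB.symm
      rw [e, hf.one_sub, ← hA.cross i hi j hj c hc d hdQ hid hjc,
        ← hA.cross x hx j hj c hc u hu hxu hjc, ← e'] at h9
      refine mul_right_cancel₀ ?_ h9
      intro h0; rw [pivot_ne_eq_mul A' hjx hcu hxu' (hA.ne hj hc hjc), h0] at h3'; simp at h3'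
  have hju : A j u ≠ 0 := fun h => hiu (h6 h)
  by_cases hic : A i c = 0
  · by_cases hjc : A j c = 0
    · rw [cr_pivot_ne₃ hix hjx hcu hdu hxu hxd hic hjc hxc, cr_pivot_ne₃ hix hjx hcu hdu hxu' hxd'
        (hA.zero hi hc hic) (hA.zero hj hc hjc) hxc', hA.cross i hi j hj u hu d hdQ hid hju]
    · have hjc' := hA.ne hj hc hjc
      have e := cr_pivot_ne₄ hix hjx hcu hdu hxu hxd hic hiu hju hxc hjd
      have e' := cr_pivot_ne₄ hix hjx hcu hdu hxu' hxd' (hA.zero hi hc hic) (hA.ne hi hu hiu)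
        (hA.ne hj hu hju) hxc' hjd'
      have eB := cr_pivot_ne₄ hix hjx hcu hdu hxuB hxdB (hgB.zero hi hc hic) (hgB.ne hi hu hiu)
        (hgB.ne hj hu hju) hxcB hjdB
      rw [hBp.cross j hj i hi c hc d hdQ h4 h1, hgB.cross j hj i hi u hu d hdQ hjd hiu,
        hgB.cross x hx j hj u hu c hc hxc hju, ← hg.one_sub, ← e] at eB
      have h8 : cr A j i u d * (1 - cr A x j u c) ≠ 0 := by
        rw [e]; exact cr_ne_zero h3 h2 h4 h1
      have h9 := hf.mul ht (left_ne_zero_of_mul h8) (right_ne_zero_of_mul h8) eB.symm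
      rw [e, hf.one_sub, ← hA.cross j hj i hi u hu d hdQ hjd hiu,
        ← hA.cross x hx j hj u hu c hc hxc hju, e'] at h9
      rw [cr_swap_row _ j i, cr_swap_row _ j i, hf.inv, h9]
  have hjc : A j c ≠ 0 := fun h => hic (h7 hiu h)
  have hic' := hA.ne hi hc hic
  have hjc' := hA.ne hj hc hjc
  have key : cr A i j u c = 1 := by
    have e : cr A x j c u * cr A i j u c = cr A x i c u := by unfold cr; field_simp
    have hicB := hgB.ne hi hc hic
    have hjuB := hgB.ne hj hu hju
    have hjcB := hgB.ne hj hc hjc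
    have e' : cr B x j c u * cr B i j u c = cr B x i c u := by unfold cr; field_simp
    rw [hgB.cross x hx j hj c hc u hu hxu hjc, hgB.cross i hi j hj u hu c hc hic hju,
      hgB.cross x hx i hi c hc u hu hxu hic, ← e] at e'
    rcases ht _ _ (cr_ne_zero hxc hju hxu hjc) (cr_ne_zero hiu hjc hic hju) e'.symm with h | h | h
    · rw [pivot_ne_eq_mul A hjx hcu hxu hjc, h] at h3; simp at h3
    · exact h
    · rw [pivot_ne_eq_mul A hix hcu hxu hic, ← e, h] at h1; simp at h1
  have key' : cr A' i j u c = 1 := by rw [hA.cross i hi j hj u hu c hc hic hju, key, hf.one]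
  rw [cr_pivot_ne₅ hix hjx hcu hdu hxu hxd hic hjc hid (cr_eq_of_cr_eq_one hic hju hxu hjc key) h3,
    cr_pivot_ne₅ hix hjx hcu hdu hxu' hxd' hic' hjc' hid'
      (cr_eq_of_cr_eq_one hic' (hA.ne hj hu hju) hxu' hjc' key') h3',
    hA.cross i hi j hj c hc d hdQ hid hjc]

lemma Good.pivot_cross_ne {S : Set Y} (h : Lift f P Q S A A') (hB : Lift g P Q Q A B)
    (hS : S ⊆ Q)
    {x i j : X} {u c d : Y} (hx : x ∈ P) (hi : i ∈ P) (hj : j ∈ P) (hu : u ∈ Q) (hc : c ∈ Q)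
    (hd : d ∈ S) (hxu : A x u ≠ 0) (hix : i ≠ x) (hjx : j ≠ x) (hij : i ≠ j) (hcu : c ≠ u)
    (hdu : d ≠ u) (hcd : c ≠ d) (h1 : pivot A x u i c ≠ 0) (h2 : pivot A x u i d ≠ 0)
    (h3 : pivot A x u j c ≠ 0) (h4 : pivot A x u j d ≠ 0) :
    cr (pivot A' x u) i j c d = f (cr (pivot A x u) i j c d) := by
  have hdQ := hS hd
  by_cases hxd : A x d = 0
  · by_cases hxc : A x c = 0
    · have hxc' := h.good.zero hx hc hxc
      have hxd' := h.good.zero hx hdQ hxd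
      simp only [cr, pivot_of_row_eq_zero _ hcu hxc, pivot_of_row_eq_zero _ hdu hxd,
        pivot_of_row_eq_zero _ hcu hxc', pivot_of_row_eq_zero _ hdu hxd'] at h2 h3 ⊢
      exact h.good.cross i hi j hj c hc d hdQ h2 h3
    by_cases hw : (A j u = 0 → A i u = 0) ∧ (A i u ≠ 0 → A j c = 0 → A i c = 0)
    · exact Good.pivot_cross_ne_aux hf hg ht h hB hS hx hi hj hu hc hd hxu hix hjx hij hcu hdu hcd
        h1 h2 h3 h4 hxd hxc hw.1 hw.2
    · rw [cr_swap_row _ j i, cr_swap_row _ j i, hf.inv]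
      congr 1
      refine Good.pivot_cross_ne_aux hf hg ht h hB hS hx hj hi hu hc hd hxu hjx hix hij.symm hcu hdu
        hcd h3 h4 h1 h2 hxd hxc ?_ ?_
      · intro h0; by_contra h9; exact hw ⟨fun h => absurd h h9, fun h => absurd h0 h⟩
      · intro h0 h9
        by_contra h8
        by_cases h7 : A i u = 0
        · rw [pivot_of_col_eq_zero _ hix h7] at h1
          exact h1 h9
        · exact hw ⟨fun h => absurd h h0, fun _ h => absurd h h8⟩
  · have e : ∀ k, pivot A x u k d = pivot (pivot A x d) x u k u := fun k => by
      rw [pivot_pivot_same_row _ hdu.symm hxd hxu]; simp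
    have e₁ : ∀ k, pivot A x u k c = pivot (pivot A x d) x u k c := fun k => by
      rw [pivot_pivot_same_row _ hdu.symm hxd hxu]; simp [Equiv.swap_apply_of_ne_of_ne hcd hcu]
    have hxu' := h.good.ne hx hu hxu
    have hxd' := h.good.ne hx hdQ hxd
    have e' : ∀ k, pivot A' x u k d = pivot (pivot A' x d) x u k u := fun k => by
      rw [pivot_pivot_same_row _ hdu.symm hxd' hxu']; simp
    have e₁' : ∀ k, pivot A' x u k c = pivot (pivot A' x d) x u k c := fun k => by
      rw [pivot_pivot_same_row _ hdu.symm hxd' hxu']; simp [Equiv.swap_apply_of_ne_of_ne hcd hcu]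
    rw [cr_swap_col _ i j d c, cr_swap_col _ i j d c, hf.inv]
    congr 1
    rw [e, e₁] at *
    simp only [cr, e, e₁, e', e₁']
    refine Good.pivot_cross_col hf ht (h.pivot hx hd hxd).good (hB.pivot hx hdQ hxd).good hx hi hj
      hu hc ?_ hij hcu h2 h1 h4 h3
    rw [pivot_row _ hdu.symm]
    exact div_ne_zero hxu hxd

lemma Lift.good_pivot {S : Set Y} (h : Lift f P Q S A A') (hB : Lift g P Q Q A B)
    (hS : S ⊆ Q)
    {x : X} {u : Y} (hx : x ∈ P) (hu : u ∈ Q) (hxu : A x u ≠ 0)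
    (hcov : ∀ c ∈ Q, ∀ d ∈ Q, c ≠ d → c ≠ u → d ≠ u → c ∈ S ∨ d ∈ S) :
    Good f P Q (DyadicLift.pivot A x u) (DyadicLift.pivot A' x u) := by
  refine Good.of_ne hf (h.good.pivot_supp hf hx hu hxu) ?_
  intro i hi j hj c hc d hd hij hcd h1 h4 h2 h3
  by_cases hix : i = x
  · subst hix
    exact Good.pivot_cross_row hf ht h.good hB.good hi hj hu hc hd hxu hij.symm hcd h1 h2 h3 h4
  by_cases hjx : j = x
  · subst hjx
    rw [cr_swap_row _ j i, cr_swap_row _ j i, hf.inv]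
    congr 1
    exact Good.pivot_cross_row hf ht h.good hB.good hj hi hu hc hd hxu hij hcd h3 h4 h1 h2
  by_cases hcu : c = u
  · subst hcu
    exact Good.pivot_cross_col hf ht h.good hB.good hx hi hj hc hd hxu hij hcd.symm h1 h2 h3 h4
  by_cases hdu : d = u
  · subst hdu
    rw [cr_swap_col _ i j d c, cr_swap_col _ i j d c, hf.inv]
    congr 1
    exact Good.pivot_cross_col hf ht h.good hB.good hx hi hj hd hc hxu hij hcd h2 h1 h4 h3
  rcases hcov c hc d hd hcd hcu hdu with h0 | h0
  · rw [cr_swap_col _ i j d c, cr_swap_col _ i j d c, hf.inv]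
    congr 1
    exact Good.pivot_cross_ne hf hg ht h hB hS hx hi hj hu hd h0 hxu hix hjx hij hdu hcu hcd.symm
      h2 h1 h4 h3
  · exact Good.pivot_cross_ne hf hg ht h hB hS hx hi hj hu hc h0 hxu hix hjx hij hcu hdu hcd
      h1 h2 h3 h4

end GoodPivot

section Upgrade

variable {X Y L F K : Type*} [DecidableEq X] [DecidableEq Y] [Field L] [Field F] [Field K]
  {f : L → K} {g : L → F} {P : Set X} {Q S : Set Y} {A : X → Y → L} {A' : X → Y → K}
  {B : X → Y → F}

lemma pivot_swap_ne_zero {x z : X} {u c : Y} (hz : z ≠ x) (hc : c ≠ u) (hu : A x u ≠ 0)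
    (hzc : A z c ≠ 0) (hp : pivot A x u z c ≠ 0) : pivot A z c x u ≠ 0 := by
  rw [pivot_ne A hz hc] at hp
  rw [pivot_ne A hz.symm hc.symm]
  contrapose! hp
  field_simp at hp ⊢
  linear_combination hp

lemma swap_mem {W : Type*} [DecidableEq W] {P : Set W} {x z : W} (hx : x ∈ P) (hz : z ∈ P) :
    ∀ i ∈ P, Equiv.swap x z i ∈ P := by
  intro i hi
  rw [Equiv.swap_apply_def]
  split_ifs <;> assumption

lemma swap_mem_diff {W : Type*} [DecidableEq W] {S : Set W} {u c : W} (hu : u ∈ S) (hc : c ∈ S) :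
    ∀ j ∈ S \ {c}, Equiv.swap u c j ∈ S \ {u} := by
  rintro j ⟨hj, hjc⟩
  refine ⟨swap_mem hu hc j hj, ?_⟩
  rw [mem_singleton_iff, Equiv.swap_apply_eq_iff, Equiv.swap_apply_left]
  exact hjc

/-- Robustness under pivots in the columns `S` extends to one more column, provided that any two
columns then meet the enlarged set. -/
lemma Lift.upgrade (hf : LiftFun f) (hg : LiftFun g) (ht : TrivialProducts g)
    (h : Lift f P Q S A A') (hB : Lift g P Q Q A B) (hS : S ⊆ Q) {u : Y} (hu : u ∈ Q)
    (hcov : ∀ c ∈ Q, ∀ d ∈ Q, c ≠ d → c ∈ insert u S ∨ d ∈ insert u S) :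
    Lift f P Q (insert u S) A A' := by
  by_cases huS : u ∈ S
  · rwa [insert_eq_of_mem huS]
  set S' := insert u S with hS'
  have hS'Q : S' ⊆ Q := insert_subset hu hS
  let T : Y → (X → Y → L) → (X → Y → K) → Prop := fun v D D' =>
    v ∈ S' ∧ Lift f P Q (S' \ {v}) D D' ∧ ∃ E, Lift g P Q Q D E
  have hT : ∀ v D D', T v D D' → ∀ x ∈ P, D x v ≠ 0 →
      Good f P Q (DyadicLift.pivot D x v) (DyadicLift.pivot D' x v) := by
    rintro v D D' ⟨hv, h1, E, h2⟩ x hx hxv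
    refine h1.good_pivot hf hg ht h2 (sdiff_subset.trans hS'Q) hx (hS'Q hv) hxv ?_
    intro c hc d hd hcd hcv hdv
    exact (hcov c hc d hd hcd).imp (⟨·, hcv⟩) (⟨·, hdv⟩)
  have hTp : ∀ v D D', T v D D' → ∀ x ∈ P, ∀ c ∈ S', c ≠ v → D x c ≠ 0 →
      T v (DyadicLift.pivot D x c) (DyadicLift.pivot D' x c) := by
    rintro v D D' ⟨hv, h1, E, h2⟩ x hx c hc hcv hxc
    exact ⟨hv, h1.pivot hx ⟨hc, hcv⟩ hxc, _, h2.pivot hx (hS'Q hc) hxc⟩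
  refine ⟨fun C C' => ∃ v D D', T v D D' ∧ (C = D ∧ C' = D' ∨ ∃ x ∈ P, D x v ≠ 0 ∧
    C = DyadicLift.pivot D x v ∧ C' = DyadicLift.pivot D' x v),
    ⟨u, A, A', ⟨mem_insert _ _, by rwa [hS', insert_sdiff_self_of_notMem huS], B, hB⟩,
      Or.inl ⟨rfl, rfl⟩⟩, ?_⟩
  rintro _ _ ⟨v, D, D', hD, ⟨rfl, rfl⟩ | ⟨x, hx, hxv, rfl, rfl⟩⟩
  · refine ⟨hD.2.1.good, fun z hz c hc hzc => ?_⟩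
    by_cases hcv : c = v
    · subst hcv
      exact ⟨c, _, _, hD, Or.inr ⟨z, hz, hzc, rfl, rfl⟩⟩
    · exact ⟨v, _, _, hTp _ _ _ hD z hz c hc hcv hzc, Or.inl ⟨rfl, rfl⟩⟩
  refine ⟨hT v D D' hD x hx hxv, fun z hz c hc hzc => ?_⟩
  have hgD := hD.2.1.good
  have hv := hD.1
  have hxv' := hgD.ne hx (hS'Q hv) hxv
  have hzc' := (hT v D D' hD x hx hxv).ne hz (hS'Q hc) hzc
  by_cases hcv : c = v
  · subst hcv
    by_cases hzx : z = x
    · subst hzx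
      exact ⟨c, D, D', hD, Or.inl ⟨pivot_pivot _ hxv, pivot_pivot _ hxv'⟩⟩
    rw [pivot_col _ hzx] at hzc hzc'
    have h1 := (div_ne_zero_iff.1 (neg_ne_zero.1 hzc)).1
    have h1' := (div_ne_zero_iff.1 (neg_ne_zero.1 hzc')).1
    obtain ⟨-, h2, E, h3⟩ := hD
    refine ⟨c, fun i j => D (Equiv.swap x z i) j, fun i j => D' (Equiv.swap x z i) j, ⟨hv, ?_,
      fun i j => E (Equiv.swap x z i) j, ?_⟩, Or.inr ⟨x, hx, by simpa,
      pivot_pivot_same_col D hzx hxv h1, pivot_pivot_same_col D' hzx hxv' h1'⟩⟩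
    · exact h2.relabel (Equiv.swap x z).injective Function.injective_id (swap_mem hx hz)
        (fun _ => id) (fun _ => id)
    · exact h3.relabel (Equiv.swap x z).injective Function.injective_id (swap_mem hx hz)
        (fun _ => id) (fun _ => id)
  by_cases hzx : z = x
  · subst hzx
    rw [pivot_row _ hcv] at hzc hzc'
    have h1 := (div_ne_zero_iff.1 hzc).1
    have h1' := (div_ne_zero_iff.1 hzc').1
    rw [pivot_pivot_same_row D hcv hxv h1, pivot_pivot_same_row D' hcv hxv' h1']
    obtain ⟨-, h2, E, h3⟩ := hTp v D D' hD z hz c hc hcv h1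
    refine ⟨c, _, _, ⟨hc, ?_, fun i j => E i (Equiv.swap v c j), ?_⟩, Or.inl ⟨rfl, rfl⟩⟩
    · exact h2.relabel Function.injective_id (Equiv.swap v c).injective (fun _ => id)
        (swap_mem (hS'Q hv) (hS'Q hc)) (swap_mem_diff hv hc)
    · exact h3.relabel Function.injective_id (Equiv.swap v c).injective (fun _ => id)
        (swap_mem (hS'Q hv) (hS'Q hc)) (swap_mem (hS'Q hv) (hS'Q hc))
  by_cases h0 : D z c = 0
  · have h0' := hgD.zero hz (hS'Q hc) h0
    have h1 : D x c ≠ 0 := by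
      intro h1
      rw [pivot_ne _ hzx hcv, h0, h1] at hzc
      simp at hzc
    have h2 : D z v ≠ 0 := by
      intro h1
      rw [pivot_ne _ hzx hcv, h0, h1] at hzc
      simp at hzc
    rw [pivot_pivot_of_eq_zero D hzx hcv hxv h0 hzc,
      pivot_pivot_of_eq_zero D' hzx hcv hxv' h0' hzc']
    obtain ⟨-, h3, E, h4⟩ := hTp v D D' hD x hx c hc hcv h1
    refine ⟨c, _, _, ⟨hc, ?_, fun i j => E (Equiv.swap x z i) (Equiv.swap v c j), ?_⟩,
      Or.inr ⟨x, hx, ?_, rfl, rfl⟩⟩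
    · exact h3.relabel (Equiv.swap x z).injective (Equiv.swap v c).injective (swap_mem hx hz)
        (swap_mem (hS'Q hv) (hS'Q hc)) (swap_mem_diff hv hc)
    · exact h4.relabel (Equiv.swap x z).injective (Equiv.swap v c).injective (swap_mem hx hz)
        (swap_mem (hS'Q hv) (hS'Q hc)) (swap_mem (hS'Q hv) (hS'Q hc))
    · rw [Equiv.swap_apply_left, Equiv.swap_apply_right, pivot_of_col_eq_zero _ hzx h0]
      exact h2
  · have h0' := hgD.ne hz (hS'Q hc) h0
    rw [pivot_comm D hzx hcv hxv h0 hzc, pivot_comm D' hzx hcv hxv' h0' hzc']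
    exact ⟨v, _, _, hTp v D D' hD z hz c hc hcv h0, Or.inr ⟨x, hx,
      pivot_swap_ne_zero hzx hcv hxv h0 hzc, rfl, rfl⟩⟩

end Upgrade

section Connected

variable {X Y K : Type*} [Field K] {P : Set X} {S : Set Y} {A : X → Y → K}

/-- The rows `a` and `b` are in the same component of the support of `A` on `P × S`. -/
def Linked (P : Set X) (S : Set Y) (A : X → Y → K) (a b : X) : Prop :=
  ∀ (p : X → Prop) (q : Y → Prop), (∀ x ∈ P, ∀ y ∈ S, A x y ≠ 0 → (p x ↔ q y)) → (p a ↔ p b)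

/-- Any two rows in `P` of the matrix `A` are linked through columns in `S`. -/
def RowConn (P : Set X) (S : Set Y) (A : X → Y → K) : Prop :=
  ∀ a ∈ P, ∀ b ∈ P, Linked P S A a b

lemma Linked.refl (a : X) : Linked P S A a a := fun _ _ _ => Iff.rfl

lemma Linked.symm {a b : X} (h : Linked P S A a b) : Linked P S A b a :=
  fun p q hpq => (h p q hpq).symm

lemma Linked.trans {a b c : X} (h : Linked P S A a b) (h' : Linked P S A b c) :
    Linked P S A a c := fun p q hpq => (h p q hpq).trans (h' p q hpq)

lemma Linked.of_ne {a b : X} {y : Y} (ha : a ∈ P) (hb : b ∈ P) (hy : y ∈ S) (h : A a y ≠ 0)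
    (h' : A b y ≠ 0) : Linked P S A a b :=
  fun _ _ hpq => (hpq a ha y hy h).trans (hpq b hb y hy h').symm

/-- The rows `a` and `b` are linked by a path through `n` columns in `S`. -/
def Reach (P : Set X) (S : Set Y) (A : X → Y → K) (b : X) : ℕ → X → Prop
  | 0, a => a = b
  | n + 1, a => ∃ k ∈ P, ∃ c ∈ S, A a c ≠ 0 ∧ A k c ≠ 0 ∧ Reach P S A b n k

lemma Linked.exists_reach {a b : X} (h : Linked P S A a b) : ∃ n, Reach P S A b n a := by
  refine (h (fun a => ∃ n, Reach P S A b n a)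
    (fun y => ∃ k ∈ P, A k y ≠ 0 ∧ ∃ n, Reach P S A b n k) ?_).2 ⟨0, rfl⟩
  intro x hx y hy hxy
  exact ⟨fun hr => ⟨x, hx, hxy, hr⟩, fun ⟨k, hk, hky, n, hn⟩ => ⟨n + 1, k, hk, y, hy, hxy, hky, hn⟩⟩

variable [DecidableEq X] [DecidableEq Y]

lemma Linked.pivot {a b : X} (h : Linked P S A a b) {x : X} {y : Y} (hx : x ∈ P) (hy : y ∈ S)
    (hxy : A x y ≠ 0) : Linked P S (pivot A x y) a b := by
  intro p q hpq
  refine h p q fun i hi j hj hij => ?_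
  by_cases hix : i = x
  · subst hix
    refine hpq i hi j hj ?_
    by_cases hjy : j = y
    · subst hjy; rw [pivot_self]; exact inv_ne_zero hxy
    · rw [pivot_row _ hjy]; exact div_ne_zero hij hxy
  by_cases hjy : j = y
  · subst hjy
    refine hpq i hi j hj ?_
    rw [pivot_col _ hix]; exact neg_ne_zero.2 (div_ne_zero hij hxy)
  by_cases h0 : DyadicLift.pivot A x y i j = 0
  · have h1 : A i y ≠ 0 := fun h1 => hij (by rwa [pivot_of_col_eq_zero _ hix h1] at h0)
    have h2 : A x j ≠ 0 := fun h1 => hij (by rwa [pivot_of_row_eq_zero _ hjy h1] at h0)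
    have e1 := hpq i hi y hy (by rw [pivot_col _ hix]; exact neg_ne_zero.2 (div_ne_zero h1 hxy))
    have e2 := hpq x hx y hy (by rw [pivot_self]; exact inv_ne_zero hxy)
    have e3 := hpq x hx j hj (by rw [pivot_row _ hjy]; exact div_ne_zero h2 hxy)
    rw [e1, ← e2, e3]
  · exact hpq i hi j hj h0

lemma RowConn.pivot (h : RowConn P S A) {x : X} {y : Y} (hx : x ∈ P) (hy : y ∈ S)
    (hxy : A x y ≠ 0) : RowConn P S (pivot A x y) :=
  fun a ha b hb => (h a ha b hb).pivot hx hy hxy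

lemma Reach.pivot {b x : X} {c : Y} : ∀ {n : ℕ} {a : X}, Reach P S A b n a → a ∈ P →
    (∀ m ≤ n, ∀ k ∈ P, Reach P S A b m k → k ≠ x ∧ A k c = 0) → Reach P S (pivot A x c) b n a
  | 0, _, h, _, _ => h
  | n + 1, a, h, ha, hz => by
    obtain ⟨k, hk, d, hd, had, hkd, hr⟩ := h
    obtain ⟨h1, h2⟩ := hz (n + 1) le_rfl a ha ⟨k, hk, d, hd, had, hkd, hr⟩
    obtain ⟨h3, h4⟩ := hz n (Nat.le_succ n) k hk hr
    refine ⟨k, hk, d, hd, ?_, ?_, Reach.pivot hr hk fun m hm => hz m (hm.trans (Nat.le_succ n))⟩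
    · rwa [pivot_of_col_eq_zero _ h1 h2]
    · rwa [pivot_of_col_eq_zero _ h3 h4]

lemma reach_induction {a b : X} (hb : b ∈ P) (hab : a ≠ b) {motive : (X → Y → K) → Prop}
    (step : ∀ A, ∀ x ∈ P, ∀ c ∈ S, x ≠ a → x ≠ b → A x c ≠ 0 → A a c = 0 → A b c = 0 →
      motive (pivot A x c) → motive A)
    (one : ∀ A, ∀ c ∈ S, A a c ≠ 0 → A b c ≠ 0 → motive A)
    (two : ∀ A, ∀ z ∈ P, ∀ c ∈ S, ∀ d ∈ S, A a c ≠ 0 → A z c ≠ 0 → A z d ≠ 0 → A b d ≠ 0 →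
      A a d = 0 → A b c = 0 → motive A) :
    ∀ n (A : X → Y → K), Reach P S A b n a → motive A := by
  intro n
  induction n using Nat.strong_induction_on with
  | _ n ih =>
  intro A hr
  by_cases hmin : ∃ m < n, Reach P S A b m a
  · obtain ⟨m, hm, hr'⟩ := hmin
    exact ih m hm A hr'
  push Not at hmin
  match n, hr with
  | 0, hr => exact absurd hr hab
  | 1, ⟨k, hk, c, hc, h1, h2, hkb⟩ =>
    rw [show k = b from hkb] at h2
    exact one A c hc h1 h2
  | 2, ⟨z, hz, c, hc, h1, h2, k, hk, d, hd, h3, h4, hkb⟩ =>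
    have hkb : k = b := hkb
    subst hkb
    refine two A z hz c hc d hd h1 h2 h3 h4 ?_ ?_
    · by_contra h; exact hmin 1 (by norm_num) ⟨k, hk, d, hd, h, h4, rfl⟩
    · by_contra h; exact hmin 1 (by norm_num) ⟨k, hk, c, hc, h1, h, rfl⟩
  | n + 3, ⟨x₁, hx₁, c₁, hc₁, h1, h2, x₂, hx₂, c₂, hc₂, h3, h4, x₃, hx₃, c₃, hc₃, h5, h6, hr⟩ =>
    have a2 : A a c₂ = 0 := by
      by_contra h
      exact hmin (n + 2) (by omega) ⟨x₂, hx₂, c₂, hc₂, h, h4, x₃, hx₃, c₃, hc₃, h5, h6, hr⟩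
    have x13 : A x₁ c₃ = 0 := by
      by_contra h
      exact hmin (n + 2) (by omega) ⟨x₁, hx₁, c₁, hc₁, h1, h2, x₃, hx₃, c₃, hc₃, h, h6, hr⟩
    have x21 : A x₂ c₁ = 0 := by
      by_contra h
      exact hmin (n + 2) (by omega) ⟨x₂, hx₂, c₁, hc₁, h1, h, x₃, hx₃, c₃, hc₃, h5, h6, hr⟩
    have far : ∀ m ≤ n, ∀ k ∈ P, Reach P S A b m k → A k c₂ = 0 := by
      intro m hm k hk hkr
      by_contra h
      exact hmin (m + 2) (by omega) ⟨x₁, hx₁, c₁, hc₁, h1, h2, k, hk, c₂, hc₂, h3, h, hkr⟩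
    have x32 : A x₃ c₂ = 0 := far n le_rfl x₃ hx₃ hr
    have b2 : A b c₂ = 0 := far 0 (Nat.zero_le n) b hb rfl
    have hne : ∀ {i}, A i c₂ = 0 → i ≠ x₂ := fun h0 h => h4 (h ▸ h0)
    have x12 : x₁ ≠ x₂ := fun h => h2 (h ▸ x21)
    have c12 : c₁ ≠ c₂ := fun h => h1 (h ▸ a2)
    have c32 : c₃ ≠ c₂ := fun h => h6 (h ▸ x32)
    refine step A x₂ hx₂ c₂ hc₂ (hne a2).symm (hne b2).symm h4 a2 b2 (ih (n + 2) (by omega) _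
      ⟨x₁, hx₁, c₁, hc₁, ?_, ?_, x₃, hx₃, c₃, hc₃, ?_, ?_, Reach.pivot hr hx₃ fun m hm k hk hkr =>
        ⟨hne (far m hm k hk hkr), far m hm k hk hkr⟩⟩)
    · rwa [pivot_of_col_eq_zero _ (hne a2) a2]
    · rwa [pivot_of_row_eq_zero _ c12 x21]
    · rw [pivot_ne _ x12 c32, x13, zero_sub]
      exact neg_ne_zero.2 (div_ne_zero (mul_ne_zero h3 h5) h4)
    · rwa [pivot_of_col_eq_zero _ (hne x32) x32]

end Connected

section Uniqueness

variable {X Y L K : Type*} [DecidableEq X] [DecidableEq Y] [Field L] [Field K]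
  {f : L → K} {P : Set X} {Q S s : Set Y} {A : X → Y → L} {A₁ A₂ : X → Y → K}

omit [DecidableEq X] [DecidableEq Y] in
lemma Good.ratio_eq {a b : X} {c y : Y} (h₁ : Good f P Q A A₁) (h₂ : Good f P Q A A₂)
    (ha : a ∈ P) (hb : b ∈ P) (hc : c ∈ Q) (hy : y ∈ Q) (hac : A a c ≠ 0) (hbc : A b c ≠ 0)
    (hay : A a y ≠ 0) (eac : A₁ a c = A₂ a c) (ebc : A₁ b c = A₂ b c) :
    A₂ a y * A₁ b y = A₂ b y * A₁ a y := by
  have e := (h₁.cross a ha b hb c hc y hy hay hbc).trans (h₂.cross a ha b hb c hc y hy hay hbc).symm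
  have n1 := h₂.ne ha hc hac
  have n2 := h₂.ne hb hc hbc
  have n3 := h₁.ne ha hy hay
  have n4 := h₂.ne ha hy hay
  unfold cr at e
  rw [eac, ebc] at e
  field_simp at e
  linear_combination e

lemma Lift.ratio_eq {a b : X} (ha : a ∈ P) (hb : b ∈ P) {y : Y} (hy : y ∈ Q) (hs : s ⊆ S)
    (hS : S ⊆ Q) (hl : Linked P s A a b) (h₁ : Lift f P Q S A A₁) (h₂ : Lift f P Q S A A₂)
    (he : ∀ i ∈ P, ∀ c ∈ s, A₁ i c = A₂ i c) (hay : A a y ≠ 0) (hby : A b y ≠ 0) :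
    A₂ a y * A₁ b y = A₂ b y * A₁ a y := by
  by_cases hab : a = b
  · rw [hab]
  obtain ⟨n, hn⟩ := hl.exists_reach
  clear hl
  refine reach_induction (P := P) (S := s) (motive := fun A => ∀ A₁ A₂ : X → Y → K,
    Lift f P Q S A A₁ → Lift f P Q S A A₂ → (∀ i ∈ P, ∀ c ∈ s, A₁ i c = A₂ i c) → A a y ≠ 0 →
    A b y ≠ 0 → A₂ a y * A₁ b y = A₂ b y * A₁ a y) hb hab ?_ ?_ ?_ n A hn A₁ A₂ h₁ h₂ he hay hby
  · intro A x hx c hc hxa hxb hxc hac hbc ih A₁ A₂ h₁ h₂ he hay hby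
    have hcQ := hS (hs hc)
    have := ih _ _ (h₁.pivot hx (hs hc) hxc) (h₂.pivot hx (hs hc) hxc) (pivot_congr he hx hc)
    rw [pivot_of_col_eq_zero _ hxa.symm hac, pivot_of_col_eq_zero _ hxb.symm hbc,
      pivot_of_col_eq_zero _ hxa.symm (h₁.good.zero ha hcQ hac),
      pivot_of_col_eq_zero _ hxb.symm (h₁.good.zero hb hcQ hbc),
      pivot_of_col_eq_zero _ hxa.symm (h₂.good.zero ha hcQ hac),
      pivot_of_col_eq_zero _ hxb.symm (h₂.good.zero hb hcQ hbc)] at this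
    exact this hay hby
  · intro A c hc hac hbc A₁ A₂ h₁ h₂ he hay hby
    exact h₁.good.ratio_eq h₂.good ha hb (hS (hs hc)) hy hac hbc hay (he a ha c hc) (he b hb c hc)
  · intro A z hz c hc d hd hac hzc hzd hbd had hbc A₁ A₂ h₁ h₂ he hay hby
    have hcQ := hS (hs hc)
    have hdQ := hS (hs hd)
    by_cases hzy : A z y = 0
    · have hza : a ≠ z := fun h => hzd (h ▸ had)
      have hzb : b ≠ z := fun h => hzc (h ▸ hbc)
      have hyc : y ≠ c := fun h => hzc (h ▸ hzy)
      have hdc : d ≠ c := fun h => hac (h ▸ had)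
      have h₁p := h₁.pivot hz (hs hc) hzc
      have h₂p := h₂.pivot hz (hs hc) hzc
      have hep := pivot_congr he hz hc
      have key := h₁p.good.ratio_eq h₂p.good ha hb hdQ hy (c := d) ?_ ?_ ?_ (hep a ha d hd)
        (hep b hb d hd)
      · rwa [pivot_of_row_eq_zero _ hyc (h₁.good.zero hz hy hzy),
          pivot_of_row_eq_zero _ hyc (h₂.good.zero hz hy hzy),
          pivot_of_row_eq_zero _ hyc (h₁.good.zero hz hy hzy),
          pivot_of_row_eq_zero _ hyc (h₂.good.zero hz hy hzy)] at key
      · rw [pivot_ne _ hza hdc, had, zero_sub]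
        exact neg_ne_zero.2 (div_ne_zero (mul_ne_zero hac hzd) hzc)
      · rwa [pivot_of_col_eq_zero _ hzb hbc]
      · rwa [pivot_of_row_eq_zero _ hyc hzy]
    · have e1 := h₁.good.ratio_eq h₂.good ha hz hcQ hy hac hzc hay (he a ha c hc) (he z hz c hc)
      have e2 := h₁.good.ratio_eq h₂.good hz hb hdQ hy hzd hbd hzy (he z hz d hd) (he b hb d hd)
      have n1 := h₁.good.ne hz hy hzy
      have n2 := h₂.good.ne hz hy hzy
      refine mul_right_cancel₀ (mul_ne_zero n1 n2) ?_
      linear_combination A₂ z y * A₁ b y * e1 + A₂ z y * A₁ a y * e2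

/-- Lifts are unique up to scaling. -/
theorem Lift.unique (hQ : Q.Finite) (h₁ : Lift f P Q Q A A₁) (h₂ : Lift f P Q Q A A₂) :
    ∃ r : X → K, ∃ c : Y → K, (∀ i, r i ≠ 0) ∧ (∀ j, c j ≠ 0) ∧
      ∀ i ∈ P, ∀ j ∈ Q, A₂ i j = DyadicLift.scale r c A₁ i j := by
  classical
  suffices H : ∀ s : Finset Y, ↑s ⊆ Q → ∃ r : X → K, ∃ c : Y → K, (∀ i, r i ≠ 0) ∧ (∀ j, c j ≠ 0) ∧
      ∀ i ∈ P, ∀ j ∈ s, A₂ i j = DyadicLift.scale r c A₁ i j by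
    obtain ⟨r, c, hr, hc, h⟩ := H hQ.toFinset (by simp)
    exact ⟨r, c, hr, hc, fun i hi j hj => h i hi j (by simpa using hj)⟩
  intro s
  induction s using Finset.induction_on with
  | empty => exact fun _ => ⟨fun _ => 1, fun _ => 1, by simp, by simp, by simp⟩
  | insert y s hys ih =>
    intro hsQ
    rw [Finset.coe_insert, insert_subset_iff] at hsQ
    obtain ⟨hy, hsQ⟩ := hsQ
    obtain ⟨r, c, hr, hc, he⟩ := ih hsQ
    have h₃ := h₁.scale_right hr hc
    set A₃ := DyadicLift.scale r c A₁ with hA₃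
    suffices H : ∃ r : X → K, ∃ c : Y → K, (∀ i, r i ≠ 0) ∧ (∀ j, c j ≠ 0) ∧
        ∀ i ∈ P, ∀ j ∈ insert y s, A₂ i j = DyadicLift.scale r c A₃ i j by
      obtain ⟨r', c', hr', hc', he'⟩ := H
      rw [hA₃, scale_scale] at he'
      exact ⟨_, _, fun i => mul_ne_zero (hr' i) (hr i), fun i => mul_ne_zero (hc' i) (hc i), he'⟩
    let p : X → X → Prop := fun a b => b ∈ P ∧ Linked P s A a b ∧ A b y ≠ 0
    let ρ : X → K := fun a => if h : ∃ b, p a b then A₂ h.choose y / A₃ h.choose y else 1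
    have hρ0 : ∀ a, ρ a ≠ 0 := by
      intro a
      by_cases h : ∃ b, p a b
      · simp only [ρ, dif_pos h]
        have := h.choose_spec
        exact div_ne_zero (h₂.good.ne this.1 hy this.2.2) (h₃.good.ne this.1 hy this.2.2)
      · simp [ρ, dif_neg h]
    have hρ : ∀ a b, p a b → ρ a = A₂ b y / A₃ b y := by
      intro a b hab
      have h : ∃ b, p a b := ⟨b, hab⟩
      simp only [ρ, dif_pos h]
      have := h.choose_spec
      rw [div_eq_div_iff (h₃.good.ne this.1 hy this.2.2) (h₃.good.ne hab.1 hy hab.2.2)]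
      exact Lift.ratio_eq this.1 hab.1 hy hsQ subset_rfl (this.2.1.symm.trans hab.2.1) h₃ h₂
        (fun i hi j hj => (he i hi j hj).symm) this.2.2 hab.2.2
    have hρl : ∀ a b, Linked P s A a b → ρ a = ρ b := by
      intro a b hab
      by_cases h : ∃ b, p a b
      · obtain ⟨k, hk⟩ := h
        rw [hρ a k hk, hρ b k ⟨hk.1, hab.symm.trans hk.2.1, hk.2.2⟩]
      · have h' : ¬ ∃ k, p b k := fun ⟨k, hk⟩ => h ⟨k, hk.1, hab.trans hk.2.1, hk.2.2⟩
        simp only [ρ, dif_neg h, dif_neg h']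
    let γ : Y → K := fun j => if j = y then 1 else
      if h : ∃ a ∈ P, A a j ≠ 0 then (ρ h.choose)⁻¹ else 1
    refine ⟨ρ, γ, hρ0, ?_, ?_⟩
    · intro j
      simp only [γ]
      split_ifs
      · exact one_ne_zero
      · exact inv_ne_zero (hρ0 _)
      · exact one_ne_zero
    · intro i hi j hj
      by_cases hij : A i j = 0
      · have hjQ : j ∈ Q := by
          rcases Finset.mem_insert.1 hj with rfl | hj
          exacts [hy, hsQ hj]
        simp [DyadicLift.scale, h₂.good.zero hi hjQ hij, h₃.good.zero hi hjQ hij]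
      rcases Finset.mem_insert.1 hj with rfl | hj
      · have := h₃.good.ne hi hy hij
        simp only [DyadicLift.scale, γ, if_true, mul_one, hρ i i ⟨hi, Linked.refl i, hij⟩]
        field_simp
      · have hjy : j ≠ y := fun h => hys (h ▸ hj)
        have h : ∃ a ∈ P, A a j ≠ 0 := ⟨i, hi, hij⟩
        have hl : Linked P s A h.choose i :=
          Linked.of_ne h.choose_spec.1 hi hj h.choose_spec.2 hij
        have := hρ0 i
        simp only [DyadicLift.scale, γ, if_neg hjy, dif_pos h, hρl _ _ hl]
        rw [he i hi j hj]
        field_simp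

end Uniqueness

section Gluing

variable {X Y L F K : Type*} [DecidableEq X] [DecidableEq Y] [Field L] [Field F] [Field K]
  {f : L → K} {g : L → F} {P : Set X} {Q : Set Y} {A : X → Y → L} {A' A₁ A₂ : X → Y → K}
  {B : X → Y → F} {u v : Y}

/-- `A'` is a lift of `A` away from the column `u`, and away from the column `v`. -/
structure LiftPair (f : L → K) (g : L → F) (P : Set X) (Q : Set Y) (u v : Y) (A : X → Y → L)
    (A' : X → Y → K) (B : X → Y → F) : Prop where
  hB : Lift g P Q Q A B
  left : Lift f P (Q \ {u}) (Q \ {u}) A A'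
  right : Lift f P (Q \ {v}) (Q \ {v}) A A'
  hu : u ∈ Q
  hv : v ∈ Q
  huv : u ≠ v

lemma LiftPair.symm (h : LiftPair f g P Q u v A A' B) : LiftPair f g P Q v u A A' B :=
  ⟨h.hB, h.right, h.left, h.hv, h.hu, h.huv.symm⟩

lemma LiftPair.pivot (h : LiftPair f g P Q u v A A' B) {x : X} {c : Y} (hx : x ∈ P)
    (hc : c ∈ Q \ {u, v}) (hxc : A x c ≠ 0) :
    LiftPair f g P Q u v (pivot A x c) (pivot A' x c) (pivot B x c) := by
  simp only [mem_sdiff, mem_insert_iff, mem_singleton_iff, not_or] at hc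
  exact ⟨h.hB.pivot hx hc.1 hxc, h.left.pivot hx ⟨hc.1, hc.2.1⟩ hxc,
    h.right.pivot hx ⟨hc.1, hc.2.2⟩ hxc, h.hu, h.hv, h.huv⟩

lemma LiftPair.supp (h : LiftPair f g P Q u v A A' B) :
    ∀ i ∈ P, ∀ c ∈ Q, A' i c = 0 ↔ A i c = 0 := by
  intro i hi c hc
  by_cases hcu : c = u
  · exact h.right.good.supp i hi c ⟨hc, fun hcv => h.huv (hcu.symm.trans hcv)⟩
  · exact h.left.good.supp i hi c ⟨hc, hcu⟩

lemma LiftPair.zero (h : LiftPair f g P Q u v A A' B) {i : X} (hi : i ∈ P) {c : Y} (hc : c ∈ Q)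
    (h0 : A i c = 0) : A' i c = 0 := (h.supp i hi c hc).2 h0

lemma LiftPair.ne (h : LiftPair f g P Q u v A A' B) {i : X} (hi : i ∈ P) {c : Y} (hc : c ∈ Q)
    (h0 : A i c ≠ 0) : A' i c ≠ 0 := mt (h.supp i hi c hc).1 h0

lemma LiftPair.cross (h : LiftPair f g P Q u v A A' B) {i j : X} (hi : i ∈ P) (hj : j ∈ P)
    {c d : Y} (hc : c ∈ Q) (hd : d ∈ Q) (hcd : c ≠ u ∧ d ≠ u ∨ c ≠ v ∧ d ≠ v) (h1 : A i d ≠ 0)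
    (h2 : A j c ≠ 0) : cr A' i j c d = f (cr A i j c d) := by
  rcases hcd with ⟨hcu, hdu⟩ | ⟨hcv, hdv⟩
  · exact h.left.good.cross i hi j hj c ⟨hc, hcu⟩ d ⟨hd, hdu⟩ h1 h2
  · exact h.right.good.cross i hi j hj c ⟨hc, hcv⟩ d ⟨hd, hdv⟩ h1 h2

lemma cr_eq_pivot_mul {A : X → Y → K} {a b z : X} {u v d : Y} (haz : a ≠ z) (hbz : b ≠ z)
    (hud : u ≠ d) (hvd : v ≠ d) (hzd : A z d ≠ 0) (hbu : A b u ≠ 0) (had : A a d = 0)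
    (hzv : A z v = 0) (hp : pivot A z d b u ≠ 0) :
    cr (pivot A z d) a b u v * (1 - cr A z b u d) = cr A a b u v := by
  rw [pivot_ne_eq_mul A hbz hud hzd hbu] at hp
  have h := right_ne_zero_of_mul hp
  rw [cr, pivot_ne_eq_mul A hbz hud hzd hbu, pivot_of_col_eq_zero A haz had,
    pivot_of_col_eq_zero A haz had, pivot_of_row_eq_zero A hvd hzv]
  generalize 1 - cr A z b u d = q at h ⊢
  unfold cr
  field_simp

lemma cr_eq_neg_pivot {A : X → Y → K} {a b z : X} {u v c d : Y} (haz : a ≠ z) (hbz : b ≠ z)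
    (hdc : d ≠ c) (hvc : v ≠ c) (hud : u ≠ d) (huc : u ≠ c) (hzc : A z c ≠ 0) (hzd : A z d ≠ 0)
    (hbu : A b u ≠ 0) (hbd : A b d ≠ 0) (hav : A a v ≠ 0) (had : A a d = 0) (hbc : A b c = 0)
    (hzv : A z v = 0) (hp : pivot A z d b u = 0) (hp' : pivot A z c a u = 0) :
    cr A a b u v = -1 * cr (pivot A z c) a b d v := by
  rw [pivot_ne _ hbz hud, sub_eq_zero] at hp
  rw [pivot_ne _ haz huc, sub_eq_zero] at hp'
  have hzu : A z u ≠ 0 := fun h => hbu (by rw [hp, h]; simp)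
  rw [cr, cr, pivot_of_col_eq_zero _ hbz hbc, pivot_of_col_eq_zero _ hbz hbc,
    pivot_of_row_eq_zero _ hvc hzv, pivot_ne _ haz hdc, had, hp, hp']
  field_simp
  ring

variable (hf : LiftFun f) (hg : LiftFun g) (ht : TrivialProducts g)

include hf ht in
lemma LiftPair.cross_of_common (h : LiftPair f g P Q u v A A' B) {a b : X} (ha : a ∈ P)
    (hb : b ∈ P) {c : Y} (hc : c ∈ Q \ {u, v}) (hac : A a c ≠ 0) (hbc : A b c ≠ 0)
    (hau : A a u ≠ 0) (hav : A a v ≠ 0) (hbu : A b u ≠ 0) (hbv : A b v ≠ 0) :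
    cr A' a b u v = f (cr A a b u v) := by
  simp only [mem_sdiff, mem_insert_iff, mem_singleton_iff, not_or] at hc
  obtain ⟨hcQ, hcu, hcv⟩ := hc
  have hgB := h.hB.good
  have e := cr_mul_col A (i := a) (j := b) (c := u) (e := c) (d := v) hac hbc
  have e' := cr_mul_col A' (i := a) (j := b) (c := u) (e := c) (d := v) (h.ne ha hcQ hac)
    (h.ne hb hcQ hbc)
  have eB := cr_mul_col B (i := a) (j := b) (c := u) (e := c) (d := v) (hgB.ne ha hcQ hac)
    (hgB.ne hb hcQ hbc)
  rw [hgB.cross a ha b hb u h.hu c hcQ hac hbu, hgB.cross a ha b hb c hcQ v h.hv hav hbc,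
    hgB.cross a ha b hb u h.hu v h.hv hav hbu, ← e] at eB
  rw [← e, hf.mul ht (cr_ne_zero hau hbc hac hbu) (cr_ne_zero hac hbv hav hbc) eB.symm, ← e',
    h.cross ha hb h.hu hcQ (Or.inr ⟨h.huv, hcv⟩) hac hbu,
    h.cross ha hb hcQ h.hv (Or.inl ⟨hcu, h.huv.symm⟩) hav hbc]

include hf hg ht in
lemma LiftPair.cross_aux (h : LiftPair f g P Q u v A A' B) {a b z : X} (ha : a ∈ P)
    (hb : b ∈ P) (hz : z ∈ P) {c d : Y} (hc : c ∈ Q \ {u, v}) (hd : d ∈ Q \ {u, v})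
    (hac : A a c ≠ 0) (hzc : A z c ≠ 0) (hzd : A z d ≠ 0) (hbd : A b d ≠ 0) (had : A a d = 0)
    (hbc : A b c = 0) (hau : A a u ≠ 0) (hav : A a v ≠ 0) (hbu : A b u ≠ 0) (hbv : A b v ≠ 0)
    (hzv : A z v = 0) (hp : DyadicLift.pivot A z d b u ≠ 0) :
    cr A' a b u v = f (cr A a b u v) := by
  have hp₁ := h.pivot hz hd hzd
  have hdQ := hd.1
  have hcQ := hc.1
  have hc' := hc
  simp only [mem_sdiff, mem_insert_iff, mem_singleton_iff, not_or] at hc hd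
  have haz : a ≠ z := fun h => hzd (h ▸ had)
  have hbz : b ≠ z := fun h => hzc (h ▸ hbc)
  have hcd : c ≠ d := fun h => hac (h ▸ had)
  have hud := Ne.symm hd.2.1
  have hvd := Ne.symm hd.2.2
  have hgB := h.hB.good
  have key := hp₁.cross_of_common hf ht ha hb hc' ?_ ?_ ?_ ?_ hp ?_
  rotate_left
  · rwa [pivot_of_col_eq_zero _ haz had]
  · rw [pivot_ne _ hbz hcd, hbc, zero_sub]
    exact neg_ne_zero.2 (div_ne_zero (mul_ne_zero hbd hzc) hzd)
  · rwa [pivot_of_col_eq_zero _ haz had]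
  · rwa [pivot_of_col_eq_zero _ haz had]
  · rwa [pivot_of_row_eq_zero _ hvd hzv]
  have e := cr_eq_pivot_mul haz hbz hud hvd hzd hbu had hzv hp
  have e' := cr_eq_pivot_mul haz hbz hud hvd (h.ne hz hdQ hzd) (h.ne hb h.hu hbu)
    (h.zero ha hdQ had) (h.zero hz h.hv hzv) (hp₁.ne hb h.hu hp)
  have eB := cr_eq_pivot_mul haz hbz hud hvd (hgB.ne hz hdQ hzd) (hgB.ne hb h.hu hbu)
    (hgB.zero ha hdQ had) (hgB.zero hz h.hv hzv) (hp₁.hB.good.ne hb h.hu hp)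
  have hpv : DyadicLift.pivot A z d a v ≠ 0 := by rwa [pivot_of_col_eq_zero _ haz had]
  rw [hp₁.hB.good.cross a ha b hb u h.hu v h.hv hpv hp, hgB.cross a ha b hb u h.hu v h.hv hav hbu,
    hgB.cross z hz b hb u h.hu d hdQ hzd hbu, ← hg.one_sub, ← e] at eB
  have hne := cr_ne_zero hau hbv hav hbu
  rw [← e] at hne
  rw [← e, hf.mul ht (left_ne_zero_of_mul hne) (right_ne_zero_of_mul hne) eB.symm, ← e', key,
    hf.one_sub, h.cross hz hb h.hu hdQ (Or.inr ⟨h.huv, hd.2.2⟩) hzd hbu]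

include hf hg ht in
lemma LiftPair.cross_of_eq_zero (h2 : (-1 : L) ≠ 1) (h : LiftPair f g P Q u v A A' B) {a b z : X}
    (ha : a ∈ P) (hb : b ∈ P) (hz : z ∈ P) {c d : Y} (hc : c ∈ Q \ {u, v}) (hd : d ∈ Q \ {u, v})
    (hac : A a c ≠ 0) (hzc : A z c ≠ 0) (hzd : A z d ≠ 0) (hbd : A b d ≠ 0) (had : A a d = 0)
    (hbc : A b c = 0) (hau : A a u ≠ 0) (hav : A a v ≠ 0) (hbu : A b u ≠ 0) (hbv : A b v ≠ 0)
    (hzv : A z v = 0) :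
    cr A' a b u v = f (cr A a b u v) := by
  by_cases hp : DyadicLift.pivot A z d b u = 0
  swap
  · exact h.cross_aux hf hg ht ha hb hz hc hd hac hzc hzd hbd had hbc hau hav hbu hbv hzv hp
  by_cases hp' : DyadicLift.pivot A z c a u = 0
  swap
  · rw [cr_swap_row _ b a, cr_swap_row _ b a, hf.inv]
    congr 1
    exact h.cross_aux hf hg ht hb ha hz hd hc hbd hzd hzc hac hbc had hbu hbv hau hav hzv hp'
  have hp₁ := h.pivot hz hd hzd
  have hp₂ := h.pivot hz hc hzc
  have hdQ := hd.1
  have hcQ := hc.1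
  simp only [mem_sdiff, mem_insert_iff, mem_singleton_iff, not_or] at hc hd
  have haz : a ≠ z := fun h => hzd (h ▸ had)
  have hbz : b ≠ z := fun h => hzc (h ▸ hbc)
  have hdc : d ≠ c := fun h => hac (h ▸ had)
  have hgB := h.hB.good
  have hvc := Ne.symm hc.2.2
  have hud := Ne.symm hd.2.1
  have huc := Ne.symm hc.2.1
  have hpd : DyadicLift.pivot A z c a d ≠ 0 := by
    rw [pivot_ne _ haz hdc, had, zero_sub]
    exact neg_ne_zero.2 (div_ne_zero (mul_ne_zero hac hzd) hzc)
  have hpv : DyadicLift.pivot A z c a v ≠ 0 := by rwa [pivot_of_row_eq_zero _ hvc hzv]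
  have hpbd : DyadicLift.pivot A z c b d ≠ 0 := by rwa [pivot_of_col_eq_zero _ hbz hbc]
  have hpbv : DyadicLift.pivot A z c b v ≠ 0 := by rwa [pivot_of_col_eq_zero _ hbz hbc]
  have e := cr_eq_neg_pivot haz hbz hdc hvc hud huc hzc hzd hbu hbd hav had hbc hzv hp hp'
  have e' := cr_eq_neg_pivot haz hbz hdc hvc hud huc (h.ne hz hcQ hzc) (h.ne hz hdQ hzd)
    (h.ne hb h.hu hbu) (h.ne hb hdQ hbd) (h.ne ha h.hv hav) (h.zero ha hdQ had)
    (h.zero hb hcQ hbc) (h.zero hz h.hv hzv) (hp₁.zero hb h.hu hp) (hp₂.zero ha h.hu hp')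
  have eB := cr_eq_neg_pivot haz hbz hdc hvc hud huc (hgB.ne hz hcQ hzc) (hgB.ne hz hdQ hzd)
    (hgB.ne hb h.hu hbu) (hgB.ne hb hdQ hbd) (hgB.ne ha h.hv hav) (hgB.zero ha hdQ had)
    (hgB.zero hb hcQ hbc) (hgB.zero hz h.hv hzv) (hp₁.hB.good.zero hb h.hu hp)
    (hp₂.hB.good.zero ha h.hu hp')
  rw [hgB.cross a ha b hb u h.hu v h.hv hav hbu,
    hp₂.hB.good.cross a ha b hb d hdQ v h.hv hpv hpbd, e, ← hg.neg_one h2] at eB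
  rw [e, hf.mul ht (neg_ne_zero.2 one_ne_zero) (cr_ne_zero hpd hpbv hpv hpbd) eB, hf.neg_one h2,
    e', hp₂.cross ha hb hdQ h.hv (Or.inl ⟨hd.2.1, h.huv.symm⟩) hpv hpbd]

include hf hg ht in
lemma LiftPair.cross_of_linked (h2 : (-1 : L) ≠ 1) (h : LiftPair f g P Q u v A A' B) {a b : X}
    (ha : a ∈ P) (hb : b ∈ P) (hab : a ≠ b) (hl : Linked P (Q \ {u, v}) A a b)
    (hau : A a u ≠ 0) (hav : A a v ≠ 0) (hbu : A b u ≠ 0) (hbv : A b v ≠ 0) :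
    cr A' a b u v = f (cr A a b u v) := by
  obtain ⟨n, hn⟩ := hl.exists_reach
  clear hl
  refine reach_induction (P := P) (S := Q \ {u, v}) (motive := fun A => ∀ A' B,
    LiftPair f g P Q u v A A' B → A a u ≠ 0 → A a v ≠ 0 → A b u ≠ 0 → A b v ≠ 0 →
    cr A' a b u v = f (cr A a b u v)) hb hab ?_ ?_ ?_ n A hn A' B h hau hav hbu hbv
  · intro A x hx c hc hxa hxb hxc hac hbc ih A' B h hau hav hbu hbv
    have := ih _ _ (h.pivot hx hc hxc)
    unfold cr at this ⊢
    simp only [pivot_of_col_eq_zero _ hxa.symm hac, pivot_of_col_eq_zero _ hxb.symm hbc,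
      pivot_of_col_eq_zero _ hxa.symm (h.zero ha hc.1 hac),
      pivot_of_col_eq_zero _ hxb.symm (h.zero hb hc.1 hbc)] at this
    exact this hau hav hbu hbv
  · intro A c hc hac hbc A' B h hau hav hbu hbv
    exact h.cross_of_common hf ht ha hb hc hac hbc hau hav hbu hbv
  · intro A z hz c hc d hd hac hzc hzd hbd had hbc A' B h hau hav hbu hbv
    by_cases hzv : A z v = 0
    · exact h.cross_of_eq_zero hf hg ht h2 ha hb hz hc hd hac hzc hzd hbd had hbc hau hav hbu hbv hzv
    by_cases hzu : A z u = 0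
    · rw [cr_swap_col _ a b v u, cr_swap_col _ a b v u, hf.inv]
      congr 1
      rw [pair_comm] at hc hd
      exact h.symm.cross_of_eq_zero hf hg ht h2 ha hb hz hc hd hac hzc hzd hbd had hbc hav hau hbv
        hbu hzu
    have e := cr_mul_row A (i := a) (k := z) (j := b) hzu hzv
    have e' := cr_mul_row A' (i := a) (k := z) (j := b) (h.ne hz h.hu hzu) (h.ne hz h.hv hzv)
    have hgB := h.hB.good
    have eB := cr_mul_row B (i := a) (k := z) (j := b) (hgB.ne hz h.hu hzu) (hgB.ne hz h.hv hzv)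
    rw [hgB.cross a ha z hz u h.hu v h.hv hav hzu, hgB.cross z hz b hb u h.hu v h.hv hzv hbu,
      hgB.cross a ha b hb u h.hu v h.hv hav hbu, ← e] at eB
    rw [← e, hf.mul ht (cr_ne_zero hau hzv hav hzu) (cr_ne_zero hzu hbv hzv hbu) eB.symm, ← e',
      h.cross_of_common hf ht ha hz hc hac hzc hau hav hzu hzv,
      h.cross_of_common hf ht hz hb hd hzd hbd hzu hzv hbu hbv]

include hf hg ht in
/-- Lifts away from two columns whose removal keeps the rows connected can be glued. -/
theorem Lift.glue (h2 : (-1 : L) ≠ 1) (hQ : Q.Finite) (hu : u ∈ Q) (hv : v ∈ Q) (huv : u ≠ v)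
    (hconn : RowConn P (Q \ {u, v}) A) (h₁ : Lift f P (Q \ {u}) (Q \ {u}) A A₁)
    (h₂ : Lift f P (Q \ {v}) (Q \ {v}) A A₂) (hB : Lift g P Q Q A B) :
    ∃ A', Lift f P Q Q A A' := by
  have hsu : Q \ {u, v} ⊆ Q \ {u} := sdiff_subset_sdiff_right (by simp)
  have hsv : Q \ {u, v} ⊆ Q \ {v} := sdiff_subset_sdiff_right (by simp)
  obtain ⟨r, c, hr, hc, he⟩ := Lift.unique hQ.sdiff (h₂.mono subset_rfl hsv hsv)
    (h₁.mono subset_rfl hsu hsu)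
  have h₃ := h₂.scale_right hr hc
  set A₃ := DyadicLift.scale r c A₂
  let A' : X → Y → K := fun i j => if j = u then A₃ i j else A₁ i j
  have hp : LiftPair f g P Q u v A A' B := by
    refine ⟨hB, h₁.congr subset_rfl (fun _ _ _ _ => rfl) fun i _ j hj => (if_neg hj.2).symm,
      h₃.congr subset_rfl (fun _ _ _ _ => rfl) fun i hi j hj => ?_, hu, hv, huv⟩
    by_cases hju : j = u
    · exact (if_pos hju).symm
    · simp only [A', if_neg hju]
      exact (he i hi j ⟨hj.1, by simpa using ⟨hju, hj.2⟩⟩).symm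
  have key : Lift f P Q (Q \ {u, v}) A A' := by
    refine ⟨fun C C' => (∃ E, LiftPair f g P Q u v C C' E) ∧ RowConn P (Q \ {u, v}) C,
      ⟨⟨B, hp⟩, hconn⟩, ?_⟩
    rintro C C' ⟨⟨E, h⟩, hC⟩
    refine ⟨Good.of_ne hf h.supp ?_, fun x hx y hy hxy =>
      ⟨⟨_, h.pivot hx hy hxy⟩, hC.pivot hx hy hxy⟩⟩
    intro i hi j hj c hc d hd hij hcd hic hjd hid hjc
    by_cases hcu : c = u
    · subst hcu
      by_cases hdv : d = v
      · subst hdv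
        exact h.cross_of_linked hf hg ht h2 hi hj hij (hC i hi j hj) hic hid hjc hjd
      · exact h.cross hi hj hc hd (Or.inr ⟨huv, hdv⟩) hid hjc
    by_cases hdu : d = u
    · subst hdu
      by_cases hcv : c = v
      · subst hcv
        rw [cr_swap_col _ i j d c, cr_swap_col _ i j d c, hf.inv]
        congr 1
        exact h.cross_of_linked hf hg ht h2 hi hj hij (hC i hi j hj) hid hic hjd hjc
      · exact h.cross hi hj hc hd (Or.inr ⟨hcv, huv⟩) hid hjc
    exact h.cross hi hj hc hd (Or.inl ⟨hcu, hdu⟩) hid hjc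
  have hins : insert u (Q \ {u, v}) = Q \ {v} := by
    ext j
    simp only [mem_insert_iff, mem_sdiff, mem_singleton_iff]
    grind
  have h4 := key.upgrade hf hg ht hB sdiff_subset hu ?_
  · rw [hins] at h4
    have h5 := h4.upgrade hf hg ht hB sdiff_subset hv ?_
    · rw [insert_sdiff_singleton, insert_eq_of_mem hv] at h5
      exact ⟨A', h5⟩
    · intro c hc d hd hcd
      simp only [mem_insert_iff, mem_sdiff, mem_singleton_iff]
      grind
  · rw [hins]
    intro c hc d hd hcd
    simp only [mem_sdiff, mem_singleton_iff]
    grind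

end Gluing

section Existence

variable {X Y L F K : Type*} [Field L] [Field F] [Field K] {f : L → K} {g : L → F} {P : Set X}
  {Q S T : Set Y} {A : X → Y → L}

lemma Linked.mono {a b : X} (h : Linked P S A a b) (hST : S ⊆ T) : Linked P T A a b :=
  fun p q hpq => h p q fun x hx y hy => hpq x hx y (hST hy)

lemma RowConn.exists_step (h : RowConn P Q A) {P₀ : Set X} {a b : X} (ha : a ∈ P) (ha₀ : a ∈ P₀)
    (hb : b ∈ P) (hb₀ : b ∉ P₀) :
    ∃ x ∈ P, x ∉ P₀ ∧ ∃ y ∈ Q, A x y ≠ 0 ∧ ∃ z ∈ P₀, A z y ≠ 0 := by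
  by_contra hcon
  refine hb₀ ((h a ha b hb (· ∈ P₀) (fun y => ∃ z ∈ P₀, A z y ≠ 0) ?_).1 ha₀)
  intro x hx y hy hxy
  refine ⟨fun hx₀ => ⟨x, hx₀, hxy⟩, fun hz => ?_⟩
  by_contra hx₀
  exact hcon ⟨x, hx, hx₀, y, hy, hxy, hz⟩

/-- A set of linked rows, found using few columns, can be enlarged to all rows. -/
lemma exists_rowConn_ncard_le (hP : P.Finite) (h : RowConn P Q A) {k : ℕ}
    {P₀ : Set X} {T₀ : Set Y} (hP₀ : P₀ ⊆ P) (hT₀ : T₀ ⊆ Q) (hne : P₀.Nonempty)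
    (h₀ : ∀ a ∈ P₀, ∀ b ∈ P₀, Linked P T₀ A a b) (hk : T₀.ncard + k ≤ P₀.ncard) :
    ∃ T ⊆ Q, RowConn P T A ∧ T.ncard + k ≤ P.ncard := by
  induction hn : P.ncard - P₀.ncard using Nat.strong_induction_on generalizing P₀ T₀ with
  | _ n ih =>
  by_cases hPP : P₀ = P
  · subst hPP
    exact ⟨T₀, hT₀, h₀, hk⟩
  obtain ⟨b, hb, hb₀⟩ := exists_of_ssubset (hP₀.ssubset_of_ne hPP)
  obtain ⟨a, ha⟩ := hne
  obtain ⟨x, hx, hx₀, y, hy, hxy, z, hz, hzy⟩ := h.exists_step (hP₀ ha) ha hb hb₀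
  have hsub : insert x P₀ ⊆ P := insert_subset hx hP₀
  have hcard : (insert x P₀).ncard = P₀.ncard + 1 := ncard_insert_of_notMem hx₀ (hP.subset hP₀)
  have hle := ncard_le_ncard hsub hP
  have hlink : ∀ a ∈ insert x P₀, Linked P (insert y T₀) A a z := by
    rintro a (rfl | ha)
    · exact .of_ne hx (hP₀ hz) (mem_insert _ _) hxy hzy
    · exact (h₀ a ha z hz).mono (subset_insert _ _)
  refine ih _ ?_ hsub (insert_subset hy hT₀) ⟨x, mem_insert _ _⟩
    (fun a ha b hb => (hlink a ha).trans (hlink b hb).symm) ?_ rfl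
  · omega
  · have := ncard_insert_le y T₀
    omega

lemma exists_rowConn_sdiff (hQ : Q.Finite) (hTQ : T ⊆ Q) (hT : RowConn P T A)
    (hc : T.ncard + 2 ≤ Q.ncard) : ∃ u ∈ Q, ∃ v ∈ Q, u ≠ v ∧ RowConn P (Q \ {u, v}) A := by
  have h1 : (Q \ T).ncard = Q.ncard - T.ncard := ncard_sdiff hTQ (hQ.subset hTQ)
  obtain ⟨u, hu, v, hv, huv⟩ := (one_lt_ncard hQ.sdiff).1 (by omega : 1 < (Q \ T).ncard)
  refine ⟨u, hu.1, v, hv.1, huv, fun a ha b hb => (hT a ha b hb).mono fun y hy => ⟨hTQ hy, ?_⟩⟩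
  rintro (rfl | rfl)
  exacts [hu.2 hy, hv.2 hy]

variable [DecidableEq X] [DecidableEq Y]

lemma pivot_block {p : X → Prop} {q : Y → Prop} {C : X → Y → K}
    (hC : ∀ x ∈ P, ∀ y ∈ Q, C x y ≠ 0 → (p x ↔ q y)) {x : X} (hx : x ∈ P) {y : Y} (hy : y ∈ Q)
    (hxy : C x y ≠ 0) : ∀ i ∈ P, ∀ j ∈ Q, pivot C x y i j ≠ 0 → (p i ↔ q j) := by
  intro i hi j hj h
  by_contra hij
  have h0 : C i j = 0 := by
    by_contra h0
    exact hij (hC i hi j hj h0)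
  by_cases hix : i = x
  · subst hix
    by_cases hjy : j = y
    · subst hjy; exact hxy h0
    · rw [pivot_row _ hjy, h0, zero_div] at h
      exact h rfl
  by_cases hjy : j = y
  · subst hjy
    rw [pivot_col _ hix, h0, zero_div, neg_zero] at h
    exact h rfl
  rw [pivot_ne _ hix hjy, h0, zero_sub, neg_ne_zero] at h
  have h1 : C i y ≠ 0 := fun h' => h (by simp [h'])
  have h2 : C x j ≠ 0 := fun h' => h (by simp [h'])
  exact hij (((hC i hi y hy h1).trans (hC x hx y hy hxy).symm).trans (hC x hx j hj h2))

lemma Lift.block {p : X → Prop} {q : Y → Prop} {A₁ A₂ : X → Y → K}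
    (hpq : ∀ x ∈ P, ∀ y ∈ Q, A x y ≠ 0 → (p x ↔ q y))
    (h₁ : Lift f {x ∈ P | p x} {y ∈ Q | q y} {y ∈ Q | q y} A A₁)
    (h₂ : Lift f {x ∈ P | ¬p x} {y ∈ Q | ¬q y} {y ∈ Q | ¬q y} A A₂) (hf : LiftFun f) :
    ∃ A', Lift f P Q Q A A' := by
  classical
  refine ⟨fun x y => if p x ↔ q y then if p x then A₁ x y else A₂ x y else 0, fun C C' =>
    (∀ x ∈ P, ∀ y ∈ Q, C x y ≠ 0 → (p x ↔ q y)) ∧ (∀ x ∈ P, ∀ y ∈ Q, C' x y ≠ 0 → (p x ↔ q y)) ∧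
    Lift f {x ∈ P | p x} {y ∈ Q | q y} {y ∈ Q | q y} C C' ∧
    Lift f {x ∈ P | ¬p x} {y ∈ Q | ¬q y} {y ∈ Q | ¬q y} C C', ⟨hpq, ?_, ?_, ?_⟩, ?_⟩
  · intro x _ y _ h
    by_contra h'
    simp [h'] at h
  · exact h₁.congr subset_rfl (fun _ _ _ _ => rfl) fun i hi c hc => by simp [hi.2, hc.2]
  · exact h₂.congr subset_rfl (fun _ _ _ _ => rfl) fun i hi c hc => by simp [hi.2, hc.2]
  rintro C C' ⟨hC, hC', h1, h2⟩
  have hsupp : ∀ i ∈ P, ∀ c ∈ Q, C' i c = 0 ↔ C i c = 0 := by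
    intro i hi c hc
    by_cases hic : p i ↔ q c
    · by_cases hi' : p i
      · exact h1.good.supp i ⟨hi, hi'⟩ c ⟨hc, hic.1 hi'⟩
      · exact h2.good.supp i ⟨hi, hi'⟩ c ⟨hc, mt hic.2 hi'⟩
    · exact ⟨fun _ => of_not_not (mt (hC i hi c hc) hic), fun _ => of_not_not (mt (hC' i hi c hc) hic)⟩
  refine ⟨.of_ne hf hsupp ?_, ?_⟩
  · intro i hi j hj c hc d hd _ _ hic hjd hid hjc
    have e1 := hC i hi c hc hic
    have e2 := hC i hi d hd hid
    have e3 := hC j hj c hc hjc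
    by_cases hi' : p i
    · have hc' := e1.1 hi'
      exact h1.good.cross i ⟨hi, hi'⟩ j ⟨hj, e3.2 hc'⟩ c ⟨hc, hc'⟩ d ⟨hd, e2.1 hi'⟩ hid hjc
    · have hc' := mt e1.2 hi'
      exact h2.good.cross i ⟨hi, hi'⟩ j ⟨hj, mt e3.1 hc'⟩ c ⟨hc, hc'⟩ d ⟨hd, mt e2.2 hi'⟩ hid hjc
  intro x hx y hy hxy
  have hxy' := mt (hsupp x hx y hy).1 hxy
  have e := hC x hx y hy hxy
  have zero : ∀ i ∈ P, ∀ j ∈ Q, ¬ (p i ↔ q j) → C i j = 0 := fun i hi j hj h =>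
    of_not_not (mt (hC i hi j hj) h)
  have zero' : ∀ i ∈ P, ∀ j ∈ Q, ¬ (p i ↔ q j) → C' i j = 0 := fun i hi j hj h =>
    of_not_not (mt (hC' i hi j hj) h)
  refine ⟨pivot_block hC hx hy hxy, pivot_block hC' hx hy hxy', ?_, ?_⟩
  · by_cases hx' : p x
    · exact h1.pivot ⟨hx, hx'⟩ ⟨hy, e.1 hx'⟩ hxy
    · have hne : ∀ i, p i → i ≠ x := fun i hi h => hx' (h ▸ hi)
      refine h1.congr subset_rfl (fun i hi c hc => ?_) fun i hi c hc => ?_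
      · rw [pivot_of_col_eq_zero _ (hne i hi.2) (zero i hi.1 y hy (by have := hi.2; tauto))]
      · rw [pivot_of_col_eq_zero _ (hne i hi.2) (zero' i hi.1 y hy (by have := hi.2; tauto))]
  · by_cases hx' : p x
    · have hne : ∀ i, ¬ p i → i ≠ x := fun i hi h => hi (h ▸ hx')
      refine h2.congr subset_rfl (fun i hi c hc => ?_) fun i hi c hc => ?_
      · rw [pivot_of_col_eq_zero _ (hne i hi.2) (zero i hi.1 y hy (by have := hi.2; tauto))]
      · rw [pivot_of_col_eq_zero _ (hne i hi.2) (zero' i hi.1 y hy (by have := hi.2; tauto))]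
    · exact h2.pivot ⟨hx, hx'⟩ ⟨hy, mt e.2 hx'⟩ hxy

lemma exists_lift_pair (hf : LiftFun f) (a b : X) (c d : Y) (A : X → Y → L) :
    ∃ A', Lift f {a, b} {c, d} {c, d} A A' := by
  suffices h : ∃ A', Good f {a, b} {c, d} A A' by
    obtain ⟨A', h⟩ := h
    refine ⟨A', Good f {a, b} {c, d}, h, fun C C' hC => ⟨hC, fun x hx y hy hxy => ?_⟩⟩
    refine .of_ne hf (hC.pivot_supp hf hx hy hxy) ?_
    have hxy' := hC.ne hx hy hxy
    have key : ∀ i ∈ ({a, b} : Set X), ∀ j ∈ ({c, d} : Set Y), i ≠ x → j ≠ y →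
        DyadicLift.pivot C x y x j ≠ 0 → DyadicLift.pivot C x y i y ≠ 0 → 
        cr (DyadicLift.pivot C' x y) x i y j = f (cr (DyadicLift.pivot C x y) x i y j) := by
      intro i hi j hj hix hjy h1 h2
      rw [pivot_row _ hjy] at h1
      rw [pivot_col _ hix] at h2
      have h1 : C x j ≠ 0 := fun h => h1 (by simp [h])
      have h2 : C i y ≠ 0 := fun h => h2 (by simp [h])
      rw [cr_pivot_self _ hix hjy hxy h1 h2,
        cr_pivot_self _ hix hjy hxy' (hC.ne hx hj h1) (hC.ne hi hy h2),
        hC.cross x hx i hi y hy j hj h1 h2, hf.one_sub]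
    intro i hi j hj k hk l hl hij hkl h1 h2 h3 h4
    have hx2 : x = i ∨ x = j := by
      rcases hx with rfl | rfl <;> rcases hi with rfl | rfl <;> rcases hj with rfl | rfl <;> simp_all
    have hy2 : y = k ∨ y = l := by
      rcases hy with rfl | rfl <;> rcases hk with rfl | rfl <;> rcases hl with rfl | rfl <;> simp_all
    rcases hx2 with rfl | rfl <;> rcases hy2 with rfl | rfl
    · exact key j hj l hl hij.symm hkl.symm h3 h4
    · rw [cr_swap_col _ _ _ y k, cr_swap_col _ _ _ y k, key j hj k hk hij.symm hkl h1 h2, hf.inv]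
    · rw [cr_swap_row, cr_swap_row _ x i, key i hi l hl hij hkl.symm h2 h1, hf.inv]
    · rw [cr_swap_row, cr_swap_row _ x i, cr_swap_col _ _ _ y k, cr_swap_col _ _ _ y k,
        key i hi k hk hij hkl h4 h3, hf.inv, hf.inv]
  classical
  by_cases hz : a ≠ b ∧ c ≠ d ∧ A a c ≠ 0 ∧ A b d ≠ 0 ∧ A a d ≠ 0 ∧ A b c ≠ 0
  · obtain ⟨hab, hcd, hac, hbd, had, hbc⟩ := hz
    set t := f (cr A a b c d)
    have ht : t ≠ 0 := fun h => cr_ne_zero hac hbd had hbc ((hf.eq_zero_iff _).1 h)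
    refine ⟨fun i j => if i = a ∧ j = c then t else 1, .of_ne hf ?_ ?_⟩
    · rintro i (rfl | rfl) j (rfl | rfl) <;> simp only [*, iff_false] <;> split_ifs <;> simp [ht]
    have e : cr (fun i j => if i = a ∧ j = c then t else 1) a b c d = t := by
      simp [cr, hab.symm, hcd.symm]
    rintro i (rfl | rfl) j (rfl | rfl) k (rfl | rfl) l (rfl | rfl) hij hkl _ _ _ _ <;>
      try contradiction
    · exact e
    · rw [cr_swap_col _ _ _ l, cr_swap_col _ _ _ l, hf.inv, e]
    · rw [cr_swap_row _ j, cr_swap_row _ j, hf.inv, e]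
    · rw [cr_swap_row _ j, cr_swap_row _ j, cr_swap_col _ _ _ l, cr_swap_col _ _ _ l, inv_inv, inv_inv,
        e]
  · refine ⟨fun i j => if A i j = 0 then 0 else 1, .of_ne hf ?_ ?_⟩
    · intro i _ j _
      simp
    rintro i (rfl | rfl) j (rfl | rfl) k (rfl | rfl) l (rfl | rfl) hij hkl _ _ _ _ <;>
      first | contradiction | (exfalso; apply hz; tauto)

/-- Some column in `Q` has at least three nonzero entries in the rows `P`. -/
def HasTriple (P : Set X) (Q : Set Y) (A : X → Y → L) : Prop :=
  ∃ w ∈ Q, ∃ s ⊆ P, s.ncard = 3 ∧ ∀ x ∈ s, A x w ≠ 0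

lemma exists_pivot_hasTriple_of_path {x₁ x₂ x₃ : X} {y₁ y₂ : Y} (hx₁ : x₁ ∈ P) (hx₂ : x₂ ∈ P)
    (hx₃ : x₃ ∈ P) (hy₁ : y₁ ∈ Q) (hy₂ : y₂ ∈ Q) (h₁₂ : x₁ ≠ x₂) (h₁₃ : x₁ ≠ x₃) (h₂₃ : x₂ ≠ x₃)
    (h₁₁ : A x₁ y₁ ≠ 0) (h₂₁ : A x₂ y₁ ≠ 0) (h₂₂ : A x₂ y₂ ≠ 0) (h₃₂ : A x₃ y₂ ≠ 0) :
    HasTriple P Q A ∨ ∃ x ∈ P, ∃ y ∈ Q, A x y ≠ 0 ∧ HasTriple P Q (pivot A x y) := by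
  have hs : ({x₁, x₂, x₃} : Set X) ⊆ P := by
    rintro x (rfl | rfl | rfl) <;> assumption
  have hc : ({x₁, x₂, x₃} : Set X).ncard = 3 := ncard_eq_three.2 ⟨_, _, _, h₁₂, h₁₃, h₂₃, rfl⟩
  by_cases h₃₁ : A x₃ y₁ = 0
  · by_cases h₁₂' : A x₁ y₂ = 0
    · have hy : y₂ ≠ y₁ := fun h => h₃₂ (h ▸ h₃₁)
      refine .inr ⟨x₂, hx₂, y₁, hy₁, h₂₁, y₂, hy₂, _, hs, hc, ?_⟩
      rintro x (rfl | rfl | rfl)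
      · rw [pivot_ne _ h₁₂ hy, h₁₂', zero_sub, neg_ne_zero]
        exact div_ne_zero (mul_ne_zero h₁₁ h₂₂) h₂₁
      · rw [pivot_row _ hy]
        exact div_ne_zero h₂₂ h₂₁
      · rwa [pivot_of_col_eq_zero _ h₂₃.symm h₃₁]
    · refine .inl ⟨y₂, hy₂, _, hs, hc, ?_⟩
      rintro x (rfl | rfl | rfl) <;> assumption
  · refine .inl ⟨y₁, hy₁, _, hs, hc, ?_⟩
    rintro x (rfl | rfl | rfl) <;> assumption

lemma RowConn.exists_pivot_hasTriple (h : RowConn P Q A) (hc : 3 ≤ P.ncard) :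
    HasTriple P Q A ∨ ∃ x ∈ P, ∃ y ∈ Q, A x y ≠ 0 ∧ HasTriple P Q (DyadicLift.pivot A x y) := by
  obtain ⟨s, hsP, hs⟩ := exists_subset_card_eq hc
  obtain ⟨a, b, c, hab, -, -, rfl⟩ := ncard_eq_three.1 hs
  have ha : a ∈ P := hsP (by simp)
  obtain ⟨x, hx, hxa, y, hy, hxy, z, rfl, hzy⟩ := h.exists_step (P₀ := {a}) ha rfl
    (hsP (by simp : b ∈ _)) hab.symm
  obtain ⟨d, hd, hdzx⟩ : ∃ d ∈ P, d ∉ ({z, x} : Set X) := by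
    by_contra! hcon
    have h4 := ncard_le_ncard hcon
    have h5 := ncard_insert_le z {x}
    rw [ncard_singleton] at h5
    omega
  obtain ⟨x₃, hx₃, h₃, y₂, hy₂, h₃₂, x₂, hx₂ | rfl, h₂₂⟩ :=
    h.exists_step (P₀ := {z, x}) ha (by simp) hd hdzx
  all_goals simp only [mem_insert_iff, mem_singleton_iff, not_or] at h₃ hxa
  · subst hx₂
    exact exists_pivot_hasTriple_of_path hx ha hx₃ hy hy₂ hxa (Ne.symm h₃.2) (Ne.symm h₃.1) hxy hzy
      h₂₂ h₃₂
  · exact exists_pivot_hasTriple_of_path ha hx hx₃ hy hy₂ (Ne.symm hxa) (Ne.symm h₃.1) (Ne.symm h₃.2)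
      hzy hxy h₂₂ h₃₂

variable {B : X → Y → F}

lemma exists_lift_of_rowConn (hf : LiftFun f) (hg : LiftFun g) (ht : TrivialProducts g)
    (h2 : (-1 : L) ≠ 1) (hQ : Q.Finite) (hTQ : T ⊆ Q) (hT : RowConn P T A)
    (hc : T.ncard + 2 ≤ Q.ncard) (hB : Lift g P Q Q A B)
    (ih : ∀ u ∈ Q, ∃ A', Lift f P (Q \ {u}) (Q \ {u}) A A') : ∃ A', Lift f P Q Q A A' := by
  obtain ⟨u, hu, v, hv, huv, h⟩ := exists_rowConn_sdiff hQ hTQ hT hc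
  obtain ⟨A₁, h₁⟩ := ih u hu
  obtain ⟨A₂, h₂⟩ := ih v hv
  exact Lift.glue hf hg ht h2 hQ hu hv huv h h₁ h₂ hB

lemma ncard_sep_lt {W : Type*} {s : Set W} (hs : s.Finite) {p : W → Prop} {a : W} (ha : a ∈ s)
    (hp : ¬ p a) : {x ∈ s | p x}.ncard < s.ncard :=
  ncard_lt_ncard ⟨sep_subset _ _, fun h => hp (h ha).2⟩ hs

lemma exists_lift_of_not_rowConn (hf : LiftFun f) (hP : P.Finite) (hQ : Q.Finite)
    (h : ¬ RowConn P Q A)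
    (ih : ∀ P' ⊆ P, ∀ Q' ⊆ Q, P'.ncard + Q'.ncard < P.ncard + Q.ncard → ∃ A', Lift f P' Q' Q' A A') :
    ∃ A', Lift f P Q Q A A' := by
  simp only [RowConn, Linked, not_forall] at h
  obtain ⟨a, ha, b, hb, p, q, hpq, hab⟩ := h
  obtain ⟨⟨c, hc, hpc⟩, d, hd, hpd⟩ : (∃ c ∈ P, p c) ∧ ∃ d ∈ P, ¬ p d := by
    by_cases h : p a
    · exact ⟨⟨a, ha, h⟩, b, hb, by tauto⟩
    · exact ⟨⟨b, hb, by tauto⟩, a, ha, h⟩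
  obtain ⟨A₁, h₁⟩ := ih _ (sep_subset P p) _ (sep_subset Q q)
    (add_lt_add_of_lt_of_le (ncard_sep_lt hP hd hpd) (ncard_le_ncard (sep_subset Q q) hQ))
  obtain ⟨A₂, h₂⟩ := ih _ (sep_subset P fun x => ¬ p x) _ (sep_subset Q fun y => ¬ q y)
    (add_lt_add_of_lt_of_le (ncard_sep_lt hP hc (not_not.2 hpc)) (ncard_le_ncard (sep_subset Q _) hQ))
  exact Lift.block hpq h₁ h₂ hf

lemma exists_eq_pair {W : Type*} {s : Set W} (h : s.ncard < 3) (h0 : s.ncard ≠ 0) :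
    ∃ a b, s = {a, b} := by
  interval_cases hs : s.ncard
  · exact absurd rfl h0
  · obtain ⟨a, rfl⟩ := ncard_eq_one.1 hs
    exact ⟨a, a, by simp⟩
  · obtain ⟨a, b, -, rfl⟩ := ncard_eq_two.1 hs
    exact ⟨a, b, rfl⟩

/-- On finitely many rows and columns, a matrix that has a lift along `g` has a lift along `f`. -/
theorem exists_lift (hf : LiftFun f) (hg : LiftFun g) (ht : TrivialProducts g) (h2 : (-1 : L) ≠ 1)
    (hP : P.Finite) (hQ : Q.Finite) (hB : Lift g P Q Q A B) : ∃ A', Lift f P Q Q A A' := by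
  induction hn : P.ncard + Q.ncard using Nat.strong_induction_on generalizing P Q A B with
  | _ n ih =>
  subst hn
  have ih' : ∀ {C : X → Y → L} {D : X → Y → F}, Lift g P Q Q C D → ∀ P' ⊆ P, ∀ Q' ⊆ Q,
      P'.ncard + Q'.ncard < P.ncard + Q.ncard → ∃ A', Lift f P' Q' Q' C A' :=
    fun hD P' hP' Q' hQ' hlt => ih _ hlt (hP.subset hP') (hQ.subset hQ') (hD.mono hP' hQ' hQ') rfl
  have flp : ∀ {P : Set X} {Q : Set Y} {A : X → Y → L}, (∃ A', Lift f Q P P (flip A) A') →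
      ∃ A', Lift f P Q Q A A' := fun ⟨A', h⟩ => ⟨flip A', h.flip⟩
  have flp' : ∀ {P : Set X} {Q : Set Y} {A : X → Y → L}, (∃ A', Lift f P Q Q A A') →
      ∃ A', Lift f Q P P (flip A) A' := fun ⟨A', h⟩ => ⟨flip A', h.flip⟩
  by_cases hconn : RowConn P Q A
  swap
  · exact exists_lift_of_not_rowConn hf hP hQ hconn (ih' hB)
  by_cases hconn' : RowConn Q P (flip A)
  swap
  · refine flp (exists_lift_of_not_rowConn hf hQ hP hconn' fun Q' hQ' P' hP' hlt => ?_)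
    exact flp' (ih' hB P' hP' Q' hQ' (by omega))
  rcases P.eq_empty_or_nonempty with rfl | ⟨a, ha⟩
  · exact ⟨0, fun _ _ => True, trivial, fun _ _ _ => ⟨⟨by simp, by simp⟩, by simp⟩⟩
  rcases Q.eq_empty_or_nonempty with rfl | ⟨c, hc⟩
  · exact ⟨0, fun _ _ => True, trivial, fun _ _ _ => ⟨⟨by simp, by simp⟩, by simp⟩⟩
  have colStep : ∀ {C : X → Y → L} {D : X → Y → F}, Lift g P Q Q C D → ∀ T ⊆ Q, RowConn P T C →
      T.ncard + 2 ≤ Q.ncard → ∃ A', Lift f P Q Q C A' := by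
    intro C D hD T hTQ hT hc
    refine exists_lift_of_rowConn hf hg ht h2 hQ hTQ hT hc hD fun u hu => ih' hD P subset_rfl _
      sdiff_subset ?_
    have := ncard_sdiff_singleton_lt_of_mem hu hQ
    omega
  rcases lt_trichotomy P.ncard Q.ncard with hlt | heq | hlt
  · obtain ⟨T, hTQ, hT, hTc⟩ := exists_rowConn_ncard_le (k := 1) hP hconn (singleton_subset_iff.2 ha)
      (empty_subset Q) (singleton_nonempty a) (by rintro _ rfl _ rfl; exact .refl _) (by simp)
    exact colStep hB T hTQ hT (by omega)
  · by_cases h3 : 3 ≤ P.ncard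
    · have key : ∀ {C : X → Y → L} {D : X → Y → F}, Lift g P Q Q C D → RowConn P Q C →
          HasTriple P Q C → ∃ A', Lift f P Q Q C A' := by
        rintro C D hD hC ⟨w, hw, s, hs, hs3, hsw⟩
        obtain ⟨T, hTQ, hT, hTc⟩ := exists_rowConn_ncard_le (k := 2) hP hC hs
          (singleton_subset_iff.2 hw) (nonempty_of_ncard_ne_zero (by omega))
          (fun a ha b hb => .of_ne (hs ha) (hs hb) rfl (hsw a ha) (hsw b hb)) (by simp [hs3])
        exact colStep hD T hTQ hT (by omega)
      rcases hconn.exists_pivot_hasTriple h3 with h | ⟨x, hx, y, hy, hxy, h⟩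
      · exact key hB hconn h
      · obtain ⟨A', hA'⟩ := key (hB.pivot hx hy hxy) (hconn.pivot hx hy hxy) h
        exact ⟨_, hA'.of_pivot hx hy hxy⟩
    · obtain ⟨a, b, rfl⟩ := exists_eq_pair (by omega) ((ncard_pos hP).2 ⟨a, ha⟩).ne'
      obtain ⟨c, d, rfl⟩ := exists_eq_pair (by omega) ((ncard_pos hQ).2 ⟨c, hc⟩).ne'
      exact exists_lift_pair hf a b c d A
  · obtain ⟨T, hTQ, hT, hTc⟩ := exists_rowConn_ncard_le (k := 1) hQ hconn' (singleton_subset_iff.2 hc)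
      (empty_subset P) (singleton_nonempty c) (by rintro _ rfl _ rfl; exact .refl _) (by simp)
    refine flp (exists_lift_of_rowConn hf hg ht h2 hP hTQ hT (by omega) hB.flip fun u hu => ?_)
    refine flp' (ih' hB _ sdiff_subset Q subset_rfl ?_)
    have := ncard_sdiff_singleton_lt_of_mem hu hP
    omega

end Existence

section Infinite

variable {X Y L F K : Type*} [DecidableEq X] [DecidableEq Y] [Field L] [Field F] [Field K]
  {f : L → K} {g : L → F} {A : X → Y → L} {A' C₀ C₁ : X → Y → K} {B : X → Y → F}

/-- A matrix with finitely supported columns that has a lift along `g` has a lift along `f` on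
finitely many columns. -/
lemma exists_lift_univ_of_finite (hf : LiftFun f) (hg : LiftFun g) (ht : TrivialProducts g)
    (h2 : (-1 : L) ≠ 1) (hA : ∀ y, {x | A x y ≠ 0}.Finite) (hB : Lift g univ univ univ A B)
    {Q : Set Y} (hQ : Q.Finite) : ∃ A', Lift f univ Q Q A A' := by
  have hP : (⋃ y ∈ Q, {x | A x y ≠ 0}).Finite := hQ.biUnion fun y _ => hA y
  obtain ⟨A₁, h₁⟩ := exists_lift hf hg ht h2 hP hQ
    (hB.mono (subset_univ _) (subset_univ Q) (subset_univ Q))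
  refine Lift.block (p := (· ∈ ⋃ y ∈ Q, {x | A x y ≠ 0})) (q := fun _ => True) (A₁ := A₁) (A₂ := 0)
    ?_ ?_ ?_ hf
  · intro x _ y hy hxy
    simp only [mem_iUnion, iff_true]
    exact ⟨y, hy, hxy⟩
  · exact h₁.mono (fun x hx => hx.2) (fun y hy => hy.1) (fun y hy => hy.1)
  · exact ⟨fun _ _ => True, trivial, fun _ _ _ => ⟨⟨by simp, by simp⟩, by simp⟩⟩

/-- `A'` is a lift of `A` on all rows and any finitely many columns from `Q`. -/
def LocalLift (f : L → K) (Q : Set Y) (A : X → Y → L) (A' : X → Y → K) : Prop :=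
  ∀ s : Set Y, s.Finite → s ⊆ Q → Lift f univ s s A A'

lemma LocalLift.lift (h : LocalLift f univ A A') : Lift f univ univ univ A A' := by
  refine ⟨LocalLift f univ, h, fun C C' hC => ⟨⟨fun i _ c _ => ?_, fun i _ j _ c _ d _ => ?_⟩, ?_⟩⟩
  · exact (hC {c} (by simp) (by simp)).good.supp i trivial c rfl
  · exact (hC {c, d} (by simp) (by simp)).good.cross i trivial j trivial c (by simp) d (by simp)
  · intro x _ y _ hxy s hs _
    exact ((hC (insert y s) (hs.insert y) (subset_univ _)).pivot trivial (mem_insert _ _) hxy).mono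
      subset_rfl (subset_insert _ _) (subset_insert _ _)

omit [DecidableEq X] [DecidableEq Y] in
lemma Linked.exists_finite {Q : Set Y} {a b : X} (h : Linked univ Q A a b) :
    ∃ s ⊆ Q, s.Finite ∧ Linked univ s A a b := by
  obtain ⟨n, hn⟩ := h.exists_reach
  induction n generalizing a with
  | zero => exact ⟨∅, empty_subset _, finite_empty, by rw [show a = b from hn]; exact .refl _⟩
  | succ n ih =>
    obtain ⟨k, -, c, hc, hac, hkc, hk⟩ := hn
    obtain ⟨s, hs, hsf, hl⟩ := ih ((Linked.of_ne (mem_univ _) (mem_univ _) hc hkc hac).trans h) hk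
    exact ⟨insert c s, insert_subset hc hs, hsf.insert c,
      (Linked.of_ne (mem_univ _) (mem_univ _) (mem_insert _ _) hac hkc).trans (hl.mono (subset_insert _ _))⟩

lemma Lift.exists_eq_of_lift {s t : Set Y} (hs : s.Finite) (hst : s ⊆ t) (h : Lift f univ s s A A')
    (h₁ : Lift f univ t t A C₁) :
    ∃ C, Lift f univ t t A C ∧ ∀ i, ∀ j ∈ s, C i j = A' i j := by
  obtain ⟨r, c, hr, hc, he⟩ := Lift.unique hs (h₁.mono subset_rfl hst hst) h
  exact ⟨_, h₁.scale_right hr hc, fun i j hj => (he i trivial j hj).symm⟩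

omit [DecidableEq X] [DecidableEq Y] in
/-- Row scalars on a set of rows that agree on linked rows extend to a scaling that does not change
the matrix. -/
lemma exists_scale_extend (Q : Set Y) (A : X → Y → L) {s : Set X} {r : X → K} (hr : ∀ i, r i ≠ 0)
    (h : ∀ a ∈ s, ∀ b ∈ s, Linked univ Q A a b → r a = r b) :
    ∃ ρ : X → K, ∃ γ : Y → K, (∀ i, ρ i ≠ 0) ∧ (∀ j, γ j ≠ 0) ∧ (∀ a ∈ s, ρ a = r a) ∧
      ∀ x, ∀ y ∈ Q, A x y ≠ 0 → ρ x * γ y = 1 := by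
  classical
  have : ∀ x, ∃ k : K, k ≠ 0 ∧ ∀ a ∈ s, Linked univ Q A x a → k = r a := by
    intro x
    by_cases hx : ∃ a ∈ s, Linked univ Q A x a
    · obtain ⟨a, ha, hxa⟩ := hx
      exact ⟨r a, hr a, fun b hb hxb => h a ha b hb (hxa.symm.trans hxb)⟩
    · exact ⟨1, one_ne_zero, fun a ha hxa => (hx ⟨a, ha, hxa⟩).elim⟩
  choose k hk hks using this
  let ρ : X → K := fun x => if ∃ a ∈ s, Linked univ Q A x a then k x else 1
  have hρ : ∀ x z, Linked univ Q A x z → ρ x = ρ z := by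
    intro x z hxz
    by_cases hx : ∃ a ∈ s, Linked univ Q A x a
    · have hz : ∃ a ∈ s, Linked univ Q A z a := hx.imp fun a ha => ⟨ha.1, hxz.symm.trans ha.2⟩
      obtain ⟨a, ha, hxa⟩ := id hx
      simp only [ρ, if_pos hx, if_pos hz]
      rw [hks x a ha hxa, hks z a ha (hxz.symm.trans hxa)]
    · have hz : ¬ ∃ a ∈ s, Linked univ Q A z a := mt (Exists.imp fun a ha => ⟨ha.1, hxz.trans ha.2⟩) hx
      simp only [ρ, if_neg hx, if_neg hz]
  have hρ0 : ∀ x, ρ x ≠ 0 := fun x => by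
    simp only [ρ]
    split_ifs
    exacts [hk x, one_ne_zero]
  have : ∀ y, ∃ l : K, l ≠ 0 ∧ (y ∈ Q → ∀ x, A x y ≠ 0 → ρ x * l = 1) := by
    intro y
    by_cases hy : ∃ x, A x y ≠ 0
    · obtain ⟨x, hx⟩ := hy
      refine ⟨(ρ x)⁻¹, inv_ne_zero (hρ0 x), fun hyQ z hz => ?_⟩
      rw [hρ z x (.of_ne trivial trivial hyQ hz hx), mul_inv_cancel₀ (hρ0 x)]
    · exact ⟨1, one_ne_zero, fun _ x hx => (hy ⟨x, hx⟩).elim⟩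
  choose γ hγ hργ using this
  refine ⟨ρ, γ, hρ0, hγ, fun a ha => ?_, fun x y hy hxy => hργ y hy x hxy⟩
  have hx : ∃ b ∈ s, Linked univ Q A a b := ⟨a, ha, .refl a⟩
  simp only [ρ, if_pos hx, hks a a ha (.refl a)]

lemma LocalLift.exists_insert {Q : Set Y} (h : LocalLift f Q A A')
    (hA : ∀ y, {x | A x y ≠ 0}.Finite)
    (hex : ∀ t : Set Y, t.Finite → ∃ A', Lift f univ t t A A') {u : Y} (hu : u ∉ Q) :
    ∃ C : X → Y → K, LocalLift f (insert u Q) A C ∧ ∀ i, ∀ j ∈ Q, C i j = A' i j := by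
  set s := {x | A x u ≠ 0} with hs
  have : ∀ a b : X, ∃ t ⊆ Q, t.Finite ∧ (Linked univ Q A a b → Linked univ t A a b) := by
    intro a b
    by_cases hab : Linked univ Q A a b
    · obtain ⟨t, h1, h2, h3⟩ := hab.exists_finite
      exact ⟨t, h1, h2, fun _ => h3⟩
    · exact ⟨∅, empty_subset _, finite_empty, fun h => (hab h).elim⟩
  choose t htQ htf htl using this
  set Q₀ := ⋃ a ∈ s, ⋃ b ∈ s, t a b
  have hQ₀ : Q₀.Finite := (hA u).biUnion fun a _ => (hA u).biUnion fun b _ => htf a b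
  have hQ₀Q : Q₀ ⊆ Q := iUnion₂_subset fun a _ => iUnion₂_subset fun b _ => htQ a b
  have hlink : ∀ a ∈ s, ∀ b ∈ s, Linked univ Q A a b → Linked univ Q₀ A a b := fun a ha b hb hab =>
    (htl a b hab).mono fun y hy => mem_biUnion ha (mem_biUnion hb hy)
  obtain ⟨C₀, hC₀, hCA₀⟩ := (h Q₀ hQ₀ hQ₀Q).exists_eq_of_lift hQ₀ (subset_insert u Q₀)
    (hex _ (hQ₀.insert u)).choose_spec
  refine ⟨fun i j => if j = u then C₀ i j else A' i j, ?_, fun i j hj =>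
    if_neg (ne_of_mem_of_not_mem hj hu)⟩
  intro Q₁ hQ₁ hQ₁Q
  set Q₂ := (Q₁ \ {u}) ∪ Q₀
  have hQ₂ : Q₂.Finite := hQ₁.sdiff.union hQ₀
  have hQ₂Q : Q₂ ⊆ Q := union_subset (fun y hy => (hQ₁Q hy.1).resolve_left hy.2) hQ₀Q
  have huQ₂ : u ∉ Q₂ := fun h => hu (hQ₂Q h)
  obtain ⟨C₁, hC₁, hCA₁⟩ := (h Q₂ hQ₂ hQ₂Q).exists_eq_of_lift hQ₂ (subset_insert u Q₂)
    (hex _ (hQ₂.insert u)).choose_spec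
  have hsub : insert u Q₀ ⊆ insert u Q₂ := insert_subset_insert subset_union_right
  obtain ⟨r, c, hr, hc, he⟩ := Lift.unique (hQ₀.insert u) (hC₁.mono subset_rfl hsub hsub) hC₀
  have hrc : ∀ x, ∀ y ∈ Q₀, A x y ≠ 0 → r x * c y = 1 := by
    intro x y hy hxy
    have e := he x trivial y (mem_insert_of_mem _ hy)
    have h0 := hC₀.good.ne (mem_univ x) (mem_insert_of_mem _ hy) hxy
    rw [DyadicLift.scale, hCA₁ x y (.inr hy), ← hCA₀ x y hy] at e
    refine mul_right_cancel₀ h0 ?_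
    linear_combination -e
  obtain ⟨ρ, γ, hρ, hγ, hρr, hργ⟩ := exists_scale_extend Q₂ A (s := s) hr fun a ha b hb hab => by
    refine ((hlink a ha b hb (hab.mono hQ₂Q)) (fun x => r a = r x) (fun y => r a * c y = 1) ?_).1 rfl
    intro x _ y hy hxy
    have h1 := hrc x y hy hxy
    refine ⟨fun h => h ▸ h1, fun h => mul_right_cancel₀ (hc y) (h.trans h1.symm)⟩
  have hfin := (hC₁.scale_right hρ (update_ne_zero hγ u (hc u) : ∀ j, Function.update γ u (c u) j ≠ 0))
  refine (hfin.congr subset_rfl (fun _ _ _ _ => rfl) fun i _ j hj => ?_).mono subset_rfl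
    (fun y hy => ?_ : Q₁ ⊆ insert u Q₂) (fun y hy => ?_)
  · rcases hj with rfl | hj
    · rw [if_pos rfl, he i trivial j (mem_insert _ _)]
      simp only [DyadicLift.scale, Function.update_self]
      by_cases hi : A i j = 0
      · rw [hC₁.good.zero (mem_univ i) (mem_insert _ _) hi]
        ring
      · rw [hρr i hi]
    · have hju : j ≠ u := ne_of_mem_of_not_mem hj huQ₂
      rw [if_neg hju]
      simp only [DyadicLift.scale, Function.update_of_ne hju]
      rw [← hCA₁ i j hj]
      by_cases hi : A i j = 0
      · rw [hC₁.good.zero (mem_univ i) (mem_insert_of_mem _ hj) hi]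
        ring
      · linear_combination C₁ i j * hργ i j hj hi
  all_goals
    by_cases hyu : y = u
    · exact .inl hyu
    · exact .inr (.inl ⟨hy, hyu⟩)

/-- A matrix with finitely supported columns that has a lift along `g` has a lift along `f`. -/
theorem exists_lift_univ (hf : LiftFun f) (hg : LiftFun g) (ht : TrivialProducts g)
    (h2 : (-1 : L) ≠ 1) (hA : ∀ y, {x | A x y ≠ 0}.Finite) (hB : Lift g univ univ univ A B) :
    ∃ A', Lift f univ univ univ A A' := by
  classical
  have hex : ∀ t : Set Y, t.Finite → ∃ A', Lift f univ t t A A' := fun t =>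
    exists_lift_univ_of_finite hf hg ht h2 hA hB
  let r : {p : Set Y × (X → Y → K) // LocalLift f p.1 A p.2} →
      {p : Set Y × (X → Y → K) // LocalLift f p.1 A p.2} → Prop :=
    fun p q => p.1.1 ⊆ q.1.1 ∧ ∀ i, ∀ j ∈ p.1.1, q.1.2 i j = p.1.2 i j
  have hrefl : ∀ p, r p p := fun p => ⟨subset_rfl, fun _ _ _ => rfl⟩
  have htrans : ∀ {p q s}, r p q → r q s → r p s := fun h h' =>
    ⟨h.1.trans h'.1, fun i j hj => (h'.2 i j (h.1 hj)).trans (h.2 i j hj)⟩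
  have hchain : ∀ c, IsChain r c → ∃ ub, ∀ p ∈ c, r p ub := by
    intro c hc
    have hdir : ∀ p ∈ c, ∀ q ∈ c, ∃ s ∈ c, r p s ∧ r q s := by
      intro p hp q hq
      by_cases hpq : p = q
      · exact ⟨q, hq, hpq ▸ hrefl q, hrefl q⟩
      rcases hc hp hq hpq with h | h
      · exact ⟨q, hq, h, hrefl q⟩
      · exact ⟨p, hp, hrefl p, h⟩
    have : ∀ y : Y, ∃ v : X → K, ∀ p ∈ c, y ∈ p.1.1 → ∀ i, v i = p.1.2 i y := by
      intro y
      by_cases hy : ∃ p ∈ c, y ∈ p.1.1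
      · obtain ⟨p, hp, hyp⟩ := hy
        refine ⟨fun i => p.1.2 i y, fun q hq hyq i => ?_⟩
        obtain ⟨s, -, h1, h2⟩ := hdir p hp q hq
        exact (h1.2 i y hyp).symm.trans (h2.2 i y hyq)
      · exact ⟨0, fun p hp hyp => (hy ⟨p, hp, hyp⟩).elim⟩
    choose v hv using this
    refine ⟨⟨⟨⋃ p ∈ c, p.1.1, fun i j => v j i⟩, fun t ht htc => ?_⟩, fun p hp =>
      ⟨subset_biUnion_of_mem (u := fun p => p.1.1) hp, fun i j hj => hv j p hp hj i⟩⟩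
    by_cases hne : c.Nonempty
    · have : ∃ p ∈ c, t ⊆ p.1.1 := by
        induction t, ht using Set.Finite.induction_on with
        | empty => exact hne.imp fun p hp => ⟨hp, empty_subset _⟩
        | @insert a t _ _ ih =>
          obtain ⟨p, hp, htp⟩ := ih ((subset_insert _ _).trans htc)
          obtain ⟨q, hq, haq⟩ := mem_iUnion₂.1 (htc (mem_insert a t))
          obtain ⟨s, hs, h1, h2⟩ := hdir p hp q hq
          exact ⟨s, hs, insert_subset (h2.1 haq) (htp.trans h1.1)⟩
      obtain ⟨p, hp, htp⟩ := this
      exact (p.2 t ht htp).congr subset_rfl (fun _ _ _ _ => rfl) fun i _ j hj =>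
        (hv j p hp (htp hj) i).symm
    · rw [not_nonempty_iff_eq_empty] at hne
      subst hne
      have : t = ∅ := by simpa using htc
      subst this
      exact ⟨fun _ _ => True, trivial, fun _ _ _ => ⟨⟨by simp, by simp⟩, by simp⟩⟩
  obtain ⟨⟨⟨Q, A'⟩, h⟩, hmax⟩ := exists_maximal_of_chains_bounded (r := r) hchain htrans
  have hQ : Q = univ := by
    by_contra hQ
    obtain ⟨u, hu⟩ := (ne_univ_iff_exists_notMem Q).1 hQ
    obtain ⟨C, hC, hCA⟩ := h.exists_insert hA hex hu
    exact hu ((hmax ⟨⟨insert u Q, C⟩, hC⟩ ⟨subset_insert _ _, hCA⟩).1 (mem_insert _ _))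
  subst hQ
  exact ⟨A', h.lift⟩

end Infinite

section Dyadic

open Classical in
/-- The map from the rationals to `K` with values `0, 1, -1, 1/2, 2`, which is constant on each of
the pieces cut out by `0` and `1`. -/
noncomputable def dyadic (K : Type*) [Field K] (q : ℚ) : K :=
  if q = 0 then 0 else if q = 1 then 1 else if q < 0 then -1 else if q < 1 then 2⁻¹ else 2

lemma dyadic_liftFun {K : Type*} [Field K] (h2 : (2 : K) ≠ 0) : LiftFun (dyadic K) where
  eq_zero_iff q := by
    unfold dyadic
    split_ifs <;> simp_all
  one_sub q := by
    have h3 : (1 : K) - 2⁻¹ = 2⁻¹ := by field_simp; ring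
    unfold dyadic
    split_ifs <;> grind
  inv q := by
    rcases lt_trichotomy q 0 with h | rfl | h
    · have h' := inv_lt_zero.2 h
      simp [dyadic, h, h', h.ne, (h.trans one_pos).ne, ne_of_lt (h'.trans one_pos)]
    · simp [dyadic]
    have h' := inv_pos.2 h
    rcases lt_trichotomy q 1 with h1 | rfl | h1
    · have h1' := (one_lt_inv₀ h).2 h1
      simp [dyadic, h.ne', h1.ne, h.not_gt, h1, h1'.not_gt]
    · simp [dyadic]
    · have h1' := inv_lt_one_of_one_lt₀ h1
      simp [dyadic, h.ne', h1.ne', h.not_gt, h1.not_gt, h1']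

lemma dyadic_zmod_three {q : ℚ} (h0 : q ≠ 0) (h1 : q ≠ 1) : dyadic (ZMod 3) q = -1 := by
  unfold dyadic
  split_ifs <;> first | contradiction | rfl | exact inv_eq_of_mul_eq_one_right (by decide)

lemma dyadic_trivialProducts : TrivialProducts (dyadic (ZMod 3)) := by
  intro p q hp hq h
  by_contra! hne
  rw [dyadic_zmod_three hp hne.1, dyadic_zmod_three hq hne.2.1,
    dyadic_zmod_three (mul_ne_zero hp hq) hne.2.2] at h
  exact absurd h (by decide)

end Dyadic

section Coord

variable {X : Type*} {Y : Type*} {L F K V V' : Type*} [Field L] [Field F] [Field K]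
  [AddCommGroup V] [AddCommGroup V'] [Module L V]

/-- `A` is the matrix of coordinates of the vectors `φ (inr y)` with respect to the linearly
independent vectors `φ (inl x)`. -/
structure Coord (φ : X ⊕ Y → V) (A : X → Y → L) : Prop where
  indep : LinearIndependent L (φ ∘ Sum.inl)
  col : ∀ y, ∃ l : X →₀ L, (∀ x, l x = A x y) ∧
    Finsupp.linearCombination L (φ ∘ Sum.inl) l = φ (Sum.inr y)

variable {φ : X ⊕ Y → V} {A : X → Y → L}

lemma exists_coord (h : LinearIndependent L (φ ∘ Sum.inl))
    (hs : ∀ y, φ (Sum.inr y) ∈ Submodule.span L (range (φ ∘ Sum.inl))) :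
    ∃ A : X → Y → L, Coord φ A := by
  simp_rw [Finsupp.mem_span_range_iff_exists_finsupp] at hs
  choose l hl using hs
  exact ⟨fun x y => l y x, h, fun y => ⟨l y, fun _ => rfl, hl y⟩⟩

lemma Coord.finite (h : Coord φ A) (y : Y) : {x | A x y ≠ 0}.Finite := by
  obtain ⟨l, hl, -⟩ := h.col y
  refine l.support.finite_toSet.subset fun x hx => ?_
  simpa [hl] using hx

/-- Every matrix with finitely supported columns is a matrix of coordinates. -/
lemma exists_coord_eq (hA : ∀ y, {x | A x y ≠ 0}.Finite) :
    ∃ φ : X ⊕ Y → (X →₀ L), Coord φ A := by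
  refine ⟨Sum.elim (fun x => Finsupp.single x 1)
    fun y => Finsupp.ofSupportFinite (fun x => A x y) (hA y), ?_, fun y =>
    ⟨Finsupp.ofSupportFinite (fun x => A x y) (hA y), fun _ => rfl, ?_⟩⟩
  · exact Finsupp.linearIndependent_single_one L X
  · rw [Sum.elim_comp_inl, Sum.elim_inr]
    ext i
    simp [Finsupp.linearCombination_apply]

variable [DecidableEq X] [DecidableEq Y]

omit [AddCommGroup V] in
lemma comp_swap_inl (φ : X ⊕ Y → V) (x : X) (y : Y) :
    (φ ∘ Equiv.swap (Sum.inl x) (Sum.inr y)) ∘ Sum.inl =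
      Function.update (φ ∘ Sum.inl) x (φ (Sum.inr y)) := by
  funext i
  by_cases hi : i = x
  · subst hi; simp
  · simp [hi, Equiv.swap_apply_of_ne_of_ne]

lemma linearCombination_update (v : X → V) (p l : X →₀ L) {x : X} (hx : p x ≠ 0) :
    Finsupp.linearCombination L (Function.update v x (Finsupp.linearCombination L v p))
      (l - (l x / p x) • p + Finsupp.single x (l x / p x)) = Finsupp.linearCombination L v l := by
  have key : ∀ m : X →₀ L, m x = 0 → ∀ w, Finsupp.linearCombination L (Function.update v x w) m =
      Finsupp.linearCombination L v m := by
    intro m hm w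
    rw [Finsupp.linearCombination_apply, Finsupp.linearCombination_apply]
    refine Finsupp.sum_congr fun i hi => ?_
    rw [Function.update_of_ne]
    rintro rfl
    simp [hm] at hi
  rw [map_add, key _ (by simp [hx])]
  simp

lemma Coord.pivot (h : Coord φ A) {x : X} {y : Y} (hxy : A x y ≠ 0) :
    Coord (φ ∘ Equiv.swap (Sum.inl x) (Sum.inr y)) (DyadicLift.pivot A x y) := by
  obtain ⟨p, hp, hpy⟩ := h.col y
  have hpx : p x ≠ 0 := by rwa [hp]
  refine ⟨?_, fun j => ?_⟩
  · rw [comp_swap_inl, ← hpy]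
    exact h.indep.update x _ ⟨1, one_mem _, p, mem_nonZeroDivisors_of_ne_zero hpx, one_smul _ _⟩
  · rw [comp_swap_inl, ← hpy]
    by_cases hj : j = y
    · subst hj
      refine ⟨_, fun i => ?_, (linearCombination_update _ p (Finsupp.single x 1) hpx).trans ?_⟩
      · by_cases hi : i = x
        · subst hi; simp [pivot_self, hp, hxy]
        · simp [pivot_col A hi, hp, hi]; ring
      · simp
    · obtain ⟨l, hl, hlj⟩ := h.col j
      refine ⟨_, fun i => ?_, (linearCombination_update _ p l hpx).trans ?_⟩
      · by_cases hi : i = x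
        · subst hi; simp [pivot_row A hj, hp, hl, hxy]
        · simp [pivot_ne A hi hj, hp, hl, hi]; ring
      · rw [hlj, Function.comp_apply, Equiv.swap_apply_of_ne_of_ne (by simp) (by simpa using hj)]

lemma Coord.ne_zero_iff (h : Coord φ A) {x : X} {y : Y} :
    A x y ≠ 0 ↔ LinearIndependent L ((φ ∘ Equiv.swap (Sum.inl x) (Sum.inr y)) ∘ Sum.inl) := by
  refine ⟨fun hxy => (h.pivot hxy).indep, fun hi h0 => ?_⟩
  obtain ⟨p, hp, hpy⟩ := h.col y
  rw [comp_swap_inl] at hi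
  have h1 : Finsupp.linearCombination L (Function.update (φ ∘ Sum.inl) x (φ (Sum.inr y))) p =
      Finsupp.linearCombination L (Function.update (φ ∘ Sum.inl) x (φ (Sum.inr y)))
        (Finsupp.single x 1) := by
    rw [Finsupp.linearCombination_single, one_smul, Function.update_self, ← hpy,
      Finsupp.linearCombination_apply, Finsupp.linearCombination_apply]
    refine Finsupp.sum_congr fun i hip => ?_
    rw [Function.update_of_ne]
    rintro rfl
    simp [hp, h0] at hip
  have := DFunLike.congr_fun (hi h1) x
  rw [hp, h0, Finsupp.single_eq_same] at this
  exact zero_ne_one this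

lemma linearIndepOn_comp_equiv {ι : Type*} {φ : ι → V} (σ : Equiv.Perm ι) (I : Set ι) :
    LinearIndepOn L (φ ∘ σ) (σ ⁻¹' I) ↔ LinearIndepOn L φ I := by
  refine ⟨fun h => ?_, fun h => ?_⟩
  · simpa [image_preimage_eq _ σ.surjective] using h.image_of_comp σ φ
  · exact LinearIndepOn.comp_of_image (by rwa [image_preimage_eq _ σ.surjective])
      σ.injective.injOn

omit [DecidableEq X] [DecidableEq Y] in
lemma Coord.not_linearIndepOn (h : Coord φ A) {I : Set (X ⊕ Y)} {y : Y} (hy : Sum.inr y ∈ I)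
    (hI : ∀ x, A x y ≠ 0 → Sum.inl x ∈ I) : ¬ LinearIndepOn L φ I := by
  intro hli
  obtain ⟨p, hp, hpy⟩ := h.col y
  rw [← insert_sdiff_self_of_mem hy, linearIndepOn_insert (by simp), ← hpy,
    Finsupp.linearCombination_apply] at hli
  refine hli.2 (Submodule.sum_mem _ fun i hi => Submodule.smul_mem _ _ (Submodule.subset_span
    ⟨Sum.inl i, ⟨hI i ?_, by simp⟩, rfl⟩))
  rwa [← hp, ← Finsupp.mem_support_iff]

variable [Module K V']

/-- A lift preserves independence of sets of vectors. -/
lemma Lift.linearIndepOn_iff {f : L → K} {A' : X → Y → K} {ψ : X ⊕ Y → V'}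
    (h : Lift f univ univ univ A A') (hA : Coord φ A) (hA' : Coord ψ A') (I : Set (X ⊕ Y)) :
    LinearIndepOn L φ I ↔ LinearIndepOn K ψ I := by
  have key : ∀ (n : ℕ) (φ : X ⊕ Y → V) (ψ : X ⊕ Y → V') (A : X → Y → L) (A' : X → Y → K)
      (I : Set (X ⊕ Y)), Lift f univ univ univ A A' → Coord φ A → Coord ψ A' → I.Finite →
      (Sum.inr ⁻¹' I).ncard = n → (LinearIndepOn L φ I ↔ LinearIndepOn K ψ I) := by
    intro n
    induction n with
    | zero =>
      intro φ ψ A A' I _ hA hA' hI hn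
      rw [ncard_eq_zero (hI.preimage Sum.inr_injective.injOn)] at hn
      have hIr : I ⊆ range Sum.inl := by
        rintro (x | y) he
        · exact mem_range_self x
        · exact (hn.subset he).elim
      exact iff_of_true (((linearIndepOn_range_iff Sum.inl_injective φ).2 hA.indep).mono hIr)
        (((linearIndepOn_range_iff Sum.inl_injective ψ).2 hA'.indep).mono hIr)
    | succ n ih =>
      intro φ ψ A A' I h hA hA' hI hn
      obtain ⟨y, hy⟩ : (Sum.inr ⁻¹' I : Set Y).Nonempty := nonempty_of_ncard_ne_zero (by omega)
      have hs : ∀ x, A x y ≠ 0 ↔ A' x y ≠ 0 := fun x =>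
        (h.good.supp x trivial y trivial).not.symm
      by_cases hx : ∃ x, A x y ≠ 0 ∧ Sum.inl x ∉ I
      · obtain ⟨x, hxy, hxI⟩ := hx
        have hpre : (Sum.inr ⁻¹' (Equiv.swap (Sum.inl x) (Sum.inr y) ⁻¹' I) : Set Y) =
            (Sum.inr ⁻¹' I) \ {y} := by
          ext j
          by_cases hj : j = y
          · subst hj; simpa using hxI
          · simp [hj, Equiv.swap_apply_of_ne_of_ne]
        have := ih _ _ _ _ (Equiv.swap (Sum.inl x) (Sum.inr y) ⁻¹' I)
          (h.pivot trivial trivial hxy) (hA.pivot hxy) (hA'.pivot ((hs x).1 hxy))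
          (hI.preimage (Equiv.injective _).injOn)
          (by rw [hpre, ncard_sdiff_singleton_of_mem hy, hn, Nat.add_sub_cancel])
        rwa [linearIndepOn_comp_equiv, linearIndepOn_comp_equiv] at this
      · push Not at hx
        exact iff_of_false (hA.not_linearIndepOn hy hx)
          (hA'.not_linearIndepOn hy fun x hxy => hx x ((hs x).2 hxy))
  exact ⟨fun hi => linearIndepOn_of_finite I fun t ht htf =>
      (key _ φ ψ A A' t h hA hA' htf rfl).1 (hi.mono ht),
    fun hi => linearIndepOn_of_finite I fun t ht htf =>
      (key _ φ ψ A A' t h hA hA' htf rfl).2 (hi.mono ht)⟩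

end Coord

section LiftOfCoord

variable {X Y : Type*} [DecidableEq X] [DecidableEq Y]

lemma Coord.eq_zero_iff {L F V W : Type*} [Field L] [Field F] [AddCommGroup V] [Module L V]
    [AddCommGroup W] [Module F W] {φ : X ⊕ Y → V} {ψ : X ⊕ Y → W}
    (h : ∀ I : Set (X ⊕ Y), LinearIndepOn L φ I ↔ LinearIndepOn F ψ I) {A : X → Y → L}
    {B : X → Y → F} {σ : Equiv.Perm (X ⊕ Y)} (hA : Coord (φ ∘ σ) A) (hB : Coord (ψ ∘ σ) B)
    (x : X) (y : Y) : B x y = 0 ↔ A x y = 0 := by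
  have hinj : (σ ∘ Equiv.swap (Sum.inl x) (Sum.inr y) ∘ Sum.inl).Injective :=
    σ.injective.comp ((Equiv.injective _).comp Sum.inl_injective)
  rw [← not_iff_not]
  exact hB.ne_zero_iff.trans (((linearIndepOn_range_iff hinj ψ).symm.trans (h _).symm).trans
    ((linearIndepOn_range_iff hinj φ).trans hA.ne_zero_iff.symm))

/-- The matrices of a matroid over `ℚ` and `𝔽₃` with respect to the same base are lifts of each
other. -/
lemma lift_of_coord {V W : Type*} [AddCommGroup V] [Module ℚ V] [AddCommGroup W]
    [Module (ZMod 3) W] {φ : X ⊕ Y → V} {ψ : X ⊕ Y → W}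
    (h : ∀ I : Set (X ⊕ Y), LinearIndepOn ℚ φ I ↔ LinearIndepOn (ZMod 3) ψ I) {A : X → Y → ℚ}
    {B : X → Y → ZMod 3} (hA : Coord φ A) (hB : Coord ψ B) :
    Lift (dyadic (ZMod 3)) univ univ univ A B := by
  refine ⟨fun C D => ∃ σ : Equiv.Perm (X ⊕ Y), Coord (φ ∘ σ) C ∧ Coord (ψ ∘ σ) D,
    ⟨Equiv.refl _, hA, hB⟩, ?_⟩
  rintro C D ⟨σ, hC, hD⟩
  have hs := Coord.eq_zero_iff h hC hD
  have hpiv : ∀ x y, C x y ≠ 0 → Coord (φ ∘ ⇑((Equiv.swap (Sum.inl x) (Sum.inr y)).trans σ))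
      (pivot C x y) ∧ Coord (ψ ∘ ⇑((Equiv.swap (Sum.inl x) (Sum.inr y)).trans σ)) (pivot D x y) :=
    fun x y hxy => ⟨hC.pivot hxy, hD.pivot fun h0 => hxy ((hs x y).1 h0)⟩
  refine ⟨Good.of_ne (dyadic_liftFun (by decide)) (fun i _ c _ => hs i c) ?_,
    fun x _ y _ hxy => ⟨_, hpiv x y hxy⟩⟩
  intro i _ j _ c _ d _ hij hcd hic hjd hid hjc
  have hD' : ∀ {x y}, C x y ≠ 0 → D x y ≠ 0 := fun hxy h0 => hxy ((hs _ _).1 h0)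
  have hp := Coord.eq_zero_iff h (hpiv j d hjd).1 (hpiv j d hjd).2 i c
  rw [pivot_ne_eq_zero_iff _ hij hcd hjd hid hjc,
    pivot_ne_eq_zero_iff _ hij hcd (hD' hjd) (hD' hid) (hD' hjc), sub_eq_zero, sub_eq_zero] at hp
  by_cases h1 : 1 = cr C i j c d
  · rw [← h1, ← hp.2 h1, (dyadic_liftFun (by decide)).one]
  · have h0 : cr C i j c d ≠ 0 :=
      div_ne_zero (mul_ne_zero hic hjd) (mul_ne_zero hid hjc)
    have h0' : cr D i j c d ≠ 0 :=
      div_ne_zero (mul_ne_zero (hD' hic) (hD' hjd)) (mul_ne_zero (hD' hid) (hD' hjc))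
    rw [dyadic_zmod_three h0 (Ne.symm h1)]
    have key : ∀ z : ZMod 3, z ≠ 0 → 1 ≠ z → z = -1 := by decide
    exact key _ h0' (hp.not.2 h1)

/-- Applying a field embedding to the entries of a matrix is a lift. -/
lemma lift_map {L K : Type*} [Field L] [Field K] (τ : L →+* K) (A : X → Y → L) :
    Lift τ univ univ univ A (fun x y => τ (A x y)) := by
  refine ⟨fun C C' => C' = fun x y => τ (C x y), rfl, ?_⟩
  rintro C _ rfl
  refine ⟨⟨fun i _ c _ => map_eq_zero τ, fun i _ j _ c _ d _ _ _ => by simp [cr]⟩,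
    fun x _ y _ _ => ?_⟩
  funext i j
  unfold pivot
  split_ifs <;> simp

end LiftOfCoord

section Representable

variable {α : Type u} {M : Matroid α} {B : Set α}

/-- The labels of a matroid with respect to a base: elements of the base and the others. -/
def labels (M : Matroid α) (B : Set α) : B ⊕ (M.E \ B : Set α) → α :=
  Sum.elim Subtype.val Subtype.val

lemma labels_injective (M : Matroid α) (B : Set α) : (labels M B).Injective :=
  Subtype.val_injective.sumElim Subtype.val_injective fun x y h => y.2.2 (h ▸ x.2)

lemma range_labels (hB : B ⊆ M.E) : range (labels M B) = M.E := by
  rw [labels, Sum.elim_range, Subtype.range_val, Subtype.range_val, union_sdiff_cancel hB]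

variable {L V : Type*} [Field L] [AddCommGroup V] [Module L V] {φ : α → V}

lemma linearIndepOn_labels (hB : B ⊆ M.E) (hφ : ∀ I ⊆ M.E, (M.Indep I ↔ LinearIndepOn L φ I))
    (J : Set (B ⊕ (M.E \ B : Set α))) :
    M.Indep (labels M B '' J) ↔ LinearIndepOn L (φ ∘ labels M B) J := by
  rw [hφ _ ((image_subset_range _ _).trans (range_labels hB).subset)]
  exact ⟨fun h => h.comp_of_image (labels_injective M B).injOn, fun h => h.image_of_comp⟩

lemma exists_coord_labels (hB : M.IsBase B)
    (hφ : ∀ I ⊆ M.E, (M.Indep I ↔ LinearIndepOn L φ I)) :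
    ∃ A : B → (M.E \ B : Set α) → L, Coord (φ ∘ labels M B) A := by
  have hli : LinearIndepOn L φ B := (hφ B hB.subset_ground).1 hB.indep
  refine exists_coord hli fun y => ?_
  by_contra hy
  have hr : range ((φ ∘ labels M B) ∘ Sum.inl) = φ '' B := by
    rw [Function.comp_assoc, range_comp]
    congr 1
    exact Subtype.range_val
  rw [hr] at hy
  refine y.2.2 (hB.mem_of_insert_indep ((hφ _ ?_).2 (hli.insert hy)))
  exact insert_subset y.2.1 hB.subset_ground

lemma representable_of_lift [DecidableEq α] {K : Type v} [Field K] {f : L → K} (hB : M.IsBase B)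
    (hφ : ∀ I ⊆ M.E, (M.Indep I ↔ LinearIndepOn L φ I)) {A : B → (M.E \ B : Set α) → L}
    (hA : Coord (φ ∘ labels M B) A) {A' : B → (M.E \ B : Set α) → K}
    (h : Lift f univ univ univ A A') : Paper.Representable M K := by
  obtain ⟨ψ, hψ⟩ := exists_coord_eq (A := A') fun y => (hA.finite y).subset fun x hx h0 =>
    hx ((h.good.supp x trivial y trivial).2 h0)
  refine ⟨B →₀ K, inferInstance, inferInstance, Function.extend (labels M B) ψ 0, fun I hI => ?_⟩
  rw [← range_labels hB.subset_ground, subset_range_iff_exists_image_eq] at hI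
  obtain ⟨J, rfl⟩ := hI
  rw [linearIndepOn_labels hB.subset_ground hφ, h.linearIndepOn_iff hA hψ]
  have hext : Function.extend (labels M B) ψ 0 ∘ labels M B = ψ :=
    Function.extend_comp (labels_injective M B) ψ 0
  constructor
  · intro hJ
    exact LinearIndepOn.image_of_comp _ _ (by rwa [hext])
  · intro hJ
    have := LinearIndepOn.comp_of_image hJ (labels_injective M B).injOn
    rwa [hext] at this

/-- Representability is preserved by field extensions. -/
lemma representable_of_ringHom {L : Type w} [Field L] {K : Type v} [Field K] (τ : L →+* K)
    (h : Paper.Representable M L) : Paper.Representable M K := by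
  classical
  obtain ⟨V, _, _, φ, hφ⟩ := h
  obtain ⟨B, hB⟩ := M.exists_isBase
  obtain ⟨A, hA⟩ := exists_coord_labels hB hφ
  exact representable_of_lift hB hφ hA (lift_map τ A)

lemma representable_of_two_ne_zero (h3 : Paper.Representable M (ZMod 3))
    (hQ : Paper.Representable M ℚ) {K : Type v} [Field K] (h2 : (2 : K) ≠ 0) :
    Paper.Representable M K := by
  classical
  obtain ⟨V, _, _, φ, hφ⟩ := hQ
  obtain ⟨W, _, _, ψ, hψ⟩ := h3
  obtain ⟨B, hB⟩ := M.exists_isBase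
  obtain ⟨A, hA⟩ := exists_coord_labels hB hφ
  obtain ⟨D, hD⟩ := exists_coord_labels hB hψ
  have hl := lift_of_coord (fun J => (linearIndepOn_labels hB.subset_ground hφ J).symm.trans
    (linearIndepOn_labels hB.subset_ground hψ J)) hA hD
  obtain ⟨A', hA'⟩ := exists_lift_univ (dyadic_liftFun h2) (dyadic_liftFun (by decide))
    dyadic_trivialProducts (by norm_num) hA.finite hl
  exact representable_of_lift hB hφ hA hA'

end Representable

end DyadicLift

/-- A matroid `M` is representable over both `𝔽₃` and the field `ℚ` of
rational numbers if and only if `M` is representable over every field of characteristic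
different from `2`. -/
theorem representable_F3_and_Q_iff_representable_over_char_ne_two_fields
    {α : Type u} (M : Matroid α) :
    (Paper.Representable M (ZMod 3) ∧ Paper.Representable M ℚ) ↔
      ∀ (K : Type v) [Field K], ringChar K ≠ 2 → Paper.Representable M K := by
  constructor
  · rintro ⟨h3, hQ⟩ K _ hK
    exact DyadicLift.representable_of_two_ne_zero h3 hQ (Ring.two_ne_zero hK)
  · intro h
    have hchar : ∀ (K : Type v) [Field K], (2 : K) ≠ 0 → ringChar K ≠ 2 := fun K _ h2 hK =>
      h2 (by exact_mod_cast (ringChar.spec K 2).2 hK.dvd)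
    refine ⟨DyadicLift.representable_of_ringHom (ULift.ringEquiv (R := ZMod 3)).toRingHom
        (h (ULift.{v} (ZMod 3)) (hchar _ fun h2 => ?_)),
      DyadicLift.representable_of_ringHom (ULift.ringEquiv (R := ℚ)).toRingHom
        (h (ULift.{v} ℚ) (hchar _ fun h2 => ?_))⟩
    · exact absurd (congrArg ULift.down h2) (show (2 : ZMod 3) ≠ 0 by decide)
    · exact absurd (congrArg ULift.down h2) (show (2 : ℚ) ≠ 0 by norm_num)
end

section
/- A matroid M is representable over both 𝔽₃ and 𝔽₄ if and only if M is representable over every field K in which the polynomial X² − X + 1 has a root, i.e., every field K containing an element u with u² − u + 1 = 0 (this includes every field of characteristic 3 and every field containing a primitive sixth root of unity). -/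
universe u v w

open Matroid Set

namespace Paper

/-- `φ` represents `M` over `K`: independence in `M` is linear independence of the images. -/
def IsRep {α : Type*} (M : Matroid α) (K : Type*) [Field K] {V : Type*} [AddCommGroup V]
    [Module K V] (φ : α → V) : Prop :=
  ∀ I ⊆ M.E, (M.Indep I ↔ LinearIndepOn K φ I)

/-- Each row `c e` with `e ∈ E` expresses `φ e` as a linear combination of the `φ b`, `b ∈ B`. -/
def IsCoords {α K V : Type*} [Field K] [AddCommGroup V] [Module K V] (φ : α → V) (E B : Set α)
    (c : α → α →₀ K) : Prop :=
  ∀ e ∈ E, c e ∈ Finsupp.supported K K B ∧ Finsupp.linearCombination K φ (c e) = φ e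

/-- The coordinates after exchanging the basis element `b` for `f`. -/
noncomputable def pivot {α K : Type*} [Field K] (c : α → α →₀ K) (b f e : α) : α →₀ K :=
  c e + (c e b / c f b) • (Finsupp.single f 1 - c f)

/-- Two scalars agree in being zero or nonzero; equivalently, the pair is either zero or a unit
of the product ring. -/
def Compat {F F' : Type*} [Zero F] [Zero F'] (x : F) (y : F') : Prop := x = 0 ↔ y = 0

/-- A homomorphism to `K` from the product partial field of `F` and `F'`. -/
structure IsPartialHom {F F' K : Type*} [Field F] [Field F'] [Field K] (h : F → F' → K) :
    Prop where
  map_one : h 1 1 = 1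
  map_mul : ∀ a b a' b', h (a * b) (a' * b') = h a a' * h b b'
  map_sub : ∀ a b a' b', Compat a a' → Compat b b' → Compat (a - b) (a' - b') →
    h (a - b) (a' - b') = h a a' - h b b'

namespace IsPartialHom

variable {F F' K : Type*} [Field F] [Field F'] [Field K] {h : F → F' → K}

lemma map_zero (hh : IsPartialHom h) : h 0 0 = 0 := by
  simpa using hh.map_sub 1 1 1 1 (by simp [Compat]) (by simp [Compat]) (by simp [Compat])

lemma map_ne_zero (hh : IsPartialHom h) {a : F} {a' : F'} (ha : a ≠ 0) (ha' : a' ≠ 0) :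
    h a a' ≠ 0 := by
  intro h0
  have := hh.map_mul a a⁻¹ a' a'⁻¹
  rw [mul_inv_cancel₀ ha, mul_inv_cancel₀ ha', hh.map_one, h0, zero_mul] at this
  exact one_ne_zero this

lemma map_div (hh : IsPartialHom h) {a b : F} {a' b' : F'} (hb : b ≠ 0) (hb' : b' ≠ 0) :
    h (a / b) (a' / b') = h a a' / h b b' := by
  rw [eq_div_iff (hh.map_ne_zero hb hb'), ← hh.map_mul, div_mul_cancel₀ _ hb,
    div_mul_cancel₀ _ hb']

end IsPartialHom

section Coords

variable {α K V : Type*} [Field K] [AddCommGroup V] [Module K V] {φ : α → V} {E B J : Set α}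
  {c : α → α →₀ K} {b e f : α}

lemma linearCombination_mem_span_iff (hB : LinearIndepOn K φ B) (hJ : J ⊆ B) {l : α →₀ K}
    (hl : l ∈ Finsupp.supported K K B) :
    Finsupp.linearCombination K φ l ∈ Submodule.span K (φ '' J) ↔
      l ∈ Finsupp.supported K K J := by
  rw [Finsupp.mem_span_image_iff_linearCombination]
  constructor
  · rintro ⟨l', hl', h⟩
    have := linearIndepOn_iff.1 hB (l' - l)
      (Submodule.sub_mem _ (Finsupp.supported_mono hJ hl') hl) (by rw [map_sub, h, sub_self])
    rwa [← sub_eq_zero.1 this]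
  · exact fun h ↦ ⟨l, h, rfl⟩

lemma mem_supported_diff_singleton_iff {l : α →₀ K} {x : α} (hl : l ∈ Finsupp.supported K K B) :
    l ∈ Finsupp.supported K K (B \ {x}) ↔ l x = 0 := by
  rw [Finsupp.mem_supported'] at hl ⊢
  constructor
  · exact fun h ↦ h x (by simp)
  · intro h y hy
    by_cases hyx : y = x
    · rwa [hyx]
    · exact hl y fun hyB ↦ hy ⟨hyB, hyx⟩

lemma IsCoords.apply_eq_zero_iff_mem_span (hc : IsCoords φ E B c) (hB : LinearIndepOn K φ B)
    (he : e ∈ E) (x : α) : c e x = 0 ↔ φ e ∈ Submodule.span K (φ '' (B \ {x})) := by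
  rw [← (hc e he).2, linearCombination_mem_span_iff hB sdiff_subset (hc e he).1,
    mem_supported_diff_singleton_iff (hc e he).1]

lemma IsCoords.pivot (hc : IsCoords φ E B c) (hf : f ∈ E) (hfb : c f b ≠ 0) :
    IsCoords φ E (insert f (B \ {b})) (pivot c b f) := by
  classical
  intro e he
  refine ⟨?_, ?_⟩
  · have h₁ := (Finsupp.mem_supported' _ _).1 (hc e he).1
    have h₂ := (Finsupp.mem_supported' _ _).1 (hc f hf).1
    rw [Finsupp.mem_supported']
    intro x hx
    simp only [mem_insert_iff, mem_sdiff, mem_singleton_iff, not_or, not_and, not_not] at hx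
    by_cases hxB : x ∈ B
    · obtain rfl := hx.2 hxB
      simp [Paper.pivot, Ne.symm hx.1, hfb]
    · simp [Paper.pivot, Ne.symm hx.1, h₁ x hxB, h₂ x hxB]
  · simp [Paper.pivot, (hc e he).2, (hc f hf).2]

lemma IsCoords.linearIndepOn_exchange (hc : IsCoords φ E B c) (hB : LinearIndepOn K φ B)
    (hf : f ∈ E) (hfb : c f b ≠ 0) : LinearIndepOn K φ (insert f (B \ {b})) :=
  (hB.mono sdiff_subset).insert fun h ↦ hfb ((hc.apply_eq_zero_iff_mem_span hB hf b).2 h)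

end Coords

namespace IsRep

variable {α K V : Type*} {M : Matroid α} [Field K] [AddCommGroup V] [Module K V] {φ : α → V}
  {B J : Set α} {c : α → α →₀ K} {e : α}

lemma mem_span_iff (hφ : IsRep M K φ) (hJ : M.Indep J) (he : e ∈ M.E) :
    φ e ∈ Submodule.span K (φ '' J) ↔ e ∈ M.closure J := by
  rw [((hφ J hJ.subset_ground).1 hJ).mem_span_iff, hJ.mem_closure_iff',
    hφ _ (insert_subset he hJ.subset_ground)]
  simp [he]

lemma exists_isCoords (hφ : IsRep M K φ) (hB : M.IsBase B) :
    ∃ c : α → α →₀ K, IsCoords φ M.E B c := by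
  have (e : α) : ∃ l : α →₀ K, e ∈ M.E →
      l ∈ Finsupp.supported K K B ∧ Finsupp.linearCombination K φ l = φ e := by
    by_cases he : e ∈ M.E
    · have hs := (hφ.mem_span_iff hB.indep he).2 (by rwa [hB.closure_eq])
      obtain ⟨l, hl⟩ := (Finsupp.mem_span_image_iff_linearCombination K).1 hs
      exact ⟨l, fun _ ↦ hl⟩
    · exact ⟨0, fun h ↦ absurd h he⟩
  choose c hc using this
  exact ⟨c, hc⟩

lemma apply_eq_zero_iff_mem_closure (hφ : IsRep M K φ) (hB : M.IsBase B)
    (hc : IsCoords φ M.E B c) (he : e ∈ M.E) (x : α) :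
    c e x = 0 ↔ e ∈ M.closure (B \ {x}) := by
  rw [hc.apply_eq_zero_iff_mem_span ((hφ B hB.subset_ground).1 hB.indep) he,
    hφ.mem_span_iff (hB.indep.subset sdiff_subset) he]

lemma coords_eq_single (hφ : IsRep M K φ) (hB : M.IsBase B) (hc : IsCoords φ M.E B c)
    (he : e ∈ B) : c e = Finsupp.single e 1 := by
  have := linearIndepOn_iff.1 ((hφ B hB.subset_ground).1 hB.indep) (c e - Finsupp.single e 1)
    (Submodule.sub_mem _ (hc e (hB.subset_ground he)).1 (Finsupp.single_mem_supported K 1 he))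
    (by simp [(hc e (hB.subset_ground he)).2])
  exact sub_eq_zero.1 this

end IsRep

section Lift

variable {α F F' K V V' W : Type*} {M : Matroid α} [Field F] [Field F'] [Field K]
  [AddCommGroup V] [Module F V] [AddCommGroup V'] [Module F' V'] [AddCommGroup W] [Module K W]
  {φ : α → V} {φ' : α → V'} {ψ : α → W} {h : F → F' → K} {B I : Set α}

/-- With respect to the base `B`, the coordinates of `ψ` are the images under the partial
homomorphism `h` of those of `φ` and `φ'`. -/
def LiftsAt (M : Matroid α) (φ : α → V) (φ' : α → V') (hh : IsPartialHom h) (ψ : α → W)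
    (B : Set α) : Prop :=
  LinearIndepOn K ψ B ∧ ∃ (c : α → α →₀ F) (c' : α → α →₀ F'),
    IsCoords φ M.E B c ∧ IsCoords φ' M.E B c' ∧
    IsCoords ψ M.E B (fun e ↦ Finsupp.zipWith h hh.map_zero (c e) (c' e))

lemma IsRep.compat_coords (hφ : IsRep M F φ) (hφ' : IsRep M F' φ') (hB : M.IsBase B)
    {c : α → α →₀ F} {c' : α → α →₀ F'} (hc : IsCoords φ M.E B c) (hc' : IsCoords φ' M.E B c')
    {e : α} (he : e ∈ M.E) (x : α) : Compat (c e x) (c' e x) := by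
  exact (hφ.apply_eq_zero_iff_mem_closure hB hc he x).trans
    (hφ'.apply_eq_zero_iff_mem_closure hB hc' he x).symm

/-- Pivoting commutes with a partial homomorphism, since every entry involved is zero or a
unit. -/
lemma LiftsAt.exchange (hφ : IsRep M F φ) (hφ' : IsRep M F' φ') (hh : IsPartialHom h)
    (hψ : LiftsAt M φ φ' hh ψ B) (hB : M.IsBase B) {b f : α} (hf : f ∈ M.E) (hfB : f ∉ B)
    (hfb : f ∉ M.closure (B \ {b})) :
    M.IsBase (insert f (B \ {b})) ∧ LiftsAt M φ φ' hh ψ (insert f (B \ {b})) := by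
  classical
  obtain ⟨hψB, c, c', hc, hc', hcψ⟩ := hψ
  have hcfb : c f b ≠ 0 := fun h0 ↦ hfb ((hφ.apply_eq_zero_iff_mem_closure hB hc hf b).1 h0)
  have hcfb' : c' f b ≠ 0 := fun h0 ↦ hfb ((hφ'.apply_eq_zero_iff_mem_closure hB hc' hf b).1 h0)
  have hB' : M.IsBase (insert f (B \ {b})) := by
    refine hB.exchange_isBase_of_indep hfB ?_
    rw [hφ _ (insert_subset hf (sdiff_subset.trans hB.subset_ground))]
    exact hc.linearIndepOn_exchange ((hφ B hB.subset_ground).1 hB.indep) hf hcfb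
  have hcψfb : h (c f b) (c' f b) ≠ 0 := hh.map_ne_zero hcfb hcfb'
  refine ⟨hB', hcψ.linearIndepOn_exchange hψB hf (by simpa using hcψfb), Paper.pivot c b f,
    Paper.pivot c' b f, hc.pivot hf hcfb, hc'.pivot hf hcfb', fun e he ↦ ?_⟩
  have hpiv := hcψ.pivot (b := b) hf (by simpa using hcψfb) e he
  suffices hcomm : Finsupp.zipWith h hh.map_zero (Paper.pivot c b f e) (Paper.pivot c' b f e) =
      Paper.pivot (fun e ↦ Finsupp.zipWith h hh.map_zero (c e) (c' e)) b f e by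
    rwa [← hcomm] at hpiv
  · ext x
    have hcompat := hφ.compat_coords hφ' hB' (hc.pivot hf hcfb) (hc'.pivot hf hcfb') he x
    have hfx : x = f → c e x = 0 ∧ c f x = 0 ∧ c' e x = 0 ∧ c' f x = 0 := by
      rintro rfl
      exact ⟨(Finsupp.mem_supported' _ _).1 (hc e he).1 _ hfB,
        (Finsupp.mem_supported' _ _).1 (hc x hf).1 _ hfB,
        (Finsupp.mem_supported' _ _).1 (hc' e he).1 _ hfB,
        (Finsupp.mem_supported' _ _).1 (hc' x hf).1 _ hfB⟩
    by_cases hx : x = f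
    · obtain ⟨h₁, h₂, h₃, h₄⟩ := hfx hx
      subst hx
      simp [Paper.pivot, h₁, h₂, h₃, h₄, hh.map_zero, hh.map_div hcfb hcfb']
    · have hcf := hφ.compat_coords hφ' hB hc hc' hf
      have hce := hφ.compat_coords hφ' hB hc hc' he
      have hprod : Compat (c e b / c f b * c f x) (c' e b / c' f b * c' f x) := by
        have := hcf x
        have := hce b
        simp only [Compat] at *
        simp [*]
      simp only [Paper.pivot, Finsupp.coe_add, Finsupp.coe_smul, Finsupp.coe_sub, Pi.add_apply,
        Pi.smul_apply, Pi.sub_apply, Finsupp.single_apply, Ne.symm hx, if_false, zero_sub,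
        smul_eq_mul, mul_neg, ← sub_eq_add_neg, Finsupp.zipWith_apply] at hcompat ⊢
      rw [hh.map_sub _ _ _ _ (hce x) hprod hcompat, hh.map_mul, hh.map_div hcfb hcfb']

lemma LiftsAt.exists_superset (hφ : IsRep M F φ) (hφ' : IsRep M F' φ') (hh : IsPartialHom h)
    (hψ : LiftsAt M φ φ' hh ψ B) (hB : M.IsBase B) (hI : M.Indep I) (hfin : I.Finite) :
    ∃ B', M.IsBase B' ∧ I ⊆ B' ∧ LiftsAt M φ φ' hh ψ B' := by
  induction hn : (I \ B).ncard using Nat.strong_induction_on generalizing B with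
  | _ n ih =>
    subst hn
    by_cases hIB : I ⊆ B
    · exact ⟨B, hB, hIB, hψ⟩
    obtain ⟨f, hfI, hfB⟩ := not_subset.1 hIB
    have hfE := hI.subset_ground hfI
    have hex : ∃ b ∈ B \ I, f ∉ M.closure (B \ {b}) := by
      by_contra! hcon
      obtain ⟨-, c, -, hc, -, -⟩ := hψ
      have hsupp : c f ∈ Finsupp.supported F F (I \ {f}) := by
        rw [Finsupp.mem_supported']
        intro x hx
        by_cases hxB : x ∈ B
        · have hxI : x ∉ I := fun hxI ↦ hx ⟨hxI, fun hxf ↦ hfB (hxf ▸ hxB)⟩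
          exact (hφ.apply_eq_zero_iff_mem_closure hB hc hfE x).2 (hcon x ⟨hxB, hxI⟩)
        · exact (Finsupp.mem_supported' _ _).1 (hc f hfE).1 x hxB
      exact ((hφ I hI.subset_ground).1 hI).notMem_span hfI
        ((Finsupp.mem_span_image_iff_linearCombination F).2 ⟨_, hsupp, (hc f hfE).2⟩)
    obtain ⟨b, ⟨hbB, hbI⟩, hfb⟩ := hex
    obtain ⟨hB', hψ'⟩ := hψ.exchange hφ hφ' hh hB hfE hfB hfb
    refine ih _ (ncard_lt_ncard ⟨?_, fun hsub ↦ ?_⟩ hfin.sdiff) hψ' hB' rfl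
    · rintro x ⟨hxI, hx⟩
      refine ⟨hxI, fun hxB ↦ hx (Or.inr ⟨hxB, ?_⟩)⟩
      rintro rfl
      exact hbI hxI
    · exact (hsub ⟨hfI, hfB⟩).2 (mem_insert f _)

lemma LiftsAt.isRep (hφ : IsRep M F φ) (hφ' : IsRep M F' φ') (hh : IsPartialHom h)
    (hψ : LiftsAt M φ φ' hh ψ B) (hB : M.IsBase B) : IsRep M K ψ := by
  intro I hI
  constructor
  · intro hIi
    rw [linearIndepOn_iff_linearIndepOn_finset]
    intro J hJ
    obtain ⟨B', -, hJB', hψ'⟩ :=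
      hψ.exists_superset hφ hφ' hh hB (hIi.subset hJ) J.finite_toSet
    exact hψ'.1.mono hJB'
  · intro hIψ
    rw [hφ I hI, linearIndepOn_iff_linearIndepOn_finset]
    intro J hJ
    rw [← hφ _ (hJ.trans hI)]
    obtain ⟨J₀, hJ₀⟩ := M.exists_isBasis (J : Set α) (hJ.trans hI)
    suffices (J : Set α) ⊆ J₀ from hJ₀.indep.subset this
    intro e heJ
    by_contra heJ₀
    have heE := hI (hJ heJ)
    obtain ⟨B', hB', hJB', -, c, c', hc, hc', hcψ⟩ :=
      hψ.exists_superset hφ hφ' hh hB hJ₀.indep (J.finite_toSet.subset hJ₀.subset)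
    have hzero : ∀ x ∉ J₀, e ∈ M.closure (B' \ {x}) := fun x hx ↦
      M.closure_subset_closure (subset_sdiff_singleton hJB' hx) (hJ₀.subset_closure heJ)
    refine (hIψ.mono hJ).notMem_span heJ (Submodule.span_mono
      (image_mono (subset_sdiff_singleton hJ₀.subset heJ₀))
      ((Finsupp.mem_span_image_iff_linearCombination K).2 ⟨_, ?_, (hcψ e heE).2⟩))
    rw [Finsupp.mem_supported']
    intro x hx
    simp [(hφ.apply_eq_zero_iff_mem_closure hB' hc heE x).2 (hzero x hx),
      (hφ'.apply_eq_zero_iff_mem_closure hB' hc' heE x).2 (hzero x hx), hh.map_zero]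

lemma IsRep.exists_of_isPartialHom (hφ : IsRep M F φ) (hφ' : IsRep M F' φ')
    (hh : IsPartialHom h) : ∃ ψ : α → (α →₀ K), IsRep M K ψ := by
  classical
  obtain ⟨B, hB⟩ := M.exists_isBase
  obtain ⟨c, hc⟩ := hφ.exists_isCoords hB
  obtain ⟨c', hc'⟩ := hφ'.exists_isCoords hB
  set ψ : α → (α →₀ K) := fun e ↦ Finsupp.zipWith h hh.map_zero (c e) (c' e) with hψ
  have hψB : ∀ b ∈ B, ψ b = Finsupp.single b 1 := by
    intro b hb
    ext x
    simp only [hψ, hφ.coords_eq_single hB hc hb, hφ'.coords_eq_single hB hc' hb,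
      Finsupp.zipWith_apply, Finsupp.single_apply]
    split_ifs
    · exact hh.map_one
    · exact hh.map_zero
  have hlin : ∀ l ∈ Finsupp.supported K K B, Finsupp.linearCombination K ψ l = l := by
    intro l hl
    rw [Finsupp.linearCombination_apply]
    conv_rhs => rw [← l.sum_single]
    refine Finsupp.sum_congr fun x hx ↦ ?_
    rw [hψB x (hl hx)]
    simp
  refine ⟨ψ, LiftsAt.isRep (B := B) hφ hφ' hh ⟨?_, c, c', hc, hc', fun e he ↦ ?_⟩ hB⟩
  · rw [linearIndepOn_iff]
    intro l hl h0
    rwa [hlin l hl] at h0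
  · have hsupp : ψ e ∈ Finsupp.supported K K B := by
      rw [Finsupp.mem_supported']
      intro x hx
      simp [hψ, (Finsupp.mem_supported' _ _).1 (hc e he).1 x hx,
        (Finsupp.mem_supported' _ _).1 (hc' e he).1 x hx, hh.map_zero]
    exact ⟨hsupp, hlin _ hsupp⟩

end Lift

lemma Representable.of_isPartialHom {α : Type u} {M : Matroid α} {F : Type*} {F' : Type*}
    {K : Type v} [Field F] [Field F'] [Field K] {h : F → F' → K} (hh : IsPartialHom h)
    (hF : Representable M F) (hF' : Representable M F') : Representable M K := by
  obtain ⟨V, _, _, φ, hφ⟩ := hF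
  obtain ⟨V', _, _, φ', hφ'⟩ := hF'
  obtain ⟨ψ, hψ⟩ := IsRep.exists_of_isPartialHom (φ := φ) (φ' := φ') hφ hφ' hh
  exact ⟨α →₀ K, inferInstance, inferInstance, ψ, hψ⟩

lemma Representable.of_ringHom {α : Type u} {M : Matroid α} {F : Type*} {K : Type v} [Field F]
    [Field K] (σ : F →+* K) (hF : Representable M F) : Representable M K :=
  hF.of_isPartialHom (h := fun x _ ↦ σ x)
    ⟨map_one σ, fun _ _ _ _ ↦ map_mul σ _ _, fun _ _ _ _ _ _ _ ↦ map_sub σ _ _⟩ hF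

/-- The field with four elements is generated by a primitive cube root of unity. -/
lemma exists_omega_galoisField : ∃ ω : GaloisField 2 2, ω ^ 2 + ω + 1 = 0 ∧
    ∀ y : GaloisField 2 2, y = 0 ∨ y = 1 ∨ y = ω ∨ y = ω + 1 := by
  classical
  have : Fintype (GaloisField 2 2) := Fintype.ofFinite _
  have hcard : Fintype.card (GaloisField 2 2) = 4 := by
    rw [← Nat.card_eq_fintype_card, GaloisField.card 2 2 (by norm_num)]
    norm_num
  have h4 (y : GaloisField 2 2) : y ^ 4 = y := by
    have := FiniteField.pow_card y
    rwa [hcard] at this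
  have h2 : (2 : GaloisField 2 2) = 0 := CharTwo.two_eq_zero
  obtain ⟨ω, hω⟩ : ∃ ω : GaloisField 2 2, ω ∉ ({0, 1} : Finset (GaloisField 2 2)) := by
    by_contra! hcon
    have := Finset.card_le_card
      (fun x _ ↦ hcon x : Finset.univ ⊆ ({0, 1} : Finset (GaloisField 2 2)))
    rw [Finset.card_univ, hcard] at this
    exact absurd (this.trans Finset.card_le_two) (by norm_num)
  simp only [Finset.mem_insert, Finset.mem_singleton, not_or] at hω
  have hmin : ω ^ 2 + ω + 1 = 0 := by
    have : ω * ((ω - 1) * (ω ^ 2 + ω + 1)) = 0 := by linear_combination h4 ω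
    exact ((mul_eq_zero.1 this).resolve_left hω.1 |> mul_eq_zero.1).resolve_left
      (sub_ne_zero.2 hω.2)
  refine ⟨ω, hmin, fun y ↦ ?_⟩
  have : y * ((y - 1) * ((y - ω) * (y - (ω + 1)))) = 0 := by
    linear_combination h4 y + (y ^ 2 - y) * hmin +
      (-y ^ 3 + y ^ 2 - ω * y ^ 3 + ω * y ^ 2 + y - y ^ 2) * h2
  simpa [sub_eq_zero] using this

/-- The partial homomorphism sending the generator `(-1, ω)` of the units of `𝔽₃ × 𝔽₄` to a
root `u` of `X² - X + 1`. -/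
lemma exists_isPartialHom_of_root {K : Type*} [Field K] {u : K} (hu : u ^ 2 - u + 1 = 0) :
    ∃ h : ZMod 3 → GaloisField 2 2 → K, IsPartialHom h := by
  classical
  obtain ⟨ω, hω, hcases⟩ := exists_omega_galoisField
  have h2 : (1 : GaloisField 2 2) + 1 = 0 := CharTwo.add_self_eq_zero 1
  have hω0 : ω ≠ 0 := by rintro rfl; simp at hω
  have hω1 : ω ≠ 1 := by
    rintro rfl
    exact one_ne_zero (by linear_combination hω - h2 : (1 : GaloisField 2 2) = 0)
  have hω2 : ω + 1 ≠ 0 := fun h0 ↦ hω1 (by linear_combination h0 - h2)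
  have hω3 : ω + 1 ≠ 1 := by simpa using hω0
  have hω4 : ω + 1 ≠ ω := by simp
  have hmul₁ : ω * ω = ω + 1 := by linear_combination hω - (ω + 1) * h2
  have hmul₂ : ω * (ω + 1) = 1 := by linear_combination hω - h2
  have hmul₃ : (ω + 1) * ω = 1 := by rw [mul_comm, hmul₂]
  have hmul₄ : (ω + 1) * (ω + 1) = ω := by linear_combination hω
  have hsub₁ : ω - 1 = ω + 1 := by linear_combination -h2
  let s : ZMod 3 → K := fun x ↦ if x = 0 then 0 else if x = 1 then 1 else -1
  let t : GaloisField 2 2 → K := fun y ↦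
    if y = 0 then 0 else if y = 1 then 1 else if y = ω then -u else u - 1
  have hs0 : s 0 = 0 := rfl
  have hs1 : s 1 = 1 := rfl
  have hs2 : s 2 = -1 := rfl
  have ht0 : t 0 = 0 := by simp [t]
  have ht1 : t 1 = 1 := by simp [t]
  have htω : t ω = -u := by simp [t, hω0, hω1]
  have htω' : t (ω + 1) = u - 1 := by simp only [t, hω2, hω3, hω4, if_false]
  have hZ (x : ZMod 3) : x = 0 ∨ x = 1 ∨ x = 2 := by decide +revert
  have hsmul (a b : ZMod 3) : s (a * b) = s a * s b := by
    have h3 : (2 : ZMod 3) * 2 = 1 := rfl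
    rcases hZ a with rfl | rfl | rfl <;> rcases hZ b with rfl | rfl | rfl <;>
      simp [hs0, hs1, hs2, h3]
  have htmul (a b : GaloisField 2 2) : t (a * b) = t a * t b := by
    rcases hcases a with rfl | rfl | rfl | rfl <;> rcases hcases b with rfl | rfl | rfl | rfl <;>
      simp only [zero_mul, mul_zero, one_mul, mul_one, hmul₁, hmul₂, hmul₃, hmul₄, ht0, ht1, htω,
        htω'] <;>
      first | ring1 | linear_combination hu | linear_combination -hu
  have hone (x : ZMod 3) (y : GaloisField 2 2) (hxy : Compat x y)
      (hxy' : Compat (x - 1) (y - 1)) : s (x - 1) * t (y - 1) = s x * t y - 1 := by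
    have h₁ : (2 : ZMod 3) - 1 = 1 := rfl
    have h₂ : (0 : ZMod 3) - 1 = 2 := rfl
    have h₃ : (0 : GaloisField 2 2) - 1 = 1 := by linear_combination -h2
    have h₄ : ω + 1 - 1 = ω := by ring
    have h₅ : (2 : ZMod 3) ≠ 0 := by decide
    rcases hZ x with rfl | rfl | rfl <;> rcases hcases y with rfl | rfl | rfl | rfl <;>
      simp only [Compat, h₁, h₂, h₃, h₄, h₅, hsub₁, hω0, hω2, one_ne_zero, sub_self, iff_true,
        iff_false, not_true] at hxy hxy' <;>
      simp only [h₁, h₂, h₃, h₄, hsub₁, hs0, hs1, hs2, ht0, ht1, htω, htω', sub_self] <;>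
      ring1
  refine ⟨fun x y ↦ s x * t y, by simp [hs1, ht1], fun a b a' b' ↦ ?_,
    fun a b a' b' ha hb hab ↦ ?_⟩
  · simp only [hsmul, htmul]
    ring
  by_cases hb0 : b = 0
  · have hb0' := hb.1 hb0
    simp [hb0, hb0', hs0]
  have hb0' : b' ≠ 0 := fun h0 ↦ hb0 (hb.2 h0)
  have hdiv : a / b - 1 = (a - b) / b := by field_simp
  have hdiv' : a' / b' - 1 = (a' - b') / b' := by field_simp
  have key := hone (a / b) (a' / b') (by simpa [Compat, hb0, hb0'] using ha)
    (by rw [hdiv, hdiv']; simpa [Compat, hb0, hb0'] using hab)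
  have e₁ : s (a - b) = s (a / b - 1) * s b := by rw [← hsmul, hdiv, div_mul_cancel₀ _ hb0]
  have e₂ : t (a' - b') = t (a' / b' - 1) * t b' := by
    rw [← htmul, hdiv', div_mul_cancel₀ _ hb0']
  have e₃ : s a = s (a / b) * s b := by rw [← hsmul, div_mul_cancel₀ _ hb0]
  have e₄ : t a' = t (a' / b') * t b' := by rw [← htmul, div_mul_cancel₀ _ hb0']
  rw [e₁, e₂, e₃, e₄]
  linear_combination (s b * t b') * key

end Paper

/-- A matroid `M` is representable over both `𝔽₃` and `𝔽₄` if and only if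
`M` is representable over every field `K` containing an element `u` with `u² − u + 1 = 0`
(this includes every field of characteristic `3` and every field containing a primitive
sixth root of unity). -/
theorem representable_F3_and_F4_iff_hexagonal_fields {α : Type u} (M : Matroid α) :
    (Paper.Representable M (ZMod 3) ∧ Paper.Representable M (GaloisField 2 2)) ↔
      ∀ (K : Type v) [Field K], (∃ u : K, u ^ 2 - u + 1 = 0) → Paper.Representable M K := by
  constructor
  · rintro ⟨h3, h4⟩ K _ ⟨u, hu⟩
    obtain ⟨h, hh⟩ := Paper.exists_isPartialHom_of_root hu
    exact h3.of_isPartialHom hh h4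
  · intro hK
    constructor
    · refine Paper.Representable.of_ringHom ULift.ringEquiv.{0, v}.toRingHom
        (hK (ULift.{v} (ZMod 3)) ⟨-1, ULift.ext _ _ ?_⟩)
      simp only [ULift.add_down, ULift.sub_down, ULift.pow_down, ULift.neg_down, ULift.one_down,
        ULift.zero_down]
      decide
    · obtain ⟨ω, hω, -⟩ := Paper.exists_omega_galoisField
      refine Paper.Representable.of_ringHom ULift.ringEquiv.{0, v}.toRingHom
        (hK (ULift.{v} (GaloisField 2 2)) ⟨⟨-ω⟩, ULift.ext _ _ ?_⟩)
      simp only [ULift.add_down, ULift.sub_down, ULift.pow_down, ULift.one_down, ULift.zero_down]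
      linear_combination hω
end

section
/- Let M be a matroid without large uniform minors. Then M is representable over 𝔽₄ if and only if M is representable over every field K that admits a ring homomorphism from 𝔽₄ (equivalently, over every field extension of 𝔽₄). -/
universe u v w

open Matroid Set

open scoped TensorProduct

/-- Representability does not depend on the universe of the representing vector space: it can
be replaced by a quotient of `α →₀ K`. -/
theorem Paper.representable_of_linearIndependent_iff {α : Type u} (M : Matroid α) {K : Type v}
    [Field K] {V : Type w} [AddCommGroup V] [Module K V] (φ : α → V)
    (hφ : ∀ I ⊆ M.E, (M.Indep I ↔ LinearIndependent K (fun x : I => φ x))) :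
    Paper.Representable M K := by
  let f : (α →₀ K) →ₗ[K] V := Finsupp.linearCombination K φ
  let g : ((α →₀ K) ⧸ LinearMap.ker f) →ₗ[K] V := (LinearMap.ker f).liftQ f le_rfl
  have hg : LinearMap.ker g = ⊥ := Submodule.ker_liftQ_eq_bot _ _ _ le_rfl
  refine ⟨_, inferInstance, inferInstance,
    fun a => (LinearMap.ker f).mkQ (Finsupp.single a 1), fun I hI => (hφ I hI).trans ?_⟩
  rw [← g.linearIndependent_iff hg]
  simp [g, f, Function.comp_def]

/-- A representation over a field yields a representation over any extension of that field. -/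
theorem Paper.Representable.of_ringHom_s12 {α : Type u} {M : Matroid α} {F : Type v} [Field F]
    {K : Type w} [Field K] (h : Paper.Representable M F) (i : F →+* K) :
    Paper.Representable M K := by
  obtain ⟨V, _, _, φ, hφ⟩ := h
  algebraize [i]
  refine Paper.representable_of_linearIndependent_iff M (fun a => (1 : K) ⊗ₜ[F] φ a)
    fun I hI => (hφ I hI).trans ⟨Module.Flat.linearIndependent_one_tmul, fun h => ?_⟩
  exact (h.restrict_scalars' F).of_comp (TensorProduct.mk F K V 1)

/-- Let `M` be a matroid without large uniform minors. Then `M` is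
representable over `𝔽₄` if and only if `M` is representable over every field `K` that
admits a ring homomorphism from `𝔽₄` (equivalently, over every field extension of `𝔽₄`). -/
theorem representable_F4_iff_representable_over_extensions_of_F4
    {α : Type u} (M : Matroid α) (hM : Paper.NoLargeUniformMinors M) :
    Paper.Representable M (GaloisField 2 2) ↔
      ∀ (K : Type v) [Field K], Nonempty (GaloisField 2 2 →+* K) → Paper.Representable M K := by
  refine ⟨fun h K _ ⟨i⟩ => h.of_ringHom_s12 i, fun h => ?_⟩
  exact (h (ULift (GaloisField 2 2)) ⟨ULift.ringEquiv.symm.toRingHom⟩).of_ringHom_s12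
    ULift.ringEquiv.toRingHom
end
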